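/- Let w be a word over the positive integers, let Q(w) be its RSK recording tableau and Q'(w) its shifted mixed insertion recording tableau. If Q(w) is viewed as a skew shifted standard Young tableau and jeu de taquin is applied to obtain a standard shifted Young tableau, the result is Q'(w), independent of any choices made in applying jeu de taquin. -/

import Mathlib

/-! ### Tableau machinery: fillings as functions `ℕ × ℕ → ℕ` (entry `0` = empty/absent cell) -/

/-- One jeu de taquin slide: starting from an empty box at position `c`, repeatedly swap the
empty box with the smaller of the entries directly to its right and directly below it
(`0` denotes an empty/absent cell), until neither exists.  Returns the resulting filling
together with the final position of the empty box; `fuel` bounds the number of steps. -/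
def jdtSlide : ℕ → ((ℕ × ℕ) → ℕ) → (ℕ × ℕ) → (((ℕ × ℕ) → ℕ) × (ℕ × ℕ))
  | 0, f, c => (f, c)
  | fuel+1, f, c =>
    let a := c.1
    let b := c.2
    let r := f (a, b+1)
    let d := f (a+1, b)
    if r = 0 ∧ d = 0 then (f, c)
    else if d = 0 ∨ (r ≠ 0 ∧ r < d) then
      jdtSlide fuel (Function.update (Function.update f (a, b+1) 0) (a, b) r) (a, b+1)
    else
      jdtSlide fuel (Function.update (Function.update f (a+1, b) 0) (a, b) d) (a+1, b)

/-- Jeu de taquin promotion of a standard filling with `N` boxes: delete the entry `1`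
(in the upper left corner `(0,0)`), decrease every other entry by `1`, slide the empty box
by jeu de taquin, and fill the final empty box with `N`. -/
def promote (N : ℕ) (f : (ℕ × ℕ) → ℕ) : (ℕ × ℕ) → ℕ :=
  let s := jdtSlide N (fun c => f c - 1) (0, 0)
  Function.update s.1 s.2 N

/-- The cells of the (straight-shape) Young diagram of a partition `lam`:
row `a` consists of the cells `(a, b)` with `b < lam a`. -/
def strCell (lam : List ℕ) (c : ℕ × ℕ) : Prop := c.2 < lam.getD c.1 0

/-- The cells of the shifted Young diagram of a strict partition `lam`:
row `a` consists of the cells `(a, b)` with `a ≤ b < a + lam a`. -/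
def shiftCell (lam : List ℕ) (c : ℕ × ℕ) : Prop :=
  c.1 ≤ c.2 ∧ c.2 < c.1 + lam.getD c.1 0

/-- `IsStdFilling cells N f` : `f` is a standard tableau on the cell set `cells` with
entries `1, …, N`: it vanishes off `cells`, restricts to a bijection `cells → {1, …, N}`,
and is strictly increasing along rows and columns. -/
def IsStdFilling (cells : ℕ × ℕ → Prop) (N : ℕ) (f : (ℕ × ℕ) → ℕ) : Prop :=
  (∀ c, ¬ cells c → f c = 0) ∧
  (∀ c, cells c → 1 ≤ f c ∧ f c ≤ N) ∧
  (∀ c c', cells c → cells c' → f c = f c' → c = c') ∧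
  (∀ v, 1 ≤ v → v ≤ N → ∃ c, cells c ∧ f c = v) ∧
  (∀ a b, cells (a, b) → cells (a, b+1) → f (a, b) < f (a, b+1)) ∧
  (∀ a b, cells (a, b) → cells (a+1, b) → f (a, b) < f (a+1, b))

/-- The rectangular partition with `b` rows and `n` columns. -/
def rectShape (b n : ℕ) : List ℕ := List.replicate b n

/-- The square partition with `n` rows and `n` columns. -/
def sqShape (n : ℕ) : List ℕ := List.replicate n n

/-- The doubled staircase strict partition `(2n-1, 2n-3, …, 1)`. -/
def dblStair (n : ℕ) : List ℕ := (List.range n).map (fun i => 2*n - 1 - 2*i)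

/-- The index of the row containing the entry `v` of a filling
(rows numbered `0, 1, 2, …` from the top). -/
noncomputable def rowOf (f : (ℕ × ℕ) → ℕ) (v : ℕ) : ℕ := sInf {a | ∃ b, f (a, b) = v}

/-! ### Insertion machinery: tableaux as lists of rows of naturals -/

/-- Set position `j` of the list `l` to `v`, padding with `0`s if necessary. -/
def padSet (l : List ℕ) (j v : ℕ) : List ℕ :=
  if j < l.length then l.set j v else l ++ List.replicate (j - l.length) 0 ++ [v]

/-- Set the box in row `r`, (row-relative) position `j`, of the tableau `T` to `v`,
adding new rows if necessary. -/
def setBox (T : List (List ℕ)) (r j v : ℕ) : List (List ℕ) :=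
  let T' := if r < T.length then T else T ++ List.replicate (r + 1 - T.length) ([] : List ℕ)
  T'.set r (padSet (T'.getD r []) j v)

/-- The number of boxes of a tableau. -/
def tsize (T : List (List ℕ)) : ℕ := (T.map List.length).sum

/-- RSK row insertion of a letter `x` into a tableau: `x` bumps the leftmost entry of the
first row that is strictly greater than `x`; the bumped entry is inserted into the next row,
and so on; a letter bumping nothing is placed at the end of the row. -/
def rskInsert (x : ℕ) : List (List ℕ) → List (List ℕ)
  | [] => [[x]]
  | row :: rest =>
    match row.findIdx? (fun z => decide (x < z)) with
    | none => (row ++ [x]) :: rest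
    | some j => row.set j x :: rskInsert (row.getD j 0) rest

/-- The (unique) cell where the shapes of the tableaux `T` and `T'` differ,
when `T'` is obtained from `T` by one insertion. -/
def newCell (T T' : List (List ℕ)) : ℕ × ℕ :=
  let r := (List.range T'.length).findIdx
    (fun r => decide ((T.getD r []).length ≠ (T'.getD r []).length))
  (r, (T.getD r []).length)

/-- The RSK insertion tableau `P(w)` and recording tableau `Q(w)` of a word `w`. -/
def rskPQ (w : List ℕ) : List (List ℕ) × List (List ℕ) :=
  w.foldl
    (fun PQ x =>
      let P' := rskInsert x PQ.1
      let c := newCell PQ.1 P'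
      (P', setBox PQ.2 c.1 c.2 (tsize PQ.2 + 1)))
    ([], [])

/-- The RSK insertion tableau `P(w)` of the word `w`. -/
def rskP (w : List ℕ) : List (List ℕ) := (rskPQ w).1

/-- The RSK recording tableau `Q(w)` of the word `w`. -/
def rskQ (w : List ℕ) : List (List ℕ) := (rskPQ w).2

/-! Shifted mixed insertion (Haiman; semistandard version of Serrano).

A shifted tableau is stored as a list of rows, row `r` occupying the (absolute) columns
`r, r+1, …`.  Entries are encoded so that primed letters can be handled: the unprimed
letter `k` is stored as `2k` and the primed letter `k'` is stored as `2k - 1`; this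
encoding is order-preserving for the alphabet `1' < 1 < 2' < 2 < ⋯`. -/

/-- The entry of a shifted tableau `T` in row `r` and (absolute) column `c`, with `0`
meaning that there is no such box. -/
def sEntry (T : List (List ℕ)) (r c : ℕ) : ℕ := (T.getD r []).getD (c - r) 0

/-- One step of shifted mixed insertion, with `fuel` bounding the bumping chain.
If `isRow = true`, the (unprimed) value `v` is inserted into row `i`, bumping the leftmost
entry strictly greater than `v`; if `isRow = false`, the (primed) value `v` is inserted into
column `i`, bumping the topmost entry strictly greater than `v`; a value bumping nothing is
placed at the end of the row resp. the bottom of the column, ending the insertion.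
An entry bumped from the main diagonal becomes primed.  A bumped unprimed entry is inserted
into the next row; a bumped primed entry is inserted into the next column.
Returns the new tableau and the cell `(row, column)` where the insertion terminated. -/
def mixedIns : ℕ → List (List ℕ) → Bool → ℕ → ℕ → List (List ℕ) × (ℕ × ℕ)
  | 0, T, _, _, _ => (T, (0, 0))
  | fuel+1, T, true, r, v =>
    let row := T.getD r []
    match row.findIdx? (fun z => decide (v < z)) with
    | none => (setBox T r row.length v, (r, r + row.length))
    | some j =>
      let z := row.getD j 0
      let T' := T.set r (row.set j v)
      let z' := if j = 0 ∧ z % 2 = 0 then z - 1 else z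
      if z' % 2 = 0 then mixedIns fuel T' true (r+1) z'
      else mixedIns fuel T' false (r + j + 1) z'
  | fuel+1, T, false, c, v =>
    match (List.range (c+1)).find? (fun r =>
        decide (c - r < (T.getD r []).length) && decide (v < sEntry T r c)) with
    | some r =>
      let z := sEntry T r c
      let T' := setBox T r (c - r) v
      let z' := if r = c ∧ z % 2 = 0 then z - 1 else z
      if z' % 2 = 0 then mixedIns fuel T' true (r+1) z'
      else mixedIns fuel T' false (c+1) z'
    | none =>
      let r := (List.range (c+1)).findIdx (fun r => decide ((T.getD r []).length ≤ c - r))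
      (setBox T r (c - r) v, (r, c))

/-- Shifted mixed insertion of the letter `x` into the shifted tableau `T`:
the new insertion tableau together with the new cell. -/
def mixedInsLetter (T : List (List ℕ)) (x : ℕ) : List (List ℕ) × (ℕ × ℕ) :=
  mixedIns (tsize T + 2) T true 0 (2 * x)

/-- The shifted mixed insertion tableau `P'(w)` (with primed entries encoded as above) and
the standard shifted recording tableau `Q'(w)` of a word `w`. -/
def mixedPQ (w : List ℕ) : List (List ℕ) × List (List ℕ) :=
  w.foldl
    (fun PQ x =>
      let s := mixedInsLetter PQ.1 x
      (s.1, setBox PQ.2 s.2.1 (s.2.2 - s.2.1) (tsize PQ.2 + 1)))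
    ([], [])

/-- The shifted mixed insertion tableau `P'(w)` of the word `w`. -/
def mixedP (w : List ℕ) : List (List ℕ) := (mixedPQ w).1

/-- The shifted mixed insertion recording tableau `Q'(w)` of the word `w`. -/
def mixedQ (w : List ℕ) : List (List ℕ) := (mixedPQ w).2

/-- View a straight-shape tableau (list of rows) as a filling `ℕ × ℕ → ℕ`. -/
def toFunStraight (T : List (List ℕ)) : (ℕ × ℕ) → ℕ := fun c => (T.getD c.1 []).getD c.2 0

/-- View a shifted tableau (list of rows, row `r` starting in column `r`) as a filling
`ℕ × ℕ → ℕ`. -/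
def toFunShifted (T : List (List ℕ)) : (ℕ × ℕ) → ℕ :=
  fun c => if c.1 ≤ c.2 then (T.getD c.1 []).getD (c.2 - c.1) 0 else 0

/-! ### Jeu de taquin rectification of skew shifted tableaux -/

/-- `c` is an empty cell of the inner (skew) part of a shifted filling `g`: it is a shifted
position (`c.1 ≤ c.2`), it is empty, and some filled cell lies weakly to its southeast. -/
def InnerCell (g : (ℕ × ℕ) → ℕ) (c : ℕ × ℕ) : Prop :=
  c.1 ≤ c.2 ∧ g c = 0 ∧ ∃ d, g d ≠ 0 ∧ c.1 ≤ d.1 ∧ c.2 ≤ d.2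

/-- An inner corner of a skew shifted filling: an inner cell whose right and lower
neighbours are not inner cells. -/
def InnerCorner (g : (ℕ × ℕ) → ℕ) (c : ℕ × ℕ) : Prop :=
  InnerCell g c ∧ ¬ InnerCell g (c.1 + 1, c.2) ∧ ¬ InnerCell g (c.1, c.2 + 1)

/-- One inward jeu de taquin slide of a skew shifted filling, into some inner corner
(`L` is a bound on the length of the slide path). -/
def JdtStep (L : ℕ) (f g : (ℕ × ℕ) → ℕ) : Prop :=
  ∃ c, InnerCorner f c ∧ g = (jdtSlide L f c).1

/-- A shifted filling is rectified (of straight shifted shape) when it has no inner cells. -/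
def IsRectifiedShifted (g : (ℕ × ℕ) → ℕ) : Prop := ∀ c, ¬ InnerCell g c

/-- The straight-shape tableau `T`, viewed as a skew shifted standard Young tableau by
placing its cell `(a, b)` at the shifted position `(a, b + k)`. -/
def embedShift (k : ℕ) (T : List (List ℕ)) : (ℕ × ℕ) → ℕ :=
  fun c => if k ≤ c.2 then toFunStraight T (c.1, c.2 - k) else 0


/-! ### Symmetric shapes and particles -/

/-- Self-conjugate partitions, given by row lengths. -/
def SC (p : ℕ → ℕ) : Prop := ∀ i j, j < p i ↔ i < p j

/-- Row `r` has an addable corner. -/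
def Addb (p : ℕ → ℕ) (r : ℕ) : Prop := p (p r) = r

/-- Add the corner of row `r` and its mirror image. -/
def bump (p : ℕ → ℕ) (r : ℕ) : ℕ → ℕ :=
  fun k => if k = r then p r + 1 else if k = p r then r + 1 else p k

theorem bump_sc {p r} (h : SC p) (hr : Addb p r) : SC (bump p r) := by
  intro i j
  have h1 := h i j
  have h2 := h r (p r)
  have h3 := h r j
  have h4 := h i r
  have h5 := h (p r) j
  have h6 := h i (p r)
  unfold Addb at hr
  unfold bump
  split_ifs <;> subst_vars <;> simp_all <;> omega

theorem SC.anti {p : ℕ → ℕ} (h : SC p) {i j : ℕ} (hij : i ≤ j) : p j ≤ p i := by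
  by_contra hc
  push Not at hc
  have h1 := h j (p i)
  have h2 := h i (p i)
  omega

theorem addb_of_lt {p r} (h : SC p) (hr : p (r+1) < p r) : Addb p (r+1) := by
  unfold Addb
  have h1 := h (p (r+1)) (r+1)
  have h2 := h (p (r+1)) r
  omega

theorem addb_zero {p} (h : SC p) : Addb p 0 := by
  unfold Addb
  have h1 := h (p 0) 0
  omega

theorem addb_succ {p r} (h : SC p) (hr : Addb p r) : Addb (bump p r) (r+1) := by
  apply addb_of_lt (bump_sc h hr)
  have h1 := h.anti (Nat.le_add_right r 1)
  unfold bump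
  split_ifs <;> omega

theorem addb_partner {p r} (hr : Addb p r) : Addb p (p r) := by
  unfold Addb at *; rw [hr]

theorem bump_partner {p r} (hr : Addb p r) : bump p (p r) = bump p r := by
  unfold Addb at *
  funext k
  unfold bump
  split_ifs <;> grind

theorem pass_ne {p e r} (hr : Addb p r) (he : Addb p e) (h1 : r ≠ e) (h2 : r ≠ p e) :
    Addb (bump p r) e ∧ Addb (bump p e) r ∧ bump p e r = p r ∧ bump (bump p e) r = bump (bump p r) e := by
  unfold Addb at *
  have : p r ≠ p e := by intro h; grind
  have : p r ≠ e := by intro h; grind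
  refine ⟨?_, ?_, ?_, ?_⟩
  · grind [bump]
  · grind [bump]
  · grind [bump]
  · funext k
    simp only [bump]; split_ifs <;> grind

/-- An event at row `e` passes the particle at `r`. -/
def Pass (p : ℕ → ℕ) (e r r' e' : ℕ) : Prop :=
  (r ≠ e ∧ r ≠ p e ∧ r' = r ∧ e' = e) ∨ ((r = e ∨ r = p e) ∧ r' = r + 1 ∧ e' = r + 1)

theorem bump_at_partner {p r} (hr : Addb p r) : bump p r (p r) = r + 1 := by
  unfold Addb at *
  unfold bump
  split_ifs <;> omega

theorem bump_self {p : ℕ → ℕ} {r} : bump p r r = p r + 1 := by simp [bump]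

theorem pass_add {p e r r' e'} (h : SC p) (hr : Addb p r) (he : Addb p e) (hp : Pass p e r r' e') :
    Addb (bump p e) r' ∧ Addb (bump p r) e' ∧ bump (bump p e) r' = bump (bump p r) e' := by
  rcases hp with ⟨h1, h2, rfl, rfl⟩ | ⟨h1, rfl, rfl⟩
  · obtain ⟨q1, q2, q3, q4⟩ := pass_ne hr he h1 h2
    exact ⟨q2, q1, q4⟩
  · have : bump p e = bump p r := by
      rcases h1 with rfl | rfl
      · rfl
      · exact (bump_partner he).symm
    rw [this]
    exact ⟨addb_succ h hr, addb_succ h hr, rfl⟩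

theorem not_hit_partner {r e : ℕ} {q : ℕ → ℕ} (hr : Addb q r) (he : Addb q e) (h1 : r ≠ e)
    (h2 : r ≠ q e) : q r ≠ e ∧ q r ≠ q e := by
  unfold Addb at *
  constructor <;> intro h <;> grind

theorem bump_ne {p : ℕ → ℕ} {r k} (h1 : k ≠ r) (h2 : k ≠ p r) : bump p r k = p k := by
  simp [bump, h1, h2]

theorem bump_hit {p : ℕ → ℕ} {r e} (he : Addb p e) (h : r = e ∨ r = p e) : bump p e = bump p r := by
  rcases h with rfl | rfl
  · rfl
  · exact (bump_partner he).symm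

/-! ### Chains of shapes and letters moving along them -/

/-- The state (row) of the letter `x` moving along the chain `D`. -/
def st (x : ℕ) (D : ℕ → ℕ → ℕ) : ℕ → ℕ
  | 0 => 0
  | t+1 => if t + 1 ≤ x then 0 else
      if D (t+1) (st x D t) ≠ D t (st x D t) then st x D t + 1 else st x D t

/-- Insert the letter `x` into the chain `D`, for a given rule of adding boxes. -/
def InsG (B : (ℕ → ℕ) → ℕ → (ℕ → ℕ)) (D : ℕ → ℕ → ℕ) (x : ℕ) : ℕ → ℕ → ℕ :=
  fun t => if t < x then D t else B (D t) (st x D t)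


def Z0 : ℕ → ℕ → ℕ := fun _ _ => 0

/-- The chain of a word. -/
def PhiG (B : (ℕ → ℕ) → ℕ → (ℕ → ℕ)) (u : List ℕ) : ℕ → ℕ → ℕ := u.foldl (InsG B) Z0


def Chain (D : ℕ → ℕ → ℕ) : Prop :=
  (∀ t, SC (D t)) ∧ ∀ t, D (t+1) = D t ∨ ∃ e, Addb (D t) e ∧ D (t+1) = bump (D t) e

def Free (D : ℕ → ℕ → ℕ) (x : ℕ) : Prop := ∀ t, t + 1 = x → D (t+1) = D t

theorem st_le {x D t} (h : t ≤ x) : st x D t = 0 := by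
  cases t with
  | zero => rfl
  | succ t => simp [st, h]

theorem st_succ {x D t} (h : x ≤ t) : st x D (t+1) =
    if D (t+1) (st x D t) ≠ D t (st x D t) then st x D t + 1 else st x D t := by
  rw [st, if_neg (by omega)]

theorem st_same {x D t} (h : D (t+1) = D t) : st x D (t+1) = st x D t := by
  by_cases c : t + 1 ≤ x
  · rw [st_le c, st_le (by omega)]
  · rw [st_succ (by omega), h]; simp

theorem ins_lt {B D x t} (h : t < x) : InsG B D x t = D t := by simp [InsG, h]
theorem ins_ge {B D x t} (h : x ≤ t) : InsG B D x t = B (D t) (st x D t) := by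
  simp [InsG, Nat.not_lt.mpr h]

theorem ins_same {B D x t} (h : D (t+1) = D t) (hx : t + 1 ≠ x) :
    InsG B D x (t+1) = InsG B D x t := by
  by_cases c : t < x
  · rw [ins_lt c, ins_lt (by omega), h]
  · rw [ins_ge (by omega), ins_ge (by omega), h, st_same h]

theorem st_congr {x D D' t} (h : ∀ s ≤ t, D s = D' s) : st x D t = st x D' t := by
  induction t with
  | zero => rfl
  | succ t ih =>
    by_cases c : t + 1 ≤ x
    · rw [st_le c, st_le c]
    · rw [st_succ (by omega), st_succ (by omega), ih (fun s hs => h s (by omega)),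
        h (t+1) le_rfl, h t (by omega)]

theorem ins_congr {B x D D' t} (h : ∀ s ≤ t, D s = D' s) : InsG B D x t = InsG B D' x t := by
  unfold InsG
  rw [st_congr h, h t le_rfl]

theorem free_ins {B D x y} (hy : Free D y) (hxy : y ≠ x) : Free (InsG B D x) y := by
  intro t ht
  exact ins_same (hy t ht) (by omega)

theorem hit_iff {p r e} (hr : Addb p r) (he : Addb p e) :
    bump p e r ≠ p r ↔ (r = e ∨ r = p e) := by
  unfold Addb at *
  unfold bump
  constructor
  · intro h; by_contra hc; grind
  · rintro (rfl | rfl) <;> grind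

theorem st_addb {D x} (h : Chain D) {t} (hx : x ≤ t) : Addb (D t) (st x D t) := by
  induction t with
  | zero => rw [st_le (by omega)]; exact addb_zero (h.1 _)
  | succ t ih =>
    by_cases c : t + 1 ≤ x
    · rw [st_le c]; exact addb_zero (h.1 _)
    · have hr := ih (by omega)
      rcases h.2 t with h1 | ⟨e, he, h1⟩
      · rw [st_same h1, h1]; exact hr
      · rw [st_succ (by omega), h1]
        simp only [hit_iff hr he]
        split_ifs with h2
        · rw [bump_hit he h2]; exact addb_succ (h.1 t) hr
        · push Not at h2
          exact (pass_ne hr he h2.1 h2.2).2.1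

theorem pass_step {D x t e} (h : Chain D) (hx : x ≤ t) (he : Addb (D t) e)
    (h1 : D (t+1) = bump (D t) e) : ∃ e', Pass (D t) e (st x D t) (st x D (t+1)) e' ∧
      Addb (InsG bump D x t) e' ∧ InsG bump D x (t+1) = bump (InsG bump D x t) e' := by
  have hr := st_addb h hx
  have : ∃ e', Pass (D t) e (st x D t) (st x D (t+1)) e' := by
    rw [st_succ hx, h1]
    simp only [hit_iff hr he]
    unfold Pass
    by_cases h2 : st x D t = e ∨ st x D t = D t e
    · exact ⟨st x D t + 1, Or.inr ⟨h2, by simp [h2], rfl⟩⟩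
    · exact ⟨e, Or.inl (by simp [h2]; tauto)⟩
  obtain ⟨e', hp⟩ := this
  obtain ⟨-, q2, q3⟩ := pass_add (h.1 t) hr he hp
  refine ⟨e', hp, ?_, ?_⟩
  · rw [ins_ge hx]; exact q2
  · rw [ins_ge hx, ins_ge (by omega), h1, q3]

theorem birth_step {D x t} (h : Chain D) (hf : Free D x) (hx : t + 1 = x) :
    Addb (InsG bump D x t) 0 ∧ InsG bump D x (t+1) = bump (InsG bump D x t) 0 := by
  rw [ins_lt (by omega), ins_ge (by omega), st_le (by omega), hf t hx]
  exact ⟨addb_zero (h.1 _), rfl⟩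

theorem chain_ins {D x} (h : Chain D) (hf : Free D x) : Chain (InsG bump D x) := by
  constructor
  · intro t
    by_cases c : t < x
    · rw [ins_lt c]; exact h.1 t
    · rw [ins_ge (by omega)]; exact bump_sc (h.1 t) (st_addb h (by omega))
  · intro t
    by_cases c : t + 1 < x
    · rw [ins_lt c, ins_lt (by omega)]; exact h.2 t
    · by_cases c2 : t + 1 = x
      · right; exact ⟨0, birth_step h hf c2⟩
      · rcases h.2 t with h1 | ⟨e, he, h1⟩
        · left; exact ins_same h1 c2
        · right
          obtain ⟨e', -, q2, q3⟩ := pass_step (x := x) h (by omega) he h1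
          exact ⟨e', q2, q3⟩

theorem chain_zero : Chain Z0 := by
  constructor
  · intro t i j; simp [Z0]
  · intro t; left; rfl

theorem free_zero (x) : Free Z0 x := fun _ _ => rfl

theorem foldl_chain {u : List ℕ} : ∀ {D}, Chain D → (∀ x ∈ u, Free D x) → u.Nodup →
    Chain (u.foldl (InsG bump) D) ∧ ∀ y, y ∉ u → Free D y → Free (u.foldl (InsG bump) D) y := by
  induction u with
  | nil => intro D h _ _; exact ⟨h, fun y _ hy => hy⟩
  | cons x u ih =>
    intro D h hf hn
    rw [List.nodup_cons] at hn
    obtain ⟨q1, q2⟩ := ih (D := InsG bump D x) (chain_ins h (hf x (by simp)))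
      (fun y hy => free_ins (hf y (by simp [hy])) (by rintro rfl; exact hn.1 hy)) hn.2
    refine ⟨q1, fun y hy hyf => q2 y (by simp at hy; tauto) (free_ins hyf ?_)⟩
    simp at hy; tauto

theorem phi_chain {u : List ℕ} (hn : u.Nodup) : Chain (PhiG bump u) ∧ ∀ y, y ∉ u → Free (PhiG bump u) y :=
  let q := foldl_chain (u := u) chain_zero (fun x _ => free_zero x) hn
  ⟨q.1, fun y hy => q.2 y hy (free_zero y)⟩



/-- The local jeu de taquin rule. -/
def JSq (p p' q q' : ℕ → ℕ) : Prop :=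
  ∃ κ, Addb p κ ∧ p' = bump p κ ∧
    ((q = p ∧ q' = p') ∨
     (∃ e, Addb p e ∧ e ≠ κ ∧ e ≠ p κ ∧ q = bump p e ∧ q' = bump p' e) ∨
     (Addb p' κ ∧ q = p' ∧ q' = bump p' κ))

def JInv (p p' : ℕ → ℕ) (s s' : ℕ) : Prop :=
  (s' = s ∧ p' s = p s) ∨ (p' s ≠ p s ∧ s' ≤ s ∧ p' s' = p s + 1)

theorem bump_succ_ne {p : ℕ → ℕ} {r k} : bump p r k ≠ p k → bump p r k = p k + 1 ∨ (k = p r ∧ bump p r k = r + 1) := by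
  unfold bump; grind

theorem hit_val {p r k} (hr : Addb p r) (h : k = r ∨ k = p r) : bump p r k = p k + 1 := by
  rw [bump_hit hr h, bump_self]


theorem jsq_A2 {p p' : ℕ → ℕ} {s κ e s1 s1' g g' : ℕ} (hp : SC p)
    (hk : Addb p κ) (hp' : p' = bump p κ) (hs : Addb p s)
    (hI : p' s = p s) (he : Addb p e) (hc1 : e ≠ κ) (hc2 : e ≠ p κ)
    (A : Pass p e s s1 g) (B : Pass p' e s s1' g') :
    JInv (bump p e) (bump p' e) s1 s1' ∧
      JSq (bump p s) (bump p' s) (bump (bump p s) g) (bump (bump p' s) g') := by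
  have n1 : s ≠ κ ∧ s ≠ p κ := by
    rw [hp'] at hI
    have := hit_iff hs hk
    tauto
  obtain ⟨r1, r2, r3, r4⟩ := pass_ne hs hk n1.1 n1.2
  obtain ⟨t1, t2, t3, t4⟩ := pass_ne he hk hc1 hc2
  have pe : p' e = p e := by rw [hp']; exact t3
  have C : bump p' s = bump (bump p s) κ := by rw [hp', r4]
  have bk : bump p s κ = p κ := (pass_ne hk hs (Ne.symm n1.1) (by
    intro h; apply n1.2; unfold Addb at *; rw [h, hs])).2.2.1
  unfold Pass at A B
  rw [pe] at B
  by_cases hh : s = e ∨ s = p e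
  · obtain ⟨rfl, rfl⟩ : s1 = s + 1 ∧ g = s + 1 := by tauto
    obtain ⟨rfl, rfl⟩ : s1' = s + 1 ∧ g' = s + 1 := by tauto
    have E1 : bump p e = bump p s := bump_hit he hh
    have E2 : bump p' e = bump p' s := by
      apply bump_hit _ (by rw [pe]; exact hh)
      rw [hp']; exact t2
    rw [E1, E2, C]
    have ad := addb_succ hp hs
    by_cases h2 : s + 1 = κ ∨ s + 1 = bump p s κ
    · refine ⟨Or.inr ⟨?_, le_rfl, hit_val r1 h2⟩, s + 1, ad, ?_, ?_⟩
      · rw [hit_val r1 h2]; omega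
      · exact bump_hit r1 h2
      · refine Or.inr (Or.inr ⟨?_, ?_, rfl⟩)
        · rw [← r4]
          exact addb_succ (p := bump p κ) (bump_sc hp hk) r2
        · exact (bump_hit r1 h2).symm
    · refine ⟨Or.inl ⟨rfl, ?_⟩, κ, r1, rfl, ?_⟩
      · have := hit_iff ad r1; tauto
      · right; left
        exact ⟨s + 1, ad, by tauto, by tauto, rfl, rfl⟩
  · obtain ⟨rfl, rfl⟩ : s1 = s ∧ g = e := by tauto
    obtain ⟨rfl, rfl⟩ : s1' = s1 ∧ g' = g := by tauto
    push Not at hh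
    obtain ⟨u1, u2, u3, u4⟩ := pass_ne hs he hh.1 hh.2
    refine ⟨Or.inl ⟨rfl, ?_⟩, κ, r1, C, ?_⟩
    · rw [u3, ← hI]
      apply bump_ne hh.1
      rw [pe]; exact hh.2
    · right; left
      exact ⟨g', u1, hc1, by rw [bk]; exact hc2, rfl, rfl⟩

theorem jsq_A3 {p p' : ℕ → ℕ} {s κ s1 s1' g g' : ℕ} (hp : SC p)
    (hk : Addb p κ) (hp' : p' = bump p κ) (hs : Addb p s)
    (hI : p' s = p s) (he' : Addb p' κ)
    (A : Pass p κ s s1 g) (B : Pass p' κ s s1' g') :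
    JInv p' (bump p' κ) s1 s1' ∧
      JSq (bump p s) (bump p' s) (bump (bump p s) g) (bump (bump p' s) g') := by
  have n1 : s ≠ κ ∧ s ≠ p κ := by
    rw [hp'] at hI
    have := hit_iff hs hk
    tauto
  obtain ⟨r1, r2, r3, r4⟩ := pass_ne hs hk n1.1 n1.2
  have C : bump p' s = bump (bump p s) κ := by rw [hp', r4]
  have n2 : s ≠ p' κ := by
    intro h
    have h1 : p' s = κ := by rw [h]; exact he'
    have h2 : p' κ = p κ + 1 := by rw [hp', bump_self]
    unfold Addb at hs
    grind
  unfold Pass at A B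
  obtain ⟨rfl, rfl⟩ : s1 = s ∧ g = κ := by tauto
  obtain ⟨rfl, rfl⟩ : s1' = s1 ∧ g' = g := by tauto
  have hs2 : Addb p' s1' := by rw [hp']; exact r2
  refine ⟨Or.inl ⟨rfl, bump_ne n1.1 n2⟩, g', r1, C, ?_⟩
  right; right
  refine ⟨?_, C.symm, rfl⟩
  exact (pass_ne hs2 he' n1.1 n2).1

theorem jsq_B2 {p p' : ℕ → ℕ} {s s' κ e s1 s1' g g' : ℕ} (hp : SC p)
    (hk : Addb p κ) (hp' : p' = bump p κ) (hs : Addb p s) (hs' : Addb p' s')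
    (hI : p' s ≠ p s) (hle : s' ≤ s) (hI2 : p' s' = p s + 1)
    (he : Addb p e) (hc1 : e ≠ κ) (hc2 : e ≠ p κ)
    (A : Pass p e s s1 g) (B : Pass p' e s' s1' g') :
    JInv (bump p e) (bump p' e) s1 s1' ∧
      JSq (bump p s) (bump p' s') (bump (bump p s) g) (bump (bump p' s') g') := by
  have n1 : s = κ ∨ s = p κ := by
    rw [hp'] at hI
    exact (hit_iff hs hk).1 hI
  have hpp : SC p' := hp' ▸ bump_sc hp hk
  have E : p' = bump p s := by rw [hp']; exact bump_hit hk n1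
  have h0 : e ≠ s ∧ e ≠ p s := by
    unfold Addb at *
    rcases n1 with rfl | rfl
    · exact ⟨hc1, hc2⟩
    · rw [hk]; exact ⟨hc2, hc1⟩
  obtain ⟨t1, t2, t3, t4⟩ := pass_ne he hs h0.1 h0.2
  obtain ⟨w1, w2⟩ := not_hit_partner he hs h0.1 h0.2
  have pe : p' e = p e := by rw [E]; exact t3
  have he2 : Addb p' e := by rw [E]; exact t2
  have bs : bump p e s = p s := bump_ne (Ne.symm h0.1) (Ne.symm w1)
  have bs2 : bump p' e s = p' s := bump_ne (Ne.symm h0.1) (by rw [pe]; exact Ne.symm w1)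
  have ps : p' s = p s + 1 := by rw [E, bump_self]
  unfold Pass at A B
  obtain ⟨rfl, rfl⟩ : s1 = s ∧ g = e := by
    have : s ≠ p e := Ne.symm w1
    have := h0.1
    grind
  rw [← E]
  by_cases hh : s' = g ∨ s' = p' g
  · obtain ⟨rfl, rfl⟩ : s1' = s' + 1 ∧ g' = s' + 1 := by tauto
    have E2 : bump p' g = bump p' s' := bump_hit he2 hh
    have hlt : s' < s1 := by
      rcases Nat.lt_or_ge s' s1 with h | h
      · exact h
      · have : s' = s1 := by omega
        subst this
        rw [pe] at hh
        rcases hh with h | h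
        · exact absurd h.symm h0.1
        · exact absurd h.symm w1
    have v : bump p' s' (s' + 1) = p s1 + 1 := by
      have hmono : p' s1 ≤ p' (s' + 1) := hpp.anti hlt
      have hmono2 : p' (s' + 1) ≤ p' s' := hpp.anti (by omega)
      have h3 : s' + 1 ≠ p' s' := by
        intro h
        have := hs'
        unfold Addb at this
        rw [← h] at this
        have : p' (s'+1) = s' + 1 := by omega
        omega
      rw [bump_ne (by omega) h3]; omega
    refine ⟨Or.inr ⟨?_, hlt, ?_⟩, p' s', addb_partner hs', (bump_partner hs').symm, ?_⟩
    · rw [bs, bs2]; exact hI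
    · rw [bs, E2, v]
    · right; right
      have ad := addb_succ hpp hs'
      have v2 : bump p' s' (s' + 1) = p' s' := by rw [v, hI2]
      refine ⟨?_, E2, ?_⟩
      · rw [← v2]; exact addb_partner ad
      · rw [← bump_partner ad, v2]
  · obtain ⟨rfl, rfl⟩ : s1' = s' ∧ g' = g := by tauto
    push Not at hh
    obtain ⟨x1, x2⟩ := not_hit_partner hs' he2 hh.1 hh.2
    refine ⟨Or.inr ⟨?_, hle, ?_⟩, s1', hs', rfl, ?_⟩
    · rw [bs, bs2]; exact hI
    · rw [bs, bump_ne hh.1 hh.2]; exact hI2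
    · right; left
      exact ⟨g', he2, Ne.symm hh.1, Ne.symm x1, rfl, rfl⟩

theorem jsq_B3 {p p' : ℕ → ℕ} {s s' κ s1 s1' g g' : ℕ} (hp : SC p)
    (hk : Addb p κ) (hp' : p' = bump p κ) (hs : Addb p s) (hs' : Addb p' s')
    (hI : p' s ≠ p s) (hle : s' ≤ s) (hI2 : p' s' = p s + 1)
    (he' : Addb p' κ)
    (A : Pass p κ s s1 g) (B : Pass p' κ s' s1' g') :
    JInv p' (bump p' κ) s1 s1' ∧
      JSq (bump p s) (bump p' s') (bump (bump p s) g) (bump (bump p' s') g') := by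
  have n1 : s = κ ∨ s = p κ := by
    rw [hp'] at hI
    exact (hit_iff hs hk).1 hI
  have hpp : SC p' := hp' ▸ bump_sc hp hk
  have E : p' = bump p s := by rw [hp']; exact bump_hit hk n1
  have ps : p' s = p s + 1 := by rw [E, bump_self]
  have pk : p' κ = p κ + 1 := by rw [hp', bump_self]
  obtain ⟨rfl, rfl⟩ : s1 = s + 1 ∧ g = s + 1 := by
    unfold Pass at A; tauto
  rw [← E]
  have ad : Addb p' (s + 1) := by rw [E]; exact addb_succ hp hs
  by_cases c : s = κ
  · subst c
    obtain rfl : s' = s := by unfold Addb at *; grind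
    obtain ⟨rfl, rfl⟩ : s1' = s' + 1 ∧ g' = s' + 1 := by unfold Pass at B; tauto
    by_cases h2 : s' + 1 = s' ∨ s' + 1 = p' s'
    · have k := hit_val hs' h2
      refine ⟨Or.inr ⟨by omega, le_rfl, k⟩, s' + 1, ad, bump_hit hs' h2, ?_⟩
      right; right
      exact ⟨addb_succ hpp hs', (bump_hit hs' h2).symm, rfl⟩
    · refine ⟨Or.inl ⟨rfl, ?_⟩, s', hs', rfl, ?_⟩
      · have := hit_iff ad hs'; tauto
      · right; left
        exact ⟨s' + 1, ad, by omega, by tauto, rfl, rfl⟩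
  · obtain rfl : s = p κ := by tauto
    have pps : p (p κ) = κ := hk
    have q1 : p' (p κ + 1) = κ := by rw [← pk]; exact he'
    have n2 : s' ≠ κ := by grind
    have n3 : s' ≠ p' κ := by omega
    obtain ⟨rfl, rfl⟩ : s1' = s' ∧ g' = κ := by unfold Pass at B; tauto
    obtain ⟨x1, x2⟩ := not_hit_partner hs' he' n2 n3
    have k := hit_val he' (k := p g' + 1) (Or.inr pk.symm)
    have E3 : bump (bump p' s1') g' = bump (bump p' s1') (p g' + 1) := by
      have y := pass_ne he' hs' (Ne.symm n2) (Ne.symm x1)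
      rw [← bump_partner y.2.1, y.2.2.1, pk]
    refine ⟨Or.inr ⟨by omega, by omega, ?_⟩, s1', hs', rfl, ?_⟩
    · rw [bump_ne n2 n3]; omega
    · right; left
      exact ⟨p g' + 1, ad, by omega, by omega, rfl, E3⟩


def JR (t0 : ℕ) (D D' : ℕ → ℕ → ℕ) : Prop :=
  ∀ t, t0 ≤ t → JSq (D t) (D' t) (D (t+1)) (D' (t+1))

theorem jsq_idle {p p' s s'} (h : SC p) (hc : ∃ κ, Addb p κ ∧ p' = bump p κ) (hs : Addb p s)
    (hs' : Addb p' s') (hI : JInv p p' s s') :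
    JSq (bump p s) (bump p' s') (bump p s) (bump p' s') := by
  obtain ⟨κ, hk, rfl⟩ := hc
  rcases hI with ⟨rfl, h1⟩ | ⟨h1, h2, h3⟩
  · have n1 : s' ≠ κ ∧ s' ≠ p κ := by
      have := hit_iff hs hk
      tauto
    obtain ⟨r1, r2, r3, r4⟩ := pass_ne hs hk n1.1 n1.2
    exact ⟨κ, r1, r4, Or.inl ⟨rfl, rfl⟩⟩
  · have n1 := (hit_iff hs hk).1 h1
    have E := bump_hit hk n1
    refine ⟨s', ?_, ?_, Or.inl ⟨rfl, rfl⟩⟩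
    · rw [← E]; exact hs'
    · rw [E]

theorem jsq_cov {p p' q q'} (h : JSq p p' q q') : ∃ κ, Addb p κ ∧ p' = bump p κ := by
  obtain ⟨κ, h1, h2, -⟩ := h; exact ⟨κ, h1, h2⟩

theorem jr_step {D D' : ℕ → ℕ → ℕ} {x t} (C : Chain D) (C' : Chain D') (hx : x ≤ t)
    (hJ : JSq (D t) (D' t) (D (t+1)) (D' (t+1)))
    (hI : JInv (D t) (D' t) (st x D t) (st x D' t)) :
    JInv (D (t+1)) (D' (t+1)) (st x D (t+1)) (st x D' (t+1)) ∧
    JSq (InsG bump D x t) (InsG bump D' x t) (InsG bump D x (t+1)) (InsG bump D' x (t+1)) := by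
  have hs := st_addb C hx
  have hs' := st_addb C' hx
  obtain ⟨κ, hk, hp', hc⟩ := hJ
  rcases hc with ⟨e1, e2⟩ | ⟨e, he, n1, n2, e1, e2⟩ | ⟨h1, e1, e2⟩
  · rw [st_same e1, st_same e2, ins_same e1 (by omega), ins_same e2 (by omega), e1, e2]
    refine ⟨hI, ?_⟩
    rw [ins_ge hx, ins_ge hx]
    exact jsq_idle (C.1 t) ⟨κ, hk, hp'⟩ hs hs' hI
  · have he' : Addb (D' t) e := by rw [hp']; exact (pass_ne he hk n1 n2).2.1
    obtain ⟨g, P, -, q⟩ := pass_step (x := x) C hx he e1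
    obtain ⟨g', P', -, q'⟩ := pass_step (x := x) C' hx he' e2
    rw [q, q', ins_ge hx, ins_ge hx, e1, e2]
    rcases hI with ⟨a, b⟩ | ⟨a, b, c⟩
    · rw [a] at P' ⊢
      exact jsq_A2 (C.1 t) hk hp' hs b he n1 n2 P P'
    · exact jsq_B2 (C.1 t) hk hp' hs hs' a b c he n1 n2 P P'
  · have e1' : D (t+1) = bump (D t) κ := by rw [e1, hp']
    obtain ⟨g, P, -, q⟩ := pass_step (x := x) C hx hk e1'
    obtain ⟨g', P', -, q'⟩ := pass_step (x := x) C' hx h1 e2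
    rw [q, q', ins_ge hx, ins_ge hx, e1, e2]
    rcases hI with ⟨a, b⟩ | ⟨a, b, c⟩
    · rw [a] at P' ⊢
      exact jsq_A3 (C.1 t) hk hp' hs b h1 P P'
    · exact jsq_B3 (C.1 t) hk hp' hs hs' a b c h1 P P'

theorem jinv_zero {p p'} (h : SC p) (hc : ∃ κ, Addb p κ ∧ p' = bump p κ) : JInv p p' 0 0 := by
  obtain ⟨κ, hk, rfl⟩ := hc
  by_cases h1 : bump p κ 0 = p 0
  · exact Or.inl ⟨rfl, h1⟩
  · exact Or.inr ⟨h1, le_rfl, hit_val hk ((hit_iff (addb_zero h) hk).1 h1)⟩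

theorem jr_ins {D D' : ℕ → ℕ → ℕ} {x t0} (C : Chain D) (C' : Chain D') (hf : Free D x)
    (hf' : Free D' x) (hx : t0 < x) (hJ : JR t0 D D') : JR t0 (InsG bump D x) (InsG bump D' x) := by
  have inv : ∀ t, x ≤ t → JInv (D t) (D' t) (st x D t) (st x D' t) := by
    intro t ht
    induction t, ht using Nat.le_induction with
    | base =>
      rw [st_le le_rfl, st_le le_rfl]
      exact jinv_zero (C.1 _) (jsq_cov (hJ x (by omega)))
    | succ t ht ih => exact (jr_step C C' ht (hJ t (by omega)) ih).1
  intro t ht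
  rcases Nat.lt_or_ge t x with c | c
  · rcases Nat.lt_or_ge (t+1) x with c2 | c2
    · rw [ins_lt c, ins_lt c, ins_lt c2, ins_lt c2]; exact hJ t ht
    · have e : t + 1 = x := by omega
      have b := birth_step C hf e
      have b' := birth_step C' hf' e
      rw [b.2, b'.2]
      rw [ins_lt c, ins_lt c] at *
      obtain ⟨κ, hk, hp'⟩ := jsq_cov (hJ t ht)
      by_cases h : 0 = κ ∨ 0 = D t κ
      · have E := bump_hit hk h
        refine ⟨0, b.1, hp'.trans E, Or.inr (Or.inr ⟨b'.1, ?_, rfl⟩)⟩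
        rw [hp', E]
      · exact ⟨κ, hk, hp', Or.inr (Or.inl ⟨0, b.1, by tauto, by tauto, rfl, rfl⟩)⟩
  · exact (jr_step C C' c (hJ t ht) (inv t c)).2

theorem jr_foldl {u : List ℕ} : ∀ {D D' : ℕ → ℕ → ℕ} {t0}, Chain D → Chain D' → (∀ x ∈ u, Free D x) →
    (∀ x ∈ u, Free D' x) → (∀ x ∈ u, t0 < x) → u.Nodup → JR t0 D D' →
    JR t0 (u.foldl (InsG bump) D) (u.foldl (InsG bump) D') := by
  induction u with
  | nil => intro D D' t0 _ _ _ _ _ _ h; exact h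
  | cons x u ih =>
    intro D D' t0 C C' f f' hx hn h
    rw [List.nodup_cons] at hn
    have hne : ∀ y ∈ u, y ≠ x := by rintro y hy rfl; exact hn.1 hy
    exact ih (chain_ins C (f x (by simp))) (chain_ins C' (f' x (by simp)))
      (fun y hy => free_ins (f y (by simp [hy])) (hne y hy))
      (fun y hy => free_ins (f' y (by simp [hy])) (hne y hy))
      (fun y hy => hx y (by simp [hy])) hn.2
      (jr_ins C C' (f x (by simp)) (f' x (by simp)) (hx x (by simp)) h)

theorem foldl_early {u : List ℕ} {t} : ∀ {D : ℕ → ℕ → ℕ}, (∀ x ∈ u, t < x) →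
    u.foldl (InsG bump) D t = D t := by
  induction u with
  | nil => intro D _; rfl
  | cons x u ih =>
    intro D h
    rw [List.foldl_cons, ih (fun y hy => h y (by simp [hy])), ins_lt (h x (by simp))]

/-- Deleting the smallest letter. -/
theorem jr_base {D : ℕ → ℕ → ℕ} {x} (C : Chain D) (h0 : D x = fun _ => 0) : JR x D (InsG bump D x) := by
  have inv : ∀ t, x ≤ t → D t (st x D t) = 0 := by
    intro t ht
    induction t, ht using Nat.le_induction with
    | base => rw [h0]
    | succ t ht ih =>
      have hs := st_addb C (x := x) (t := t) (by omega)
      rcases C.2 t with h | ⟨e, he, h⟩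
      · rw [st_same h, h]; exact ih
      · rw [st_succ ht, h]
        simp only [hit_iff hs he]
        split_ifs with k
        · rw [bump_hit he k]
          have := (C.1 t).anti (Nat.le_add_right (st x D t) 1)
          unfold bump
          rw [ih]
          have hs2 := hs
          unfold Addb at hs2
          rw [ih] at hs2
          split_ifs <;> omega
        · push Not at k
          rw [bump_ne k.1 k.2]; exact ih
  intro t ht
  have hs := st_addb C (x := x) (t := t) (by omega)
  rcases C.2 t with h | ⟨e, he, h⟩
  · exact ⟨st x D t, hs, ins_ge ht, Or.inl ⟨h, ins_same h (by omega)⟩⟩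
  · by_cases k : st x D t = e ∨ st x D t = D t e
    · have E := bump_hit he k
      have i := inv t ht
      have i2 := inv (t+1) (by omega)
      have k' : st x D (t+1) = st x D t + 1 := by
        rw [st_succ ht, h, if_pos ((hit_iff hs he).2 k)]
      have P := bump_partner hs
      rw [i] at P
      have hs1 := st_addb C (x := x) (t := t+1) (by omega)
      have P1 := bump_partner hs1
      rw [i2] at P1
      refine ⟨0, addb_zero (C.1 t), by rw [ins_ge ht, P], Or.inr (Or.inr ⟨?_, ?_, ?_⟩)⟩
      · rw [ins_ge ht]; exact addb_zero (bump_sc (C.1 t) hs)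
      · rw [ins_ge ht, h, E]
      · rw [ins_ge ht, ins_ge (by omega), ← P1, h, E]
    · have k' : st x D (t+1) = st x D t := by
        rw [st_succ ht, h, if_neg (fun z => k ((hit_iff hs he).1 z))]
      push Not at k
      obtain ⟨r1, r2, r3, r4⟩ := pass_ne hs he k.1 k.2
      obtain ⟨w1, w2⟩ := not_hit_partner hs he k.1 k.2
      refine ⟨st x D t, hs, ins_ge ht, Or.inr (Or.inl ⟨e, he, Ne.symm k.1, Ne.symm w1, h, ?_⟩)⟩
      rw [ins_ge ht, ins_ge (by omega), k', h, r4]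

theorem phi_delete {v1 v2 : List ℕ} {x : ℕ} (hn : (v1 ++ x :: v2).Nodup) (h1 : ∀ y ∈ v1, x < y)
    (h2 : ∀ y ∈ v2, x < y) : JR x (PhiG bump (v1 ++ v2)) (PhiG bump (v1 ++ x :: v2)) := by
  unfold PhiG
  rw [List.foldl_append, List.foldl_append, List.foldl_cons]
  have hn' := hn
  rw [List.nodup_append] at hn
  obtain ⟨na, nb, nc⟩ := hn
  rw [List.nodup_cons] at nb
  obtain ⟨C, F⟩ := phi_chain na
  have fx := F x (fun h => absurd rfl (nc x h x (by simp)))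
  refine jr_foldl C (chain_ins C fx) (fun y hy => F y (fun h => nc y h y (by simp [hy]) rfl))
    (fun y hy => free_ins (F y (fun h => nc y h y (by simp [hy]) rfl)) (by rintro rfl; exact nb.1 hy))
    h2 nb.2 (jr_base C ?_)
  rw [foldl_early h1]; rfl


theorem bump_inj {p a b} (ha : Addb p a) (hb : Addb p b) (h : bump p a = bump p b) : a = b ∨ a = p b := by
  rw [← hit_iff ha hb, ← h, bump_self]; omega

theorem bump_ne_self {p : ℕ → ℕ} {a} : bump p a ≠ p := by
  intro h
  have := congrFun h a
  rw [bump_self] at this; omega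

theorem jsq_excl {p κ e} (hk : Addb p κ) (he : Addb p e) (n1 : e ≠ κ) (n2 : e ≠ p κ)
    (hk' : Addb (bump p κ) κ) : bump (bump p κ) e ≠ bump (bump p κ) κ := by
  intro h
  obtain ⟨r1, r2, r3, r4⟩ := pass_ne he hk n1 n2
  rcases bump_inj r2 hk' h with h | h
  · exact n1 h
  · unfold Addb at *
    rw [bump_self] at *
    rw [← h, r3] at hk'
    rw [hk'] at he
    omega

theorem jsq_det {p p' q1 q2 q'} (h1 : JSq p p' q1 q') (h2 : JSq p p' q2 q') : q1 = q2 := by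
  obtain ⟨κ, hk, rfl, h1⟩ := h1
  obtain ⟨κ2, hk2, hp2, h2⟩ := h2
  have hkk := bump_inj hk2 hk hp2.symm
  have key : ∀ e, e ≠ κ2 → e ≠ p κ2 → e ≠ κ ∧ e ≠ p κ := by
    intro e a b
    rcases hkk with rfl | rfl
    · exact ⟨a, b⟩
    · unfold Addb at hk; rw [hk] at b; exact ⟨b, a⟩
  have key2 : ∀ e, e ≠ κ → e ≠ p κ → e ≠ κ2 ∧ e ≠ p κ2 := by
    intro e a b
    rcases hkk with rfl | rfl
    · exact ⟨a, b⟩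
    · unfold Addb at hk; rw [hk]; exact ⟨b, a⟩
  rcases h1 with ⟨e1, f1⟩ | ⟨e, he, n1, n2, e1, f1⟩ | ⟨z1, e1, f1⟩ <;>
  rcases h2 with ⟨e2, f2⟩ | ⟨d, hd, m1, m2, e2, f2⟩ | ⟨z2, e2, f2⟩
  · rw [e1, e2]
  · exact absurd (f2.symm.trans f1) bump_ne_self
  · exact absurd (f2.symm.trans f1) bump_ne_self
  · exact absurd (f1.symm.trans f2) bump_ne_self
  · obtain ⟨r1, r2, r3, r4⟩ := pass_ne he hk n1 n2
    have m := key d m1 m2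
    obtain ⟨s1, s2, s3, s4⟩ := pass_ne hd hk m.1 m.2
    have := bump_inj r2 s2 (f1.symm.trans f2)
    rw [s3] at this
    rw [e1, e2, bump_hit hd this]
  · have m := key2 e n1 n2
    have := jsq_excl hk2 he m.1 m.2 (hp2 ▸ z2)
    rw [← hp2] at this
    exact absurd (f1.symm.trans f2) this
  · exact absurd (f1.symm.trans f2) bump_ne_self
  · have m := key d m1 m2
    exact absurd (f2.symm.trans f1) (jsq_excl hk hd m.1 m.2 z1)
  · rw [e1, e2]

/-- Filling a square backwards. -/
theorem jsq_back {p e f} (hp : SC p) (he : Addb p e) (hf : Addb (bump p e) f) :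
    ∃ p', (∃ κ, Addb p κ ∧ p' = bump p κ) ∧ (∃ g, Addb p' g ∧ bump (bump p e) f = bump p' g) ∧
      JSq p p' (bump p e) (bump (bump p e) f) := by
  have main : ∀ f, Addb (bump p e) f → bump p e f ≠ p f →
      ∃ p', (∃ κ, Addb p κ ∧ p' = bump p κ) ∧ (∃ g, Addb p' g ∧ bump (bump p e) f = bump p' g) ∧
      JSq p p' (bump p e) (bump (bump p e) f) := by
    intro f hf hne
    have h1 : f = e ∨ f = p e := by
      by_contra hc
      push Not at hc
      exact hne (bump_ne hc.1 hc.2)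
    have hpf : Addb p f := by
      rcases h1 with rfl | rfl
      · exact he
      · exact addb_partner he
    have E := bump_hit he h1
    exact ⟨bump p e, ⟨e, he, rfl⟩, ⟨f, hf, rfl⟩, f, hpf, E, Or.inr (Or.inr ⟨hf, rfl, rfl⟩)⟩
  by_cases c1 : bump p e f ≠ p f
  · exact main f hf c1
  by_cases c2 : bump p e (bump p e f) ≠ p (bump p e f)
  · have := main _ (addb_partner hf) c2
    rw [bump_partner hf] at this
    exact this
  push Not at c1 c2
  have hpf : Addb p f := by
    unfold Addb at *
    rw [← c1, ← c2, hf]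
  have n : f ≠ e ∧ f ≠ p e := by
    have := hit_iff hpf he
    tauto
  obtain ⟨r1, r2, r3, r4⟩ := pass_ne hpf he n.1 n.2
  obtain ⟨w1, w2⟩ := not_hit_partner hpf he n.1 n.2
  exact ⟨bump p f, ⟨f, hpf, rfl⟩, ⟨e, r1, r4⟩, f, hpf, rfl,
    Or.inr (Or.inl ⟨e, he, Ne.symm n.1, Ne.symm w1, rfl, r4⟩)⟩

/-- Saturated chain on an interval. -/
def Sat (a b : ℕ) (D : ℕ → ℕ → ℕ) : Prop :=
  ∀ t, a ≤ t → t < b → ∃ e, Addb (D t) e ∧ D (t+1) = bump (D t) e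

theorem ext_back {a b : ℕ} (hab : a ≤ b) : ∀ {D : ℕ → ℕ → ℕ} {p'}, (∀ t, a ≤ t → t ≤ b → SC (D t)) → Sat a b D →
    (∃ κ, Addb (D b) κ ∧ p' = bump (D b) κ) →
    ∃ D' : ℕ → ℕ → ℕ, D' b = p' ∧ Sat a b D' ∧ (∀ t, a ≤ t → t ≤ b → ∃ κ, Addb (D t) κ ∧ D' t = bump (D t) κ) ∧
      ∀ t, a ≤ t → t < b → JSq (D t) (D' t) (D (t+1)) (D' (t+1)) := by
  induction b, hab using Nat.le_induction with
  | base =>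
    intro D p' C S hp
    refine ⟨fun _ => p', rfl, fun t _ _ => by omega, ?_, fun t _ _ => by omega⟩
    intro t h1 h2
    obtain rfl : t = a := by omega
    exact hp
  | succ b hb ih =>
    rintro D p' C S ⟨κ, hk, rfl⟩
    obtain ⟨e, he, h⟩ := S b hb (by omega)
    rw [h] at hk ⊢
    obtain ⟨p1, hc, ⟨g, hg, hg2⟩, hJ⟩ := jsq_back (C b hb (by omega)) he hk
    obtain ⟨D', q1, q2, q3, q4⟩   := ih (fun t h1 h2 => C t h1 (by omega)) (fun t h1 h2 => S t h1 (by omega)) hc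
    refine ⟨fun t => if t ≤ b then D' t else bump (bump (D b) e) κ, by simp, ?_, ?_, ?_⟩
    · intro t h1 h2
      by_cases c : t < b
      · simp only [c.le, if_true, Nat.succ_le_of_lt c]
        exact q2 t h1 c
      · obtain rfl : t = b := by omega
        simp only [le_refl, if_true, show ¬ (t + 1 ≤ t) by omega, if_false, q1]
        exact ⟨g, hg, hg2⟩
    · intro t h1 h2
      by_cases c : t ≤ b
      · simp only [c, if_true]; exact q3 t h1 c
      · obtain rfl : t = b + 1 := by omega
        simp only [c, if_false, h]
        exact ⟨κ, hk, rfl⟩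
    · intro t h1 h2
      by_cases c : t < b
      · simp only [c.le, if_true, Nat.succ_le_of_lt c]
        exact q4 t h1 c
      · obtain rfl : t = b := by omega
        simp only [le_refl, if_true, show ¬ (t + 1 ≤ t) by omega, if_false, q1, h]
        exact hJ

theorem sat_sc {a b : ℕ} {D : ℕ → ℕ → ℕ} (h0 : SC (D a)) (h : Sat a b D) : ∀ t, a ≤ t → t ≤ b → SC (D t) := by
  intro t ht
  induction t, ht using Nat.le_induction with
  | base => intro _; exact h0
  | succ t ht ih =>
    intro hb
    obtain ⟨e, he, h1⟩ := h t ht (by omega)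
    rw [h1]; exact bump_sc (ih (by omega)) he

def zsh : ℕ → ℕ := fun _ => 0

theorem sc_zero : SC zsh := by intro i j; simp [zsh]

theorem triangle {m : ℕ} {c : ℕ → ℕ → ℕ} (hm : c m = zsh)
    (hc : ∀ j, j < m → ∃ e, Addb (c (j+1)) e ∧ c j = bump (c (j+1)) e) : ∀ d, d ≤ m →
    ∃ Y : ℕ → ℕ → ℕ → ℕ, ∀ j, m - d ≤ j → j ≤ m → Y j m = c j ∧ Y j j = zsh ∧ Sat j m (Y j) ∧
      (j < m → ∀ t, j + 1 ≤ t → t < m → JSq (Y (j+1) t) (Y j t) (Y (j+1) (t+1)) (Y j (t+1))) := by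
  intro d
  induction d with
  | zero =>
    intro _
    refine ⟨fun _ _ => zsh, ?_⟩
    intro j h1 h2
    obtain rfl : j = m := by omega
    exact ⟨hm.symm, rfl, fun t _ _ => by omega, fun h => by omega⟩
  | succ d ih =>
    intro hd
    obtain ⟨Y, hY⟩ := ih (by omega)
    obtain ⟨i, hi⟩ : ∃ i, i + 1 = m - d := ⟨m - d - 1, by omega⟩
    obtain ⟨y1, y2, y3, y4⟩ := hY (i+1) (by omega) (by omega)
    have S := sat_sc (by rw [y2]; exact sc_zero) y3
    obtain ⟨D', q1, q2, q3, q4⟩ := ext_back (a := i+1) (b := m) (by omega) S y3 (p' := c i)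
      (by rw [y1]; exact hc i (by omega))
    refine ⟨fun j t => if j = i then (if t ≤ i then zsh else D' t) else Y j t, ?_⟩
    intro j h1 h2
    by_cases c : j = i
    · subst c
      simp only [if_true, show ¬ (m ≤ j) by omega, if_false, le_refl]
      refine ⟨q1, trivial, ?_, ?_⟩
      · intro t k1 k2
        by_cases e : t = j
        · subst e
          simp only [le_refl, if_true, show ¬ (t + 1 ≤ t) by omega, if_false]
          obtain ⟨κ, z1, z2⟩ := q3 (t+1) le_rfl (by omega)
          rw [y2] at z1 z2
          exact ⟨κ, z1, z2⟩
        · simp only [show ¬ (t ≤ j) by omega, show ¬ (t + 1 ≤ j) by omega, if_false]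
          exact q2 t (by omega) k2
      · intro _ t k1 k2
        simp only [show ¬ (t ≤ j) by omega, show ¬ (t + 1 ≤ j) by omega, if_false,
          show ¬ (j + 1 = j) by omega]
        exact q4 t k1 k2
    · simp only [c, if_false, show ¬ (j + 1 = i) by omega]
      exact hY j (by omega) h2


/-- Remove the corner of row `r`. -/
def unb (P : ℕ → ℕ) (r : ℕ) : ℕ → ℕ :=
  fun k => if k = r then P r - 1 else if k = P r - 1 then r else P k

theorem unb_sc {P r} (h : SC P) (h1 : 1 ≤ P r) (h2 : P (P r - 1) = r + 1) : SC (unb P r) := by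
  intro i j
  have a1 := h i j
  have a2 := h r j
  have a3 := h i r
  have a4 := h (P r - 1) j
  have a5 := h i (P r - 1)
  unfold unb
  split_ifs <;> subst_vars <;> simp_all <;> omega

theorem unb_addb {P r} : Addb (unb P r) r := by
  have : unb P r r = P r - 1 := by simp [unb]
  unfold Addb; rw [this]; unfold unb; split_ifs <;> omega

theorem unb_bump {P r} (h1 : 1 ≤ P r) (h2 : P (P r - 1) = r + 1) : bump (unb P r) r = P := by
  have : unb P r r = P r - 1 := by simp [unb]
  funext k
  simp only [bump, this]
  unfold unb
  split_ifs <;> subst_vars <;> omega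

theorem corner_of_lt {P r} (h : SC P) (h1 : P (r+1) < P r) : P (P r - 1) = r + 1 := by
  have a := h (P r - 1) r
  have b := h (P r - 1) (r+1)
  omega

/-- Two shapes covered by the same shape. -/
theorem meet {q z r e} (hq : SC q) (hz : SC z) (hr : Addb q r) (he : Addb z e)
    (h : bump q r = bump z e) : (q = z ∧ (r = e ∨ r = q e)) ∨
    ∃ d, SC d ∧ Addb d r ∧ Addb d e ∧ r ≠ e ∧ r ≠ d e ∧ q = bump d e ∧ z = bump d r := by
  have cz : ∀ k, bump q r k = bump z e k := fun k => congrFun h k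
  by_cases c : r = e ∨ r = z e
  · left
    have hz2 : Addb z r := by
      rcases c with rfl | rfl
      · exact he
      · exact addb_partner he
    rw [bump_hit he c] at h
    have e1 : q r = z r := by
      have := congrFun h r
      rw [bump_self, bump_self] at this; omega
    have : q = z := by
      funext k
      have := congrFun h k
      unfold bump at this
      unfold Addb at *
      rw [e1] at this
      by_cases k1 : k = r
      · rw [k1, e1]
      · by_cases k2 : k = z r
        · rw [k2]
          rw [e1] at hr
          rw [hr, hz2]
        · simp [k1, k2] at this; exact this
    subst this
    exact ⟨rfl, c⟩
  · right
    push Not at c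
    have zr : z r = q r + 1 := by
      have := cz r
      rw [bump_self, bump_ne c.1 c.2] at this; exact this.symm
    have zqr : z (q r) = r + 1 := by
      have h1 := cz (q r)
      rw [bump_at_partner hr] at h1
      have n1 : q r ≠ e := by
        intro k
        apply c.2
        have := cz e
        rw [bump_self] at this
        rw [← k, bump_at_partner hr, k] at this
        omega
      have n2 : q r ≠ z e := by
        intro k
        have := cz (z e)
        rw [bump_at_partner he] at this
        rw [← k, bump_at_partner hr] at this
        apply c.1; omega
      rw [bump_ne n1 n2] at h1
      exact h1.symm
    have h1 : 1 ≤ z r := by omega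
    have h2 : z (z r - 1) = r + 1 := by rw [zr]; exact zqr
    have hd := unb_sc hz h1 h2
    have hB := unb_bump h1 h2
    have dr : unb z r r = q r := by simp [unb, zr]
    have ad : Addb (unb z r) r := unb_addb
    have qe' : q r ≠ e := by
      intro k
      apply c.2
      have := cz e
      rw [bump_self] at this
      rw [← k, bump_at_partner hr, k] at this
      omega
    have de : unb z r e = z e := by
      unfold unb
      rw [if_neg (Ne.symm c.1), if_neg (by rw [zr]; simpa using Ne.symm qe')]
    have ae : Addb (unb z r) e := by
      have n2 : q r ≠ z e := by
        intro k
        have := cz (z e)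
        rw [bump_at_partner he] at this
        rw [← k, bump_at_partner hr] at this
        apply c.1; omega
      unfold Addb
      rw [de]
      unfold unb
      rw [if_neg (Ne.symm c.2), if_neg (by rw [zr]; simpa using Ne.symm n2)]
      exact he
    have c2 : r ≠ unb z r e := by rw [de]; exact c.2
    refine ⟨unb z r, hd, ad, ae, c.1, c2, ?_, hB.symm⟩
    obtain ⟨r1, r2, r3, r4⟩ := pass_ne ad ae c.1 c2
    rw [hB, ← h] at r4
    have hx : (bump (unb z r) e) r = q r := by rw [r3, dr]
    funext k
    have := congrFun r4 k
    unfold bump at this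
    change (if k = r then bump (unb z r) e r + 1 else if k = bump (unb z r) e r then r + 1 else bump (unb z r) e k) = _ at this
    rw [hx] at this
    by_cases k1 : k = r
    · rw [k1, hx]
    · by_cases k2 : k = q r
      · have a := r2
        unfold Addb at a hr
        rw [hx] at a
        rw [k2, a, hr]
      · simp only [k1, k2, if_false] at this
        exact this.symm

theorem back_run {Z : ℕ → ℕ → ℕ} (C : Chain Z) (h0 : Z 0 = zsh) : ∀ b q r, SC q → Addb q r →
    Z b = bump q r → ∃ x D, 1 ≤ x ∧ x ≤ b ∧ Chain D ∧ D 0 = zsh ∧ (∀ t, b ≤ t → D t = q) ∧ Free D x ∧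
      st x D b = r ∧ (∀ t, t ≤ b → InsG bump D x t = Z t) ∧ (∀ t, t < b → Z (t+1) = Z t → D (t+1) = D t) := by
  intro b
  induction b with
  | zero =>
    intro q r hq hr h
    have := congrFun (h0.symm.trans h) r
    rw [bump_self] at this
    simp [zsh] at this
  | succ b ih =>
    intro q r hq hr h
    have extend : ∀ q1 r1 (x : ℕ) (D : ℕ → ℕ → ℕ), 1 ≤ x → x ≤ b → Chain D → D 0 = zsh → (∀ t, b ≤ t → D t = q1) →
        Free D x → st x D b = r1 → (∀ t, t ≤ b → InsG bump D x t = Z t) →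
        (∀ t, t < b → Z (t+1) = Z t → D (t+1) = D t) →
        (q = q1 ∨ ∃ e, Addb q1 e ∧ q = bump q1 e) → r = (if q r1 ≠ q1 r1 then r1 + 1 else r1) →
        (Z (b+1) = Z b → q = q1) →
        ∃ x D, 1 ≤ x ∧ x ≤ b + 1 ∧ Chain D ∧ D 0 = zsh ∧ (∀ t, b + 1 ≤ t → D t = q) ∧ Free D x ∧
      st x D (b+1) = r ∧ (∀ t, t ≤ b + 1 → InsG bump D x t = Z t) ∧
        (∀ t, t < b + 1 → Z (t+1) = Z t → D (t+1) = D t) := by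
      intro q1 r1 x D x1 x2 CD D0 Dc F S I N hq1 hr1 hZ
      have cg : ∀ s, s ≤ b → (fun t => if t ≤ b then D t else q) s = D s := by
        intro s hs; simp [hs]
      have hst : st x (fun t => if t ≤ b then D t else q) (b+1) = r := by
        rw [st_succ x2, st_congr cg, S]
        simp only [le_refl, if_true, show ¬ (b + 1 ≤ b) by omega, if_false, Dc b le_rfl]
        exact hr1.symm
      refine ⟨x, fun t => if t ≤ b then D t else q, x1, by omega, ⟨?_, ?_⟩, by simpa using D0, ?_, ?_, hst, ?_, ?_⟩
      · intro t
        by_cases c : t ≤ b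
        · simp only [c, if_true]; exact CD.1 t
        · simp only [c, if_false]; exact hq
      · intro t
        by_cases c : t + 1 ≤ b
        · simp only [c, show t ≤ b by omega, if_true]; exact CD.2 t
        · by_cases c2 : t = b
          · subst c2
            simp only [le_refl, if_true, c, if_false, Dc t le_rfl]; exact hq1
          · left; simp only [c, show ¬ (t ≤ b) by omega, if_false]
      · intro t ht; simp only [show ¬ (t ≤ b) by omega, if_false]
      · intro t ht
        simp only [show t ≤ b by omega, show t + 1 ≤ b by omega, if_true]
        exact F t ht
      · intro t ht
        by_cases c : t ≤ b
        · rw [ins_congr (D' := D) (fun s hs => cg s (by omega)), I t c]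
        · obtain rfl : t = b + 1 := by omega
          rw [ins_ge (by omega), hst, h]
          simp
      · intro t ht hz
        by_cases c : t < b
        · simp only [show t ≤ b by omega, show t + 1 ≤ b by omega, if_true]
          exact N t c hz
        · obtain rfl : t = b := by omega
          simp only [le_refl, if_true, show ¬ (t + 1 ≤ t) by omega, if_false, Dc t le_rfl]
          exact hZ hz
    rcases C.2 b with hb | ⟨e, he, hb⟩
    · obtain ⟨x, D, x1, x2, k1, k2, k3, k4, k5, k6, k7⟩ := ih q r hq hr (hb ▸ h)
      exact extend q r x D x1 x2 k1 k2 k3 k4 k5 k6 k7 (Or.inl rfl) (by simp) (fun _ => rfl)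
    · have hne : Z (b+1) ≠ Z b := by rw [hb]; exact bump_ne_self
      rcases meet hq (C.1 b) hr he (h.symm.trans hb) with ⟨m1, m2⟩ | ⟨d, m1, m2, m3, m4, m5, m6, m7⟩
      · rcases Nat.eq_zero_or_pos r with c | c
        · subst c
          refine ⟨b + 1, fun t => if t ≤ b then Z t else q, by omega, le_rfl, ⟨?_, ?_⟩, by simpa using h0, ?_, ?_, st_le le_rfl, ?_, ?_⟩
          · intro t
            by_cases c : t ≤ b
            · simp only [c, if_true]; exact C.1 t
            · simp only [c, if_false]; exact hq
          · intro t
            by_cases c : t + 1 ≤ b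
            · simp only [c, show t ≤ b by omega, if_true]; exact C.2 t
            · by_cases c2 : t = b
              · subst c2
                left
                simp only [le_refl, if_true, c, if_false, m1]
              · left; simp only [c, show ¬ (t ≤ b) by omega, if_false]
          · intro t ht; simp only [show ¬ (t ≤ b) by omega, if_false]
          · intro t ht
            obtain rfl : t = b := by omega
            simp only [le_refl, if_true, show ¬ (t + 1 ≤ t) by omega, if_false, m1]
          · intro t ht
            by_cases c : t ≤ b
            · rw [ins_lt (by omega)]; simp [c]
            · obtain rfl : t = b + 1 := by omega
              rw [ins_ge le_rfl, st_le le_rfl, h]; simp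
          · intro t ht hz
            by_cases c : t < b
            · simp only [show t ≤ b by omega, show t + 1 ≤ b by omega, if_true]
              exact hz
            · obtain rfl : t = b := by omega
              exact absurd hz hne
        · obtain ⟨r0, rfl⟩ : ∃ r0, r = r0 + 1 := ⟨r - 1, by omega⟩
          have hlt : q (r0 + 1) < q r0 := by
            have a := hq.anti (Nat.le_add_right r0 1)
            have b1 := hr
            unfold Addb at b1
            have a2 := hq r0 (q (r0 + 1))
            omega
          have k1 := corner_of_lt hq hlt
          have h1 : 1 ≤ q r0 := by omega
          have B := unb_bump h1 k1
          have ad : Addb (unb q r0) r0 := unb_addb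
          obtain ⟨x, D, x1, x2, k1, k2, k3, k4, k5, k6, k7⟩ := ih (unb q r0) r0 (unb_sc hq h1 k1) ad (by rw [B, m1])
          refine extend _ _ x D x1 x2 k1 k2 k3 k4 k5 k6 k7 (Or.inr ⟨r0, ad, B.symm⟩) ?_ (fun z => absurd z hne)
          rw [if_pos]
          conv_lhs => rw [← B]
          rw [bump_self]; omega
      · obtain ⟨x, D, x1, x2, k1, k2, k3, k4, k5, k6, k7⟩ := ih d r m1 m2 m7
        refine extend _ _ x D x1 x2 k1 k2 k3 k4 k5 k6 k7 (Or.inr ⟨e, m3, m6⟩) ?_ (fun z => absurd z hne)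
        rw [if_neg]
        rw [m6, bump_ne m4 m5]; simp

open Classical in
theorem word_exists : ∀ (N m : ℕ) (Z : ℕ → ℕ → ℕ), ((Finset.range m).filter (fun t => Z (t+1) ≠ Z t)).card = N →
    Chain Z → Z 0 = zsh → (∀ t, m ≤ t → Z t = Z m) →
    ∃ v : List ℕ, v.Nodup ∧ (∀ x ∈ v, 1 ≤ x ∧ x ≤ m ∧ ¬ Free Z x) ∧ PhiG bump v = Z := by
  intro N
  induction N with
  | zero =>
    intro m Z hN C h0 hm
    refine ⟨[], by simp, by simp, ?_⟩
    have : ∀ t, t ≤ m → Z t = zsh := by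
      intro t
      induction t with
      | zero => intro _; exact h0
      | succ t ih =>
        intro ht
        rw [Finset.card_eq_zero, Finset.filter_eq_empty_iff] at hN
        have := hN (Finset.mem_range.2 (show t < m by omega))
        push Not at this
        rw [this]; exact ih (by omega)
    funext t
    rcases Nat.le_total t m with c | c
    · rw [this t c]; rfl
    · rw [hm t c, this m le_rfl]; rfl
  | succ N ih =>
    intro m Z hN C h0 hm
    have hne : Z m ≠ zsh := by
      intro hz
      have : ∀ d t, t + d = m → Z t = zsh := by
        intro d
        induction d with
        | zero => intro t ht; obtain rfl : t = m := by omega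
                  exact hz
        | succ d ihd =>
          intro t ht
          have h1 := ihd (t+1) (by omega)
          rcases C.2 t with h | ⟨e, he, h⟩
          · rw [← h]; exact h1
          · have := congrFun (h1.symm.trans h) e
            rw [bump_self] at this; simp [zsh] at this
      have : ((Finset.range m).filter (fun t => Z (t+1) ≠ Z t)) = ∅ := by
        rw [Finset.filter_eq_empty_iff]
        intro t ht
        rw [Finset.mem_range] at ht
        rw [this (m-t) t (by omega), this (m-(t+1)) (t+1) (by omega)]
        simp
      rw [this] at hN; simp at hN
    have hS := C.1 m
    have hpos : 0 < Z m 0 := by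
      by_contra hc
      apply hne
      funext i
      have := hS.anti (Nat.zero_le i)
      simp only [zsh]; omega
    obtain ⟨r, hr⟩ : ∃ r, r + 1 = Z m 0 := ⟨Z m 0 - 1, by omega⟩
    have c1 := hS r 0
    have c2 := hS (r+1) 0
    have hlt : Z m (r+1) < Z m r := by omega
    have k := corner_of_lt hS hlt
    have h1 : 1 ≤ Z m r := by omega
    obtain ⟨x, D, x1, x2, k1, k2, k3, k4, k5, k6, k7⟩ := back_run C h0 m _ r (unb_sc hS h1 k) unb_addb (unb_bump h1 k).symm
    have hins : InsG bump D x = Z := by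
      have : ∀ d, InsG bump D x (m + d) = Z (m + d) := by
        intro d
        induction d with
        | zero => exact k6 m le_rfl
        | succ d ihd =>
          rw [show m + (d+1) = (m + d) + 1 by omega, ins_same (by rw [k3 _ (by omega), k3 _ (by omega)]) (by omega), ihd,
            hm _ (by omega), hm (m + d + 1) (by omega)]
      funext t
      rcases Nat.le_total t m with c | c
      · rw [k6 t c]
      · have := this (t - m)
        rw [show m + (t - m) = t by omega] at this
        rw [this]
    have k7' : ∀ t, Z (t+1) = Z t → D (t+1) = D t := by
      intro t h
      rcases Nat.lt_or_ge t m with c | c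
      · exact k7 t c h
      · rw [k3 t c, k3 (t+1) (by omega)]
    have nfx : ¬ Free Z x := by
      intro hf
      obtain ⟨t, rfl⟩ : ∃ t, x = t + 1 := ⟨x - 1, by omega⟩
      have b := birth_step k1 k4 rfl
      rw [hins] at b
      have := hf t rfl
      rw [b.2] at this
      exact bump_ne_self this
    have hcard : ((Finset.range m).filter (fun t => D (t+1) ≠ D t)).card < N + 1 := by
      rw [← hN]
      apply Finset.card_lt_card
      rw [Finset.ssubset_iff_of_subset]
      · refine ⟨x - 1, ?_, ?_⟩
        · simp only [Finset.mem_filter, Finset.mem_range]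
          refine ⟨by omega, fun h => nfx ?_⟩
          rintro t rfl
          exact h
        · simp only [Finset.mem_filter, Finset.mem_range, not_and, not_not]
          intro _
          exact k4 (x - 1) (by omega)
      · intro t ht
        simp only [Finset.mem_filter, Finset.mem_range] at ht ⊢
        exact ⟨ht.1, fun h => ht.2 (k7' t h)⟩
    have hle : ((Finset.range m).filter (fun t => D (t+1) ≠ D t)).card = N := by
      have : ((Finset.range m).filter (fun t => Z (t+1) ≠ Z t)) ⊆
          insert (x-1) ((Finset.range m).filter (fun t => D (t+1) ≠ D t)) := by
        intro t ht
        simp only [Finset.mem_filter, Finset.mem_range, Finset.mem_insert] at ht ⊢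
        by_cases c : t = x - 1
        · exact Or.inl c
        · right
          refine ⟨ht.1, fun h => ht.2 ?_⟩
          rw [← hins]
          exact ins_same h (by omega)
      have h2 := Finset.card_le_card this
      have h3 := Finset.card_insert_le (x-1) ((Finset.range m).filter (fun t => D (t+1) ≠ D t))
      omega
    obtain ⟨v, v1, v2, v3⟩ := ih m D hle k1 k2 (fun t ht => by rw [k3 t ht, k3 m le_rfl])
    have hxv : x ∉ v := fun h => (v2 x h).2.2 k4
    refine ⟨v ++ [x], ?_, ?_, ?_⟩
    · rw [List.nodup_append]
      refine ⟨v1, by simp, ?_⟩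
      intro a ha b hb
      simp at hb; subst hb
      rintro rfl; exact hxv ha
    · intro y hy
      rw [List.mem_append] at hy
      rcases hy with hy | hy
      · obtain ⟨y1, y2, y3⟩ := v2 y hy
        refine ⟨y1, y2, fun h => y3 ?_⟩
        rintro t rfl
        exact k7' t (h t rfl)
      · simp at hy; subst hy
        exact ⟨x1, x2, nfx⟩
    · unfold PhiG at *
      rw [List.foldl_append, v3, List.foldl_cons, List.foldl_nil, hins]


/-- A sequence of jeu de taquin steps on chains. -/
inductive Desc : (ℕ → ℕ → ℕ) → ℕ → (ℕ → ℕ → ℕ) → Prop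
  | nil (X : ℕ → ℕ → ℕ) : Chain X → Desc X 0 X
  | cons {X X1 Xf : ℕ → ℕ → ℕ} {m : ℕ} : Chain X → JR 0 X1 X → Desc X1 m Xf → Desc X (m+1) Xf

theorem Desc.seq {X m Xf} (h : Desc X m Xf) : ∃ S : ℕ → ℕ → ℕ → ℕ, S 0 = X ∧ S m = Xf ∧
    ∀ j, j < m → JR 0 (S (j+1)) (S j) := by
  induction h with
  | nil X _ => exact ⟨fun _ => X, rfl, rfl, fun j hj => by omega⟩
  | @cons X X1 Xf m C J _ ih =>
    obtain ⟨S, s0, sm, s⟩ := ih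
    refine ⟨fun j => match j with | 0 => X | j+1 => S j, rfl, sm, ?_⟩
    intro j hj
    cases j with
    | zero => simpa [s0] using J
    | succ j => exact s j (by omega)

theorem st_shift {x m t : ℕ} {D : ℕ → ℕ → ℕ} : st (x+m) D (t+m) = st x (fun s => D (s+m)) t := by
  induction t with
  | zero => rw [st_le (by omega), st_le (by omega)]
  | succ t ih =>
    by_cases c : t + 1 ≤ x
    · rw [st_le c, st_le (by omega)]
    · rw [show t + 1 + m = (t + m) + 1 by omega, st_succ (by omega), st_succ (by omega), ih]
      simp only [show t + 1 + m = (t + m) + 1 by omega]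

theorem ins_shift {B} {x m : ℕ} {D : ℕ → ℕ → ℕ} :
    (fun s => InsG B D (x+m) (s+m)) = InsG B (fun s => D (s+m)) x := by
  funext s
  by_cases c : s < x
  · rw [ins_lt c, ins_lt (by omega)]
  · rw [ins_ge (by omega), ins_ge (by omega), st_shift]

theorem foldl_shift {B} {m : ℕ} {u : List ℕ} : ∀ {D : ℕ → ℕ → ℕ},
    (fun s => (u.map (· + m)).foldl (InsG B) D (s+m)) = u.foldl (InsG B) (fun s => D (s+m)) := by
  induction u with
  | nil => intro D; rfl
  | cons x u ih =>
    intro D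
    rw [List.map_cons, List.foldl_cons, ih, List.foldl_cons, ins_shift]

theorem phi_del_filter {U : List ℕ} {j : ℕ} (hn : U.Nodup) (hj : j + 1 ∈ U) :
    JR (j+1) (PhiG bump (U.filter (fun y => decide (j + 1 < y))))
      (PhiG bump (U.filter (fun y => decide (j < y)))) := by
  obtain ⟨a, b, rfl⟩ := List.append_of_mem hj
  have hn' := hn
  rw [List.nodup_append] at hn
  obtain ⟨na, nb, nc⟩ := hn
  rw [List.nodup_cons] at nb
  have ea : a.filter (fun y => decide (j < y)) = a.filter (fun y => decide (j + 1 < y)) := by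
    apply List.filter_congr
    intro y hy
    have := nc y hy (j+1) (by simp)
    rw [decide_eq_decide]; omega
  have eb : b.filter (fun y => decide (j < y)) = b.filter (fun y => decide (j + 1 < y)) := by
    apply List.filter_congr
    intro y hy
    have : y ≠ j + 1 := by rintro rfl; exact nb.1 hy
    rw [decide_eq_decide]; omega
  have hf := hn'.filter (fun y => decide (j < y))
  simp only [List.filter_append, List.filter_cons, lt_self_iff_false, decide_false, Bool.false_eq_true,
    if_false, Nat.lt_succ_self, decide_true, if_true] at hf ⊢
  rw [ea, eb] at *
  apply phi_delete hf
  · intro y hy; simpa using (List.mem_filter.1 hy).2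
  · intro y hy; simpa using (List.mem_filter.1 hy).2

theorem main_comb {X Xf : ℕ → ℕ → ℕ} {m : ℕ} {u : List ℕ} (hd : Desc X m Xf) (hf : Xf 0 = zsh)
    (hu : u.Nodup) (hu1 : ∀ x ∈ u, 1 ≤ x)
    (hX : u.foldl (InsG bump) (fun _ => X 0) = X) : Xf = PhiG bump u := by
  classical
  obtain ⟨S, s0, sm, hS⟩ := hd.seq
  obtain ⟨Y, hY⟩ := triangle (m := m) (c := fun j => S j 0) (by simp only [sm, hf])
    (fun j hj => jsq_cov (hS j hj 0 le_rfl)) m le_rfl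
  simp only [Nat.sub_self, Nat.zero_le, true_imp_iff] at hY
  obtain ⟨y1, y2, y3, -⟩ := hY 0 (Nat.zero_le _)
  have ysc := sat_sc (by rw [y2]; exact sc_zero) y3
  let Z : ℕ → ℕ → ℕ := fun t => Y 0 (min t m)
  have hZ1 : ∀ t, t < m → Z (t+1) = Y 0 (t+1) ∧ Z t = Y 0 t := by
    intro t ht
    simp only [Z]
    rw [min_eq_left (by omega), min_eq_left (by omega)]; exact ⟨rfl, rfl⟩
  have hZ2 : ∀ t, m ≤ t → Z t = X 0 := by
    intro t ht
    simp only [Z]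
    rw [min_eq_right ht, y1, s0]
  have CZ : Chain Z := by
    constructor
    · intro t; exact ysc _ (Nat.zero_le _) (min_le_right _ _)
    · intro t
      rcases Nat.lt_or_ge t m with c | c
      · right
        rw [(hZ1 t c).1, (hZ1 t c).2]
        exact y3 t (Nat.zero_le _) c
      · left; rw [hZ2 t c, hZ2 _ (by omega)]
  obtain ⟨v, v1, v2, v3⟩ := word_exists _ m Z rfl CZ (by simp only [Z, Nat.zero_min, y2])
    (fun t ht => by rw [hZ2 t ht, hZ2 m le_rfl])
  have v4 : ∀ j, j < m → j + 1 ∈ v := by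
    intro j hj
    by_contra hc
    have := (phi_chain v1).2 (j+1) hc j rfl
    rw [v3, (hZ1 j hj).1, (hZ1 j hj).2] at this
    obtain ⟨e, -, h⟩ := y3 j (Nat.zero_le _) hj
    rw [h] at this
    exact bump_ne_self this
  set U := v ++ u.map (· + m) with hU
  have hUn : U.Nodup := by
    rw [hU, List.nodup_append]
    refine ⟨v1, hu.map (fun a b h => by simpa using h), ?_⟩
    intro a ha b hb
    have := (v2 a ha).2.1
    rw [List.mem_map] at hb
    obtain ⟨y, hy, rfl⟩ := hb
    have := hu1 y hy
    omega
  have key : ∀ j, j ≤ m → (∀ t, j ≤ t → t ≤ m → PhiG bump (U.filter (fun y => decide (j < y))) t = Y j t) ∧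
      ∀ s, PhiG bump (U.filter (fun y => decide (j < y))) (s + m) = S j s := by
    intro j
    induction j with
    | zero =>
      intro _
      have : U.filter (fun y => decide (0 < y)) = U := by
        rw [List.filter_eq_self]
        intro y hy
        rw [hU, List.mem_append] at hy
        rcases hy with hy | hy
        · have := (v2 y hy).1
          simp; omega
        · rw [List.mem_map] at hy
          obtain ⟨y, hy, rfl⟩ := hy
          have := hu1 y hy
          simp; omega
      rw [this, hU]
      unfold PhiG at v3 ⊢
      rw [List.foldl_append, v3]
      constructor
      · intro t _ ht
        rw [foldl_early]
        · simp only [Z]; rw [min_eq_left ht]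
        · intro y hy
          rw [List.mem_map] at hy
          obtain ⟨y, hy, rfl⟩ := hy
          have := hu1 y hy
          omega
      · intro s
        have := congrFun (foldl_shift (B := bump) (m := m) (u := u) (D := Z)) s
        rw [this, s0]
        have e : (fun s => Z (s + m)) = fun _ => X 0 := by
          funext s; exact hZ2 _ (by omega)
        rw [e, hX]
    | succ j ih =>
      intro hj
      obtain ⟨i1, i2⟩ := ih (by omega)
      have J := phi_del_filter (j := j) hUn (by rw [hU]; exact List.mem_append_left _ (v4 j (by omega)))
      obtain ⟨-, -, -, y4⟩ := hY j (by omega)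
      obtain ⟨y5, y6, -, -⟩ := hY (j+1) (by omega)
      have p1 : ∀ t, j + 1 ≤ t → t ≤ m → PhiG bump (U.filter (fun y => decide (j + 1 < y))) t = Y (j+1) t := by
        intro t ht
        induction t, ht using Nat.le_induction with
        | base =>
          intro _
          unfold PhiG
          rw [foldl_early, y6]; · rfl
          intro y hy; simpa using (List.mem_filter.1 hy).2
        | succ t ht iht =>
          intro htm
          have a := J t ht
          rw [iht (by omega), i1 t (by omega) (by omega), i1 (t+1) (by omega) (by omega)] at a
          exact jsq_det a (y4 (by omega) t ht (by omega))
      refine ⟨p1, ?_⟩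
      intro s
      induction s with
      | zero => rw [Nat.zero_add, p1 m hj le_rfl, y5]
      | succ s ihs =>
        have a := J (s + m) (by omega)
        rw [ihs, i2 s, show s + m + 1 = (s + 1) + m by omega, i2 (s+1)] at a
        exact jsq_det a (hS j (by omega) s (Nat.zero_le _))
  have h := (key m le_rfl).2
  have : U.filter (fun y => decide (m < y)) = u.map (· + m) := by
    rw [hU, List.filter_append]
    have a : v.filter (fun y => decide (m < y)) = [] := by
      rw [List.filter_eq_nil_iff]
      intro y hy
      have := (v2 y hy).2.1
      simp; omega
    rw [a, List.nil_append, List.filter_eq_self]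
    intro y hy
    rw [List.mem_map] at hy
    obtain ⟨y, hy, rfl⟩ := hy
    have := hu1 y hy
    simp; omega
  rw [this, sm] at h
  funext s
  rw [← h s]
  unfold PhiG
  have := congrFun (foldl_shift (B := bump) (m := m) (u := u) (D := Z0)) s
  exact this


theorem cell_bump {p : ℕ → ℕ} {e r c : ℕ} (he : Addb p e) (hle : e ≤ p e) (hrc : r ≤ c) :
    c < bump p e r ↔ c < p r ∨ (r = e ∧ c = p e) := by
  unfold Addb at he
  unfold bump
  split_ifs with h1 h2
  · subst h1; omega
  · subst h2; omega
  · omega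

theorem bump_norm {p : ℕ → ℕ} {e : ℕ} (he : Addb p e) : ∃ e', Addb p e' ∧ e' ≤ p e' ∧ bump p e = bump p e' := by
  rcases Nat.le_total e (p e) with h | h
  · exact ⟨e, he, h, rfl⟩
  · refine ⟨p e, addb_partner he, ?_, (bump_partner he).symm⟩
    unfold Addb at he; rw [he]; exact h

/-- The filling `f` describes the chain `X` from time `t0` on. -/
def RpAt (t0 : ℕ) (f : ℕ × ℕ → ℕ) (X : ℕ → ℕ → ℕ) : Prop :=
  (∀ r c, c < r → f (r, c) = 0) ∧ ∀ r c, r ≤ c → (c < X t0 r → f (r, c) ≤ t0) ∧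
    (¬ c < X t0 r → f (r, c) = 0 ∨ t0 < f (r, c)) ∧
    ∀ t, t0 ≤ t → (c < X t r ↔ c < X t0 r ∨ (t0 < f (r, c) ∧ f (r, c) ≤ t))

theorem RpAt.succ {t0 f X} (h : RpAt t0 f X) : RpAt (t0+1) f X := by
  refine ⟨h.1, fun r c hrc => ?_⟩
  obtain ⟨h1, h2, h3⟩ := h.2 r c hrc
  have h4 := h3 (t0+1) (by omega)
  refine ⟨fun a => ?_, fun a => ?_, fun t ht => ?_⟩
  · rw [h4] at a
    rcases a with a | a
    · have := h1 a; omega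
    · omega
  · rw [h4] at a
    push Not at a
    have := h2 (by omega); omega
  · rw [h4, h3 t (by omega)]
    by_cases c1 : c < X t0 r
    · simp [c1]
    · simp only [c1, false_or]; omega

theorem corner_out {q : ℕ → ℕ} {a b : ℕ} (hq : SC q) (ha : Addb q a) (hb : q a = b) (hab : a ≤ b) :
    bump q a a = b + 1 ∧ (a + 1 ≤ b → bump q a (a+1) ≤ b) := by
  subst hb
  refine ⟨bump_self, fun h => ?_⟩
  have h1 := hq (a+1) (q a)
  unfold Addb at ha
  unfold bump
  split_ifs <;> omega

/-- Prolong a chain one step backwards. -/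
def consAt (t0 : ℕ) (q : ℕ → ℕ) (X : ℕ → ℕ → ℕ) : ℕ → ℕ → ℕ := fun t => if t ≤ t0 then q else X t

theorem consAt_le {t0 t q X} (h : t ≤ t0) : consAt t0 q X t = q := by simp [consAt, h]
theorem consAt_gt {t0 t q X} (h : t0 < t) : consAt t0 q X t = X t := by simp [consAt, Nat.not_le.2 h]

theorem jr_cons {t0 q} {X' X : ℕ → ℕ → ℕ} (h : JR (t0+1) X' X) (h0 : JSq q (X t0) (X' (t0+1)) (X (t0+1))) :
    JR t0 (consAt t0 q X') X := by
  intro t ht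
  rcases Nat.eq_or_lt_of_le ht with rfl | c
  · rw [consAt_le le_rfl, consAt_gt (by omega)]; exact h0
  · rw [consAt_gt c, consAt_gt (by omega)]; exact h t c

theorem const_cons {n t0 q} {X' : ℕ → ℕ → ℕ} (hn : t0 < n) (h : ∀ t, n ≤ t → t0 + 1 ≤ t → X' (t+1) = X' t) :
    ∀ t, n ≤ t → t0 ≤ t → consAt t0 q X' (t+1) = consAt t0 q X' t := by
  intro t h1 h2
  rw [consAt_gt (by omega), consAt_gt (by omega)]
  exact h t h1 (by omega)

theorem slide_aux (n : ℕ) (X : ℕ → ℕ → ℕ) (C : Chain X) (hX : ∀ t, n ≤ t → X (t+1) = X t) :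
    ∀ (d t0 : ℕ) (f : ℕ × ℕ → ℕ) (a b fuel : ℕ) (q : ℕ → ℕ), n ≤ t0 + d → d ≤ fuel → SC q → Addb q a → q a = b → a ≤ b →
      X t0 = bump q a → RpAt t0 f X → f (a, b) = 0 →
      ∃ X' : ℕ → ℕ → ℕ, X' t0 = q ∧ JR t0 X' X ∧ (∀ t, n ≤ t → t0 ≤ t → X' (t+1) = X' t) ∧
        RpAt t0 (jdtSlide fuel f (a, b)).1 X' ∧
        ∀ r c, r ≤ c → c < q r → (jdtSlide fuel f (a, b)).1 (r, c) = f (r, c) := by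
  intro d
  induction d with
  | zero =>
    intro t0 f a b fuel q hn _ hq ha hb hab hP hR h0
    have hc : ∀ t, t0 ≤ t → X t = X t0 := by
      intro t ht
      induction t, ht using Nat.le_induction with
      | base => rfl
      | succ t ht ih => rw [hX t (by omega), ih]
    have hout : ∀ r c, r ≤ c → ¬ c < X t0 r → f (r, c) = 0 := by
      intro r c hrc h
      by_contra hne
      have h1 := (hR.2 r c hrc).2.1 h
      have h2 := (hR.2 r c hrc).2.2 (f (r, c)) (by omega)
      rw [hc _ (by omega)] at h2
      omega
    obtain ⟨o1, o2⟩ := corner_out hq ha hb hab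
    have hs : (jdtSlide fuel f (a, b)).1 = f := by
      cases fuel with
      | zero => rfl
      | succ fuel =>
        have e1 : f (a, b+1) = 0 := hout a (b+1) (by omega) (by rw [hP, o1]; omega)
        have e2 : f (a+1, b) = 0 := by
          by_cases hh : a + 1 ≤ b
          · exact hout _ _ hh (by rw [hP]; have := o2 hh; omega)
          · exact hR.1 _ _ (by omega)
        simp [jdtSlide, e1, e2]
    rw [hs]
    have hle : a ≤ q a := by omega
    refine ⟨fun _ => q, rfl, ?_, fun _ _ _ => rfl, ⟨hR.1, fun r c hrc => ?_⟩, fun _ _ _ _ => rfl⟩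
    · intro t ht
      rw [hc t ht, hc (t+1) (by omega), hP]
      exact ⟨a, ha, rfl, Or.inl ⟨rfl, rfl⟩⟩
    · have cb := cell_bump ha hle hrc
      rw [← hP] at cb
      obtain ⟨h1, h2, h3⟩ := hR.2 r c hrc
      have ho := hout r c hrc
      have hz : ¬ c < q r → f (r, c) = 0 := by
        intro hcq
        by_cases k : c < X t0 r
        · rcases cb.1 k with k | ⟨rfl, rfl⟩
          · exact absurd k hcq
          · rw [hb]; exact h0
        · exact ho k
      refine ⟨fun k => h1 (cb.2 (Or.inl k)), fun k => Or.inl (hz k), fun t ht => ?_⟩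
      simp only
      by_cases k : c < q r
      · simp [k]
      · rw [hz k]; simp
  | succ d ih =>
    intro t0 f a b fuel q hn hfu hq ha hb hab hP hR h0
    rcases Nat.lt_or_ge t0 n with hlt | hge
    swap
    · obtain ⟨X', k⟩ := ih t0 f a b fuel q (by omega) (by omega) hq ha hb hab hP hR h0
      exact ⟨X', k⟩
    have hle : a ≤ q a := by omega
    rcases C.2 t0 with hs | ⟨e0, he0, hs⟩
    · obtain ⟨X', k1, k2, k3, k4, k5⟩ := ih (t0+1) f a b fuel q (by omega) (by omega) hq ha hb hab (by rw [hs, hP]) hR.succ h0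
      refine ⟨consAt t0 q X', consAt_le le_rfl, jr_cons k2 ?_, const_cons hlt k3, ⟨k4.1, fun r c hrc => ?_⟩, k5⟩
      · rw [k1, hs, hP]
        exact ⟨a, ha, rfl, Or.inl ⟨rfl, rfl⟩⟩
      · rw [consAt_le le_rfl]
        obtain ⟨h1, h2, h3⟩ := k4.2 r c hrc
        rw [k1] at h1 h2 h3
        have cb := cell_bump ha hle hrc
        rw [← hP] at cb
        obtain ⟨g1, g2, g3⟩ := hR.2 r c hrc
        refine ⟨fun k => ?_, fun k => ?_, fun t ht => ?_⟩
        · rw [k5 r c hrc k]; exact g1 (cb.2 (Or.inl k))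
        · have := h2 k; omega
        · rcases Nat.eq_or_lt_of_le ht with rfl | ht'
          · rw [consAt_le le_rfl]
            constructor
            · exact Or.inl
            · rintro (h | h)
              · exact h
              · omega
          · rw [consAt_gt ht', h3 t ht']
            by_cases k : c < q r
            · simp [k]
            · have := h2 k
              simp only [k, false_or]; omega
    · obtain ⟨e, he, hle2, hbe⟩ := bump_norm he0
      rw [hbe] at hs
      clear he0 hbe
      -- the new cell
      have hnew : ∀ r c, r ≤ c → (c < X (t0+1) r ↔ c < X t0 r ∨ (r = e ∧ c = X t0 e)) := by
        intro r c hrc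
        rw [hs]; exact cell_bump he hle2 hrc
      have hfE : f (e, X t0 e) = t0 + 1 := by
        have h1 := (hR.2 e (X t0 e) hle2).2.2 (t0+1) (by omega)
        have h2 := hnew e (X t0 e) hle2
        simp at h2
        rw [← Nat.not_le] at h2
        have : ¬ X t0 e < X t0 e := by omega
        have : X t0 e < X (t0+1) e := by omega
        omega
      have hfo : ∀ r c, f (r, c) = t0 + 1 → r = e ∧ c = X t0 e := by
        intro r c h
        have hrc : r ≤ c := by
          by_contra hh
          have := hR.1 r c (by omega); omega
        obtain ⟨g1, g2, g3⟩ := hR.2 r c hrc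
        have k1 : ¬ c < X t0 r := fun k => by have := g1 k; omega
        have k2 := (g3 (t0+1) (by omega)).2 (Or.inr (by omega))
        exact ((hnew r c hrc).1 k2).resolve_left k1
      obtain ⟨o1, o2⟩ := corner_out hq ha hb hab
      rw [← hP] at o1 o2
      -- values at the neighbours
      have nb1 : f (a, b+1) = 0 ∨ t0 < f (a, b+1) := (hR.2 a (b+1) (by omega)).2.1 (by omega)
      have nb2 : f (a+1, b) = 0 ∨ t0 < f (a+1, b) := by
        by_cases hh : a + 1 ≤ b
        · exact (hR.2 (a+1) b hh).2.1 (by have := o2 hh; omega)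
        · exact Or.inl (hR.1 _ _ (by omega))
      have adj : ∀ fuel', d ≤ fuel' → (jdtSlide fuel f (a, b)).1 =
          (jdtSlide fuel' (Function.update (Function.update f (e, X t0 e) 0) (a, b) (t0+1)) (e, X t0 e)).1 →
          JSq q (X t0) (X t0) (X (t0+1)) → (e, X t0 e) ≠ (a, b) →
          ∃ X' : ℕ → ℕ → ℕ, X' t0 = q ∧ JR t0 X' X ∧ (∀ t, n ≤ t → t0 ≤ t → X' (t+1) = X' t) ∧
            RpAt t0 (jdtSlide fuel f (a, b)).1 X' ∧
            ∀ r c, r ≤ c → c < q r → (jdtSlide fuel f (a, b)).1 (r, c) = f (r, c) := by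
        intro fuel' hfu' hsl hJ hneE
        rw [hsl]
        set f2 := Function.update (Function.update f (e, X t0 e) 0) (a, b) (t0+1) with hf2
        have f2E : f2 (e, X t0 e) = 0 := by
          rw [hf2, Function.update_of_ne hneE, Function.update_self]
        have f2a : f2 (a, b) = t0 + 1 := by rw [hf2, Function.update_self]
        have f2o : ∀ r c, (r, c) ≠ (a, b) → (r, c) ≠ (e, X t0 e) → f2 (r, c) = f (r, c) := by
          intro r c n1 n2
          rw [hf2, Function.update_of_ne n1, Function.update_of_ne n2]
        have hR2 : RpAt (t0+1) f2 X := by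
          have hR1 := hR.succ
          constructor
          · intro r c hrc
            rw [f2o]
            · exact hR.1 r c hrc
            · intro h; rw [Prod.mk.injEq] at h; omega
            · intro h; rw [Prod.mk.injEq] at h; omega
          · intro r c hrc
            by_cases n1 : (r, c) = (a, b)
            · rw [n1, f2a]
              rw [Prod.mk.injEq] at n1
              obtain ⟨rfl, rfl⟩ := n1
              have i1 : c < X (t0+1) r := (hnew r c hrc).2 (Or.inl (by omega))
              refine ⟨fun _ => le_rfl, fun k => absurd i1 k, fun t ht => ?_⟩
              have := ((hR1.2 r c hrc).2.2 t ht).2 (Or.inl i1)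
              simp [i1, this]
            · by_cases n2 : (r, c) = (e, X t0 e)
              · rw [n2, f2E]
                rw [Prod.mk.injEq] at n2
                have i1 : c < X (t0+1) r := (hnew r c hrc).2 (Or.inr n2)
                refine ⟨fun _ => by omega, fun k => absurd i1 k, fun t ht => ?_⟩
                have := ((hR1.2 r c hrc).2.2 t ht).2 (Or.inl i1)
                simp [i1, this]
              · rw [f2o r c n1 n2]; exact hR1.2 r c hrc
        obtain ⟨X', k1, k2, k3, k4, k5⟩ := ih (t0+1) f2 e (X t0 e) fuel' (X t0) (by omega) hfu' (C.1 t0) he rfl hle2 hs hR2 f2E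
        have fin : ∀ r c, r ≤ c → c < q r →
            (jdtSlide fuel' f2 (e, X t0 e)).1 (r, c) = f (r, c) := by
          intro r c hrc hcq
          have cb := cell_bump ha hle hrc
          rw [← hP] at cb
          rw [k5 r c hrc (cb.2 (Or.inl hcq))]
          apply f2o
          · intro h; rw [Prod.mk.injEq] at h
            obtain ⟨rfl, rfl⟩ := h; omega
          · intro h; rw [Prod.mk.injEq] at h
            obtain ⟨rfl, rfl⟩ := h
            have := cb.2 (Or.inl hcq); omega
        have fab : (jdtSlide fuel' f2 (e, X t0 e)).1 (a, b) = t0 + 1 := by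
          rw [k5 a b hab (by omega), f2a]
        refine ⟨consAt t0 q X', consAt_le le_rfl, jr_cons k2 (by rw [k1]; exact hJ), const_cons hlt k3, ⟨k4.1, fun r c hrc => ?_⟩, fin⟩
        rw [consAt_le le_rfl]
        have cb := cell_bump ha hle hrc
        rw [← hP] at cb
        obtain ⟨g1, g2, g3⟩ := hR.2 r c hrc
        obtain ⟨h1, h2, h3⟩ := k4.2 r c hrc
        rw [k1] at h1 h2 h3
        have nq : ¬ c < q r → ((jdtSlide fuel' f2 (e, X t0 e)).1 (r, c) = 0 ∨ t0 < (jdtSlide fuel' f2 (e, X t0 e)).1 (r, c)) ∧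
            (c < X t0 r → (jdtSlide fuel' f2 (e, X t0 e)).1 (r, c) = t0 + 1) := by
          intro k
          by_cases kk : c < X t0 r
          · rcases cb.1 kk with k' | ⟨rfl, hc⟩
            · exact absurd k' k
            · rw [hb] at hc; subst hc
              rw [fab]; exact ⟨Or.inr (by omega), fun _ => rfl⟩
          · exact ⟨by have := h2 kk; omega, fun h => absurd h kk⟩
        refine ⟨fun k => ?_, fun k => (nq k).1, fun t ht => ?_⟩
        · rw [fin r c hrc k]; exact g1 (cb.2 (Or.inl k))
        · rcases Nat.eq_or_lt_of_le ht with rfl | ht'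
          · rw [consAt_le le_rfl]
            constructor
            · exact Or.inl
            · rintro (h | h)
              · exact h
              · omega
          · rw [consAt_gt ht', h3 t ht']
            by_cases k : c < q r
            · have := cb.2 (Or.inl k); simp [k, this]
            · have := nq k
              by_cases kk : c < X t0 r
              · have := this.2 kk
                simp only [k, kk, false_or, true_or, true_iff]; omega
              · have := h2 kk
                simp only [k, kk, false_or]; omega
      by_cases c1 : e = a
      · subst c1
        obtain ⟨fuel', rfl⟩ : ∃ k, fuel = k + 1 := ⟨fuel - 1, by omega⟩
        rw [o1] at hfE
        apply adj fuel' (by omega)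
        · rw [o1]
          have : f (e+1, b) ≠ t0 + 1 := by
            intro h; have := (hfo _ _ h).1; omega
          have c2 : ¬ (f (e, b+1) = 0 ∧ f (e+1, b) = 0) := by omega
          have c3 : f (e+1, b) = 0 ∨ (f (e, b+1) ≠ 0 ∧ f (e, b+1) < f (e+1, b)) := by omega
          rw [jdtSlide]
          simp only
          rw [if_neg c2, if_pos c3, hfE]
        · exact ⟨e, ha, hP, Or.inr (Or.inr ⟨he, rfl, hs⟩)⟩
        · intro h; rw [Prod.mk.injEq] at h; omega
      · by_cases c2 : e = a + 1 ∧ X t0 e = b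
        · obtain ⟨rfl, c2⟩ := c2
          obtain ⟨fuel', rfl⟩ : ∃ k, fuel = k + 1 := ⟨fuel - 1, by omega⟩
          have hbq : Addb q b := by rw [← hb]; exact addb_partner ha
          have hPb : X t0 = bump q b := by rw [hP, ← hb, bump_partner ha]
          have hbP : Addb (X t0) b := by rw [← c2]; exact addb_partner he
          have hs2 : X (t0+1) = bump (X t0) b := by rw [hs, ← c2, bump_partner he]
          rw [c2] at hfE
          apply adj fuel' (by omega)
          · rw [c2]
            have : f (a, b+1) ≠ t0 + 1 := by
              intro h; have := (hfo _ _ h).1; omega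
            have c2 : ¬ (f (a, b+1) = 0 ∧ f (a+1, b) = 0) := by omega
            have c3 : ¬ (f (a+1, b) = 0 ∨ (f (a, b+1) ≠ 0 ∧ f (a, b+1) < f (a+1, b))) := by omega
            rw [jdtSlide]
            simp only
            rw [if_neg c2, if_neg c3, hfE]
          · exact ⟨b, hbq, hPb, Or.inr (Or.inr ⟨hbP, rfl, hs2⟩)⟩
          · intro h; rw [Prod.mk.injEq] at h; omega
        · -- not adjacent
          have eb : e ≠ b := by
            intro h
            have : X t0 b = a + 1 := by
              rw [hP, ← hb]; exact bump_at_partner ha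
            subst h
            omega
          have ene : X t0 e = q e := by
            rw [hP]; exact bump_ne c1 (by rw [hb]; exact eb)
          have heq : Addb q e := by
            have h1 : X t0 (q e) = e := by rw [← ene]; exact he
            unfold Addb
            by_cases k1 : q e = a
            · rw [k1, o1] at h1; omega
            · by_cases k2 : q e = b
              · have : X t0 b = a + 1 := by
                  rw [hP, ← hb]; exact bump_at_partner ha
                rw [k2, this] at h1
                exact absurd ⟨h1.symm, by omega⟩ c2
              · rw [hP, bump_ne k1 (by rw [hb]; exact k2)] at h1
                exact h1
          have eb' : e ≠ q a := by rw [hb]; exact eb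
          obtain ⟨p1, p2, p3, p4⟩ := pass_ne heq ha c1 eb'
          have hX1 : X (t0+1) = bump (bump q e) a := by
            rw [hs, hP, p4]
          have q2a : bump q e a = b := by
            rw [← hb]
            apply bump_ne
            · omega
            · intro h
              unfold Addb at heq
              rw [h] at eb'
              rw [← h] at heq
              omega
          obtain ⟨X', k1, k2, k3, k4, k5⟩ := ih (t0+1) f a b fuel (bump q e) (by omega) (by omega) (bump_sc hq heq) p1 q2a hab hX1 hR.succ h0
          have hle3 : e ≤ q e := by omega
          have cbe : ∀ r c, r ≤ c → (c < bump q e r ↔ c < q r ∨ (r = e ∧ c = q e)) := fun r c hrc => cell_bump heq hle3 hrc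
          have fE : (jdtSlide fuel f (a, b)).1 (e, q e) = t0 + 1 := by
            rw [k5 e (q e) hle3 ((cbe _ _ hle3).2 (Or.inr ⟨rfl, rfl⟩)), ← hfE, ene]
          have fin : ∀ r c, r ≤ c → c < q r → (jdtSlide fuel f (a, b)).1 (r, c) = f (r, c) :=
            fun r c hrc h => k5 r c hrc ((cbe r c hrc).2 (Or.inl h))
          refine ⟨consAt t0 q X', consAt_le le_rfl, jr_cons k2 ?_, const_cons hlt k3, ⟨k4.1, fun r c hrc => ?_⟩, fin⟩
          · rw [k1]
            exact ⟨a, ha, hP, Or.inr (Or.inl ⟨e, heq, c1, eb', rfl, hs⟩)⟩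
          rw [consAt_le le_rfl]
          have cb := cell_bump ha hle hrc
          rw [← hP] at cb
          obtain ⟨g1, g2, g3⟩ := hR.2 r c hrc
          obtain ⟨h1, h2, h3⟩ := k4.2 r c hrc
          rw [k1] at h1 h2 h3
          have cc := cbe r c hrc
          have nq : ¬ c < q r → c < bump q e r → (jdtSlide fuel f (a, b)).1 (r, c) = t0 + 1 := by
            intro k k'
            rcases cc.1 k' with h | ⟨rfl, rfl⟩
            · exact absurd h k
            · exact fE
          refine ⟨fun k => ?_, fun k => ?_, fun t ht => ?_⟩
          · rw [fin r c hrc k]; exact g1 (cb.2 (Or.inl k))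
          · by_cases kk : c < bump q e r
            · have := nq k kk; omega
            · have := h2 kk; omega
          · rcases Nat.eq_or_lt_of_le ht with rfl | ht'
            · rw [consAt_le le_rfl]
              constructor
              · exact Or.inl
              · rintro (h | h)
                · exact h
                · omega
            · rw [consAt_gt ht', h3 t ht']
              by_cases k : c < q r
              · have := cc.2 (Or.inl k); simp [k, this]
              · have := nq k
                by_cases kk : c < bump q e r
                · have := this kk
                  simp only [k, kk, false_or, true_or, true_iff]; omega
                · have := h2 kk
                  simp only [k, kk, false_or]; omega


/-- The filling `f` with entries at most `n` describes the chain `X`. -/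
def Rp (n : ℕ) (f : ℕ × ℕ → ℕ) (X : ℕ → ℕ → ℕ) : Prop :=
  Chain X ∧ (∀ t, n ≤ t → X (t+1) = X t) ∧ RpAt 0 f X

theorem chain_of_jr {X' X : ℕ → ℕ → ℕ} (h0 : SC (X' 0)) (h : JR 0 X' X) : Chain X' := by
  have step : ∀ t, X' (t+1) = X' t ∨ ∃ e, Addb (X' t) e ∧ X' (t+1) = bump (X' t) e := by
    intro t
    obtain ⟨κ, hk, hk2, h1 | ⟨e, h1, -, -, h2, -⟩ | ⟨h1, h2, h3⟩⟩ := h t (Nat.zero_le _)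
    · exact Or.inl h1.1
    · exact Or.inr ⟨e, h1, h2⟩
    · exact Or.inr ⟨κ, hk, by rw [h2, hk2]⟩
  refine ⟨?_, step⟩
  intro t
  induction t with
  | zero => exact h0
  | succ t ih =>
    rcases step t with h1 | ⟨e, h1, h2⟩
    · rw [h1]; exact ih
    · rw [h2]; exact bump_sc ih h1

theorem real_step {n f X a b} (h : Rp n f X) (hab : a ≤ b) (h1 : X 0 a = b + 1) (h2 : X 0 b = a + 1) :
    ∃ X', JR 0 X' X ∧ Rp n (jdtSlide (n+1) f (a, b)).1 X' := by
  obtain ⟨C, hc, hR⟩ := h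
  have hb : X 0 a - 1 = b := by omega
  have q1 := unb_sc (C.1 0) (r := a) (by omega) (by rw [hb, h2])
  have q2 := unb_bump (P := X 0) (r := a) (by omega) (by rw [hb, h2])
  have q3 : unb (X 0) a a = b := by simp [unb, hb]
  have f0 : f (a, b) = 0 := by
    have := (hR.2 a b hab).1 (by omega); omega
  obtain ⟨X', k1, k2, k3, k4, -⟩ := slide_aux n X C hc n 0 f a b (n+1) _ (by omega) (by omega) q1 unb_addb q3 hab q2.symm hR f0
  exact ⟨X', k2, chain_of_jr (by rw [k1]; exact q1) k2, fun t ht => k3 t ht (Nat.zero_le _), k4⟩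

theorem virt_step {n f X a b} (h : Rp n f X) (hab : a ≤ b) (h1 : X 0 a = b + 1) (h2 : X 0 b = a + 1)
    (f1 : f (a, b+1) = 0) (f2 : f (a+1, b) = 0) :
    ∃ X', JR 0 X' X ∧ Rp n f X' := by
  have := real_step h hab h1 h2
  simpa [jdtSlide, f1, f2] using this

/-- The size of a shape. -/
def mu (p : ℕ → ℕ) : ℕ := ∑ r ∈ Finset.range (p 0), p r

theorem bump_mono {p k r} (hk : Addb p k) : p r ≤ bump p k r := by
  unfold Addb at hk
  unfold bump
  split_ifs <;> subst_vars <;> omega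

theorem mu_lt {X' X : ℕ → ℕ → ℕ} (h0 : SC (X' 0)) (h : JR 0 X' X) : mu (X' 0) < mu (X 0) := by
  obtain ⟨k, hk, hk2⟩ := jsq_cov (h 0 le_rfl)
  rw [hk2]
  have hsc := bump_sc h0 hk
  unfold mu
  have a1 : ∑ r ∈ Finset.range (X' 0 0), X' 0 r ≤ ∑ r ∈ Finset.range (bump (X' 0) k 0), X' 0 r := by
    apply Finset.sum_le_sum_of_subset
    exact Finset.range_mono (bump_mono hk)
  refine lt_of_le_of_lt a1 ?_
  apply Finset.sum_lt_sum
  · intro r _; exact bump_mono hk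
  · refine ⟨k, ?_, by rw [bump_self]; omega⟩
    rw [Finset.mem_range, ← hsc k 0, bump_self]; omega

theorem corner_se {p : ℕ → ℕ} {a b : ℕ} (h : SC p) (hab : a ≤ b) (hin : b < p a) :
    ∃ a' b', a ≤ a' ∧ b ≤ b' ∧ a' ≤ b' ∧ p a' = b' + 1 ∧ p b' = a' + 1 := by
  obtain ⟨r, hr⟩ : ∃ r, p b = r + 1 := ⟨p b - 1, by have := h a b; omega⟩
  have e1 := h r b
  have e2 := h (r+1) b
  have e3 := h a b
  have hlt : p (r+1) < p r := by omega
  have k := corner_of_lt h hlt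
  rcases Nat.le_total r (p r - 1) with c | c
  · exact ⟨r, p r - 1, by omega, by omega, c, by omega, k⟩
  · exact ⟨p r - 1, r, by omega, by omega, c, k, by omega⟩

theorem inner_mem {n f X a b} (h : Rp n f X) (hi : InnerCell f (a, b)) : b < X 0 a := by
  obtain ⟨h1, h2, ⟨r, c⟩, h3, h4, h5⟩ := hi
  simp only at h1 h2 h4 h5
  have hrc : r ≤ c := by
    by_contra hh
    exact h3 (h.2.2.1 r c (by omega))
  have i1 : c < X (f (r, c)) r := ((h.2.2.2 r c hrc).2.2 _ (Nat.zero_le _)).2 (by omega)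
  have i2 : b < X (f (r, c)) a := by
    have := (h.1.1 (f (r, c))).anti h4; omega
  rcases ((h.2.2.2 a b h1).2.2 _ (Nat.zero_le _)).1 i2 with i3 | i3
  · exact i3
  · omega

/-- A corner of the inner shape which lies in a noninner area is removable for free. -/
theorem virt_corner {n f X a b} (h : Rp n f X) (hab : a ≤ b) (hin : b < X 0 a) (hn : ¬ InnerCell f (a, b)) :
    ∃ X', JR 0 X' X ∧ Rp n f X' := by
  have f0 : f (a, b) = 0 := by
    have := (h.2.2.2 a b hab).1 hin; omega
  have hs : ∀ r c, a ≤ r → b ≤ c → f (r, c) = 0 := by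
    intro r c h1 h2
    by_contra hc
    exact hn ⟨hab, f0, (r, c), hc, h1, h2⟩
  obtain ⟨a', b', k1, k2, k3, k4, k5⟩ := corner_se (h.1.1 0) hab hin
  exact virt_step h k3 k4 k5 (hs _ _ k1 (by omega)) (hs _ _ (by omega) k2)

theorem Desc.trans {X m Y m' Z} (h : Desc X m Y) (h' : Desc Y m' Z) : ∃ k, Desc X k Z := by
  induction h with
  | nil X _ => exact ⟨_, h'⟩
  | cons C J _ ih =>
    obtain ⟨k, hk⟩ := ih h'
    exact ⟨_, Desc.cons C J hk⟩

theorem make_corner {n f a b} (hi : InnerCorner f (a, b)) : ∀ (M : ℕ) (X : ℕ → ℕ → ℕ), mu (X 0) ≤ M → Rp n f X →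
    ∃ m X1, Desc X m X1 ∧ Rp n f X1 ∧ mu (X1 0) ≤ mu (X 0) ∧ X1 0 a = b + 1 ∧ X1 0 b = a + 1 := by
  intro M
  induction M with
  | zero =>
    intro X hM h
    exfalso
    have hin := inner_mem h hi.1
    have hsc := h.1.1 0
    have : X 0 0 ≤ mu (X 0) := by
      unfold mu
      apply Finset.single_le_sum (f := fun r => X 0 r) (fun _ _ => Nat.zero_le _)
      rw [Finset.mem_range]
      have := hsc.anti (Nat.zero_le a); omega
    have := hsc.anti (Nat.zero_le a); omega
  | succ M ih =>
    intro X hM h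
    have hin := inner_mem h hi.1
    have hab : a ≤ b := hi.1.1
    have hsc := h.1.1 0
    have done : (∃ X', JR 0 X' X ∧ Rp n f X') →
        ∃ m X1, Desc X m X1 ∧ Rp n f X1 ∧ mu (X1 0) ≤ mu (X 0) ∧ X1 0 a = b + 1 ∧ X1 0 b = a + 1 := by
      rintro ⟨X', J, h'⟩
      have := mu_lt (h'.1.1 0) J
      obtain ⟨m, X1, k1, k2, k3, k4⟩ := ih X' (by omega) h'
      exact ⟨_, X1, Desc.cons h.1 J k1, k2, by omega, k4⟩
    by_cases c1 : X 0 a = b + 1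
    · by_cases c2 : X 0 b = a + 1
      · exact ⟨0, X, Desc.nil X h.1, h, le_rfl, c1, c2⟩
      · have i1 := hsc a b
        have i2 := hsc (a+1) b
        have : a + 1 ≤ b := by
          by_contra hh
          obtain rfl : a = b := by omega
          omega
        exact done (virt_corner h this (by omega) hi.2.1)
    · exact done (virt_corner h (show a ≤ b + 1 by omega) (by omega) hi.2.2)

theorem step_desc {n f g X} (h : Rp n f X) (hs : JdtStep (n+1) f g) :
    ∃ m Y, Desc X m Y ∧ Rp n g Y ∧ mu (Y 0) < mu (X 0) := by
  obtain ⟨⟨a, b⟩, hi, rfl⟩ := hs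
  obtain ⟨m, X1, k1, k2, k3, k4, k5⟩ := make_corner hi _ X le_rfl h
  obtain ⟨Y, J, hY⟩ := real_step k2 hi.1.1 k4 k5
  have := mu_lt (hY.1.1 0) J
  obtain ⟨k, hk⟩ := k1.trans (Desc.cons k2.1 J (Desc.nil Y hY.1))
  exact ⟨k, Y, hk, hY, by omega⟩

theorem reach_desc {n f g X} (h : Rp n f X) (hs : Relation.ReflTransGen (JdtStep (n+1)) f g) :
    ∃ m Y, Desc X m Y ∧ Rp n g Y := by
  induction hs with
  | refl => exact ⟨0, X, Desc.nil X h.1, h⟩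
  | tail _ hb ih =>
    obtain ⟨m, Y, k1, k2⟩ := ih
    obtain ⟨m', Z, k3, k4, -⟩ := step_desc k2 hb
    obtain ⟨k, hk⟩ := k1.trans k3
    exact ⟨k, Z, hk, k4⟩

theorem finish_desc {n g} (hg : IsRectifiedShifted g) : ∀ (M : ℕ) (X : ℕ → ℕ → ℕ), mu (X 0) ≤ M → Rp n g X →
    ∃ m Y, Desc X m Y ∧ Rp n g Y ∧ Y 0 = zsh := by
  have main : ∀ X : ℕ → ℕ → ℕ, Rp n g X → X 0 = zsh ∨ ∃ X', JR 0 X' X ∧ Rp n g X' := by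
    intro X h
    by_cases c : 0 < X 0 0
    · exact Or.inr (virt_corner h le_rfl c (hg _))
    · left
      funext r
      have := (h.1.1 0).anti (Nat.zero_le r)
      simp only [zsh]; omega
  intro M
  induction M with
  | zero =>
    intro X hM h
    rcases main X h with k | ⟨X', J, h'⟩
    · exact ⟨0, X, Desc.nil X h.1, h, k⟩
    · have := mu_lt (h'.1.1 0) J; omega
  | succ M ih =>
    intro X hM h
    rcases main X h with k | ⟨X', J, h'⟩
    · exact ⟨0, X, Desc.nil X h.1, h, k⟩
    · have := mu_lt (h'.1.1 0) J
      obtain ⟨m, Y, k1, k2, k3⟩ := ih X' (by omega) h'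
      exact ⟨_, Y, Desc.cons h.1 J k1, k2, k3⟩

theorem exists_corner {n f X} (h : Rp n f X) : ∀ d a b, InnerCell f (a, b) → 2 * X 0 0 ≤ a + b + d →
    ∃ c, InnerCorner f c := by
  have bd : ∀ a b, InnerCell f (a, b) → a + b < 2 * X 0 0 := by
    intro a b hi
    have h1 := inner_mem h hi
    have h2 := (h.1.1 0).anti (Nat.zero_le a)
    have h3 : a ≤ b := hi.1
    omega
  intro d
  induction d with
  | zero => intro a b hi h1; have := bd a b hi; omega
  | succ d ih =>
    intro a b hi h1
    by_cases c1 : InnerCell f (a+1, b)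
    · exact ih _ _ c1 (by omega)
    · by_cases c2 : InnerCell f (a, b+1)
      · exact ih _ _ c2 (by omega)
      · exact ⟨(a, b), hi, c1, c2⟩

theorem rect_exists {n} : ∀ (M : ℕ) (f : ℕ × ℕ → ℕ) (X : ℕ → ℕ → ℕ), mu (X 0) ≤ M → Rp n f X →
    ∃ g, Relation.ReflTransGen (JdtStep (n+1)) f g ∧ IsRectifiedShifted g := by
  intro M
  induction M with
  | zero =>
    intro f X hM h
    by_cases hr : IsRectifiedShifted f
    · exact ⟨f, Relation.ReflTransGen.refl, hr⟩
    · unfold IsRectifiedShifted at hr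
      push Not at hr
      obtain ⟨⟨a, b⟩, hi⟩ := hr
      obtain ⟨c, hc⟩ := exists_corner h _ a b hi (Nat.le_add_left _ _)
      obtain ⟨m, Y, -, -, k⟩ := step_desc h ⟨c, hc, rfl⟩
      omega
  | succ M ih =>
    intro f X hM h
    by_cases hr : IsRectifiedShifted f
    · exact ⟨f, Relation.ReflTransGen.refl, hr⟩
    · unfold IsRectifiedShifted at hr
      push Not at hr
      obtain ⟨⟨a, b⟩, hi⟩ := hr
      obtain ⟨c, hc⟩ := exists_corner h _ a b hi (Nat.le_add_left _ _)
      obtain ⟨m, Y, -, k1, k⟩ := step_desc h ⟨c, hc, rfl⟩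
      obtain ⟨g, g1, g2⟩ := ih _ Y (by omega) k1
      exact ⟨g, Relation.ReflTransGen.head ⟨c, hc, rfl⟩ g1, g2⟩

theorem rp_unique {n n' f g} {X : ℕ → ℕ → ℕ} (hf : Rp n f X) (hg : Rp n' g X) : f = g := by
  funext ⟨r, c⟩
  rcases Nat.lt_or_ge c r with h | h
  · rw [hf.2.2.1 r c h, hg.2.2.1 r c h]
  · obtain ⟨f1, f2, f3⟩ := hf.2.2.2 r c h
    obtain ⟨g1, g2, g3⟩ := hg.2.2.2 r c h
    by_cases k : c < X 0 r
    · have := f1 k; have := g1 k; omega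
    · have a1 := f3 (f (r, c)) (Nat.zero_le _)
      have a2 := f3 (g (r, c)) (Nat.zero_le _)
      have b1 := g3 (f (r, c)) (Nat.zero_le _)
      have b2 := g3 (g (r, c)) (Nat.zero_le _)
      omega

/-- The geometric part of the theorem. -/
theorem geom_main {n f h} {X : ℕ → ℕ → ℕ} {u : List ℕ} (hf : Rp n f X)
    (hu : u.Nodup) (hu1 : ∀ x ∈ u, 1 ≤ x)
    (hX : u.foldl (InsG bump) (fun _ => X 0) = X) (hh : Rp n h (PhiG bump u)) :
    (∃ g, Relation.ReflTransGen (JdtStep (n + 1)) f g ∧ IsRectifiedShifted g) ∧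
    (∀ g, Relation.ReflTransGen (JdtStep (n + 1)) f g → IsRectifiedShifted g → g = h) := by
  refine ⟨rect_exists _ f X le_rfl hf, ?_⟩
  intro g hg hr
  obtain ⟨m, Y, k1, k2⟩ := reach_desc hf hg
  obtain ⟨m', Z, k3, k4, k5⟩ := finish_desc hr _ Y le_rfl k2
  obtain ⟨k, hk⟩ := k1.trans k3
  rw [main_comb hk k5 hu hu1 hX] at k4
  exact rp_unique k4 hh


/-- The cell (weakly above the diagonal) of the addable corner of row `r`. -/
def cellOf (p : ℕ → ℕ) (r : ℕ) : ℕ × ℕ := if r ≤ p r then (r, p r) else (p r, r)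

/-- The encoded entry of a letter with value `v` in state `r`. -/
def encOf (v : ℕ) (p : ℕ → ℕ) (r : ℕ) : ℕ := if r ≤ p r then 2 * v else 2 * v - 1

theorem cellOf_le {p r} : (cellOf p r).1 ≤ (cellOf p r).2 := by
  unfold cellOf; split_ifs <;> simp <;> omega

theorem cellOf_out {p r} (h : Addb p r) : (cellOf p r).2 = p (cellOf p r).1 := by
  unfold Addb at h
  unfold cellOf; split_ifs <;> simp [h]

theorem cellOf_hit {p r e} (he : Addb p e) (h : r = e ∨ r = p e) : cellOf p r = cellOf p e := by
  unfold Addb at he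
  rcases h with rfl | rfl
  · rfl
  · unfold cellOf
    rw [he]
    split_ifs
    · have : e = p e := by omega
      rw [← this]
    · rfl
    · rfl
    · omega

theorem cell_bump2 {p e r c} (he : Addb p e) (hrc : r ≤ c) :
    c < bump p e r ↔ c < p r ∨ (r, c) = cellOf p e := by
  rcases Nat.le_total e (p e) with h | h
  · rw [cell_bump he h hrc]
    simp [cellOf, h]
  · have h2 : p (p e) = e := he
    rw [← bump_partner he, cell_bump (addb_partner he) (by omega) hrc, ← cellOf_hit he (Or.inr rfl)]
    simp [cellOf, h2, h]

theorem cell_of_row {p : ℕ → ℕ} {e e' : ℕ} (h : bump p e e' = p e') : cellOf (bump p e) e' = cellOf p e' ∧ ∀ v, encOf v (bump p e) e' = encOf v p e' := by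
  unfold cellOf encOf; rw [h]; exact ⟨rfl, fun _ => rfl⟩

/-- Fillings of the chains: insert the letter `x`. -/
def insF (val : ℕ → ℕ) (D : ℕ → ℕ → ℕ) (F : ℕ → ℕ × ℕ → ℕ) (x : ℕ) : ℕ → ℕ × ℕ → ℕ :=
  fun t c => if x ≤ t ∧ c = cellOf (D t) (st x D t) then encOf (val x) (D t) (st x D t) else F t c

/-- The filling of the chain of a word. -/
def FF (val : ℕ → ℕ) : List ℕ → (ℕ → ℕ → ℕ) → (ℕ → ℕ × ℕ → ℕ) → ℕ → ℕ × ℕ → ℕ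
  | [], _, F => F
  | x :: u, D, F => FF val u (InsG bump D x) (insF val D F x)

/-- The order on the letters. -/
def LOrd (val : ℕ → ℕ) (x y : ℕ) : Prop := val x < val y ∨ (val x = val y ∧ x < y)

theorem st_mono {D x y} (C : Chain D) (hxy : x < y) : ∀ t, st y (InsG bump D x) t ≤ st x D t := by
  intro t
  induction t with
  | zero => simp [st]
  | succ t ih =>
    by_cases hy : t + 1 ≤ y
    · rw [st_le hy]; omega
    · have hx : x ≤ t := by omega
      rcases C.2 t with h | ⟨e, he, h⟩
      · rw [st_same (ins_same h (by omega)), st_same h]; exact ih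
      · obtain ⟨e', hp, ha, hb⟩ := pass_step C hx he h
        have hrx := st_addb C hx
        rcases hp with ⟨n1, n2, n3, rfl⟩ | ⟨n1, n2, rfl⟩
        · rw [n3, st_succ (x := y) (by omega)]
          split_ifs with hh
          · rw [hb] at hh
            have e1 : InsG bump D x t e' = D t e' := by
              rw [ins_ge hx]
              obtain ⟨m1, m2⟩ := not_hit_partner hrx he n1 n2
              exact bump_ne (by omega) (by omega)
            have : st y (InsG bump D x) t = e' ∨ st y (InsG bump D x) t = D t e' := by
              by_contra hc
              push Not at hc
              exact hh (bump_ne hc.1 (by rw [e1]; exact hc.2))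
            omega
          · exact ih
        · rw [n2, st_succ (x := y) (by omega)]
          split_ifs <;> omega

theorem ins_mem {D x s r c} (C : Chain D) (hx : x ≤ s) (hrc : r ≤ c) :
    c < InsG bump D x s r ↔ c < D s r ∨ (r, c) = cellOf (D s) (st x D s) := by
  rw [ins_ge hx]; exact cell_bump2 (st_addb C hx) hrc

/-- Invariant of the fillings. -/
def FInv (val : ℕ → ℕ) (D : ℕ → ℕ → ℕ) (F : ℕ → ℕ × ℕ → ℕ) (s : ℕ) (u : List ℕ) : Prop :=
  ∀ x ∈ u, ∀ r c, r ≤ c → c < D s r → F s (r, c) ≤ 2 * val x ∧ (F s (r, c) = 2 * val x → st x D s ≤ r) ∧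
    (F s (r, c) = 2 * val x - 1 → st x D s ≤ c)

theorem finv_step {val D F s y u} (C : Chain D) (h : FInv val D F s (y :: u)) (hv : ∀ x ∈ y :: u, 1 ≤ val x)
    (ho : ∀ x ∈ u, LOrd val y x) : FInv val (InsG bump D y) (insF val D F y) s u := by
  intro x hx r c hrc hc
  have hvy := hv y (by simp)
  have hvx := hv x (by simp [hx])
  rcases Nat.lt_or_ge s y with hs | hs
  · rw [ins_lt hs] at hc
    have := h x (by simp [hx]) r c hrc hc
    have e1 : insF val D F y s (r, c) = F s (r, c) := by simp [insF, Nat.not_le.2 hs]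
    have e2 : st x (InsG bump D y) s = st x D s := st_congr (fun q hq => ins_lt (by omega))
    rw [e1, e2]; exact this
  · have hor := ho x hx
    have hst : val y = val x → st x (InsG bump D y) s ≤ st y D s := by
      intro hh
      rcases hor with k | k
      · omega
      · exact st_mono C k.2 s
    have hle : val y ≤ val x := by rcases hor with k | k <;> omega
    by_cases hcell : (r, c) = cellOf (D s) (st y D s)
    · have e1 : insF val D F y s (r, c) = encOf (val y) (D s) (st y D s) := by simp [insF, hs, hcell]
      rw [e1]
      unfold cellOf at hcell
      unfold encOf
      split_ifs at hcell ⊢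
      · rw [Prod.mk.injEq] at hcell
        obtain ⟨h1, h2⟩ := hcell
        refine ⟨by omega, fun hh => ?_, fun hh => by omega⟩
        have := hst (by omega); omega
      · rw [Prod.mk.injEq] at hcell
        obtain ⟨h1, h2⟩ := hcell
        refine ⟨by omega, fun hh => by omega, fun hh => ?_⟩
        have := hst (by omega); omega
    · have e1 : insF val D F y s (r, c) = F s (r, c) := by simp [insF, hcell]
      have hin := ((ins_mem C hs hrc).1 hc).resolve_right hcell
      obtain ⟨k1, k2, k3⟩ := h y (by simp) r c hrc hin
      rw [e1]
      refine ⟨by omega, fun hh => ?_, fun hh => ?_⟩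
      · have := hst (by omega); have := k2 (by omega); omega
      · have := hst (by omega); have := k3 (by omega); omega

theorem ins_mono {D x s r} (C : Chain D) : D s r ≤ InsG bump D x s r := by
  rcases Nat.lt_or_ge s x with h | h
  · rw [ins_lt h]
  · rw [ins_ge h]; exact bump_mono (st_addb C h)

theorem foldl_mono {u : List ℕ} {s r} : ∀ {D}, Chain D → (∀ x ∈ u, Free D x) → u.Nodup →
    D s r ≤ u.foldl (InsG bump) D s r := by
  induction u with
  | nil => intro D _ _ _; exact le_rfl
  | cons x u ih =>
    intro D C hf hn
    rw [List.nodup_cons] at hn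
    refine (ins_mono (x := x) C).trans (ih (chain_ins C (hf x (by simp)))
      (fun y hy => free_ins (hf y (by simp [hy])) (by rintro rfl; exact hn.1 hy)) hn.2)

theorem insF_old {val D F x s r c} (C : Chain D) (hc : c < D s r) : insF val D F x s (r, c) = F s (r, c) := by
  unfold insF
  rw [if_neg]
  rintro ⟨h1, h2⟩
  have := cellOf_out (st_addb C h1)
  rw [← h2] at this
  simp only at this; omega

theorem FF_old {val} {u : List ℕ} {s r c} : ∀ {D F}, Chain D → (∀ x ∈ u, Free D x) → u.Nodup → c < D s r →
    FF val u D F s (r, c) = F s (r, c) := by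
  induction u with
  | nil => intro D F _ _ _ _; rfl
  | cons x u ih =>
    intro D F C hf hn hc
    rw [List.nodup_cons] at hn
    rw [FF, ih (chain_ins C (hf x (by simp)))
      (fun y hy => free_ins (hf y (by simp [hy])) (by rintro rfl; exact hn.1 hy)) hn.2
      (lt_of_lt_of_le hc (ins_mono C)), insF_old C hc]

/-- The tableau `T` has shape `p` and entries `G`. -/
def TRep (T : List (List ℕ)) (p : ℕ → ℕ) (G : ℕ × ℕ → ℕ) : Prop :=
  ∀ r, (T.getD r []).length = p r - r ∧ ∀ j, j < p r - r → (T.getD r []).getD j 0 = G (r, r + j)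

theorem padSet_lt {l : List ℕ} {j v} (h : j < l.length) : padSet l j v = l.set j v := by simp [padSet, h]
theorem padSet_eq {l : List ℕ} {v} : padSet l l.length v = l ++ [v] := by simp [padSet]

theorem setBox_getD (T : List (List ℕ)) (r j v r' : ℕ) : (setBox T r j v).getD r' [] =
    if r' = r then padSet (T.getD r []) j v else T.getD r' [] := by
  unfold setBox
  by_cases h : r < T.length
  · simp only [h, if_true]
    by_cases h2 : r' = r
    · subst h2; simp [List.getD_eq_getElem?_getD, h]
    · simp only [h2, if_false]
      simp [List.getD_eq_getElem?_getD, List.getElem?_set, Ne.symm h2]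
  · simp only [h, if_false]
    have e : T ++ List.replicate (r + 1 - T.length) ([] : List ℕ) = T ++ List.replicate (r + 1 - T.length) [] := rfl
    have key : ∀ k, (T ++ List.replicate (r + 1 - T.length) ([] : List ℕ)).getD k [] = T.getD k [] := by
      intro k
      simp only [List.getD_eq_getElem?_getD, List.getElem?_append, List.getElem?_replicate]
      split_ifs with h1 h2
      · rfl
      · rw [List.getElem?_eq_none (by omega)]; rfl
      · rw [List.getElem?_eq_none (by omega)]
    have hl : r < (T ++ List.replicate (r + 1 - T.length) ([] : List ℕ)).length := by simp; omega
    by_cases h2 : r' = r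
    · subst h2
      rw [if_pos rfl, key]
      simp only [List.getD_eq_getElem?_getD, List.getElem?_set, if_true, hl]
      simp
    · simp only [h2, if_false]
      rw [← key r']
      simp only [List.getD_eq_getElem?_getD, List.getElem?_set, Ne.symm h2, if_false]

theorem rep_set {T p G r c v} (h : TRep T p G) (hrc : r ≤ c) (hc : c < p r) :
    TRep (setBox T r (c - r) v) p (Function.update G (r, c) v) := by
  intro r'
  obtain ⟨h1, h2⟩ := h r'
  rw [setBox_getD]
  split_ifs with hr
  · subst hr
    rw [padSet_lt (by omega)]
    refine ⟨by rw [List.length_set, h1], fun j hj => ?_⟩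
    by_cases hjc : j = c - r'
    · subst hjc
      rw [show r' + (c - r') = c by omega, Function.update_self]
      rw [← h1] at hj
      generalize T.getD r' [] = row at hj
      simp [List.getD_eq_getElem?_getD, hj]
    · rw [Function.update_of_ne (by rw [Ne, Prod.mk.injEq]; omega), ← h2 j hj]
      simp [List.getD_eq_getElem?_getD, List.getElem?_set, Ne.symm hjc]
  · refine ⟨h1, fun j hj => ?_⟩
    rw [Function.update_of_ne (by rw [Ne, Prod.mk.injEq]; omega)]; exact h2 j hj

theorem rep_new {T p p' G r c v} (h : TRep T p G) (hrc : r ≤ c) (hc : c = p r)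
    (hp : ∀ r' c', r' ≤ c' → (c' < p' r' ↔ c' < p r' ∨ (r', c') = (r, c))) :
    TRep (setBox T r (c - r) v) p' (Function.update G (r, c) v) := by
  intro r'
  obtain ⟨h1, h2⟩ := h r'
  have key : p' r' - r' = p r' - r' + if r' = r then 1 else 0 := by
    split_ifs with hr
    · subst hr
      have a := hp r' c hrc
      have b := hp r' (c+1) (by omega)
      simp at a b
      omega
    · have a : ∀ d, r' + d < p' r' ↔ r' + d < p r' := by
        intro d
        have a := hp r' (r' + d) (by omega)
        rw [Prod.mk.injEq] at a
        omega
      have a1 := a (p r' - r')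
      have a2 := a (p' r' - r')
      have a3 := a 0
      clear hp h1 h2
      omega
  rw [setBox_getD]
  split_ifs with hr
  · subst hr
    have : c - r' = (T.getD r' []).length := by omega
    rw [if_pos rfl] at key
    rw [this, padSet_eq, key]
    refine ⟨by rw [List.length_append, h1]; rfl, fun j hj => ?_⟩
    by_cases hjc : j = c - r'
    · subst hjc
      rw [show r' + (c - r') = c by omega, Function.update_self, this]
      simp [List.getD_eq_getElem?_getD]
    · rw [Function.update_of_ne (by rw [Ne, Prod.mk.injEq]; omega), ← h2 j (by omega)]
      have hlt : j < (T.getD r' []).length := by omega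
      rw [List.getD_eq_getElem?_getD, List.getElem?_append_left hlt, ← List.getD_eq_getElem?_getD]
  · rw [key, if_neg hr, Nat.add_zero]
    refine ⟨h1, fun j hj => ?_⟩
    rw [Function.update_of_ne (by rw [Ne, Prod.mk.injEq]; omega)]; exact h2 j hj

theorem rep_congr {T p G G'} (h : TRep T p G) (hG : ∀ r c, r ≤ c → c < p r → G (r, c) = G' (r, c)) : TRep T p G' := by
  intro r
  refine ⟨(h r).1, fun j hj => ?_⟩
  rw [(h r).2 j hj, hG r _ (by omega) (by omega)]


theorem bool_cases {P : ℕ → Bool} {n i : ℕ} (hi : i < n) (h1 : P i = true) (h2 : ∀ j < i, P j = false) :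
    (List.range n).find? P = some i := by
  rw [List.find?_range_eq_some]
  refine ⟨h1, by simpa using hi, fun j hj => by simp [h2 j hj]⟩

theorem findIdx_range {P : ℕ → Bool} {n i : ℕ} (hi : i < n) (h1 : P i = true) (h2 : ∀ j < i, P j = false) :
    (List.range n).findIdx P = i := by
  rw [List.findIdx_eq (by simpa using hi)]
  simp only [List.getElem_range]
  exact ⟨h1, h2⟩

theorem findIdx_some {l : List ℕ} {v i : ℕ} (hi : i < l.length) (h1 : v < l.getD i 0)
    (h2 : ∀ j < i, l.getD j 0 ≤ v) : l.findIdx? (fun z => decide (v < z)) = some i := by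
  rw [List.findIdx?_eq_some_iff_getElem]
  refine ⟨hi, ?_, fun j hj => ?_⟩
  · rw [List.getD_eq_getElem _ _ hi] at h1; simpa using h1
  · have := h2 j hj
    rw [List.getD_eq_getElem _ _ (by omega)] at this; simpa using this

theorem findIdx_none {l : List ℕ} {v : ℕ} (h2 : ∀ j < l.length, l.getD j 0 ≤ v) :
    l.findIdx? (fun z => decide (v < z)) = none := by
  rw [List.findIdx?_eq_none_iff]
  intro z hz
  obtain ⟨j, hj, rfl⟩ := List.getElem_of_mem hz
  have := h2 j hj
  rw [List.getD_eq_getElem _ _ hj] at this; simpa using this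

theorem setBox_of_lt {T : List (List ℕ)} {r j v} (h : j < (T.getD r []).length) :
    setBox T r j v = T.set r ((T.getD r []).set j v) := by
  have hr : r < T.length := by
    by_contra hc
    rw [List.getD_eq_default _ _ (by omega)] at h
    simp at h
  unfold setBox
  simp only [hr, if_true]
  rw [padSet_lt h]

/-- The row (resp. column) bound before the insertion cell. -/
def LeftOK (p : ℕ → ℕ) (e : ℕ) (G : ℕ × ℕ → ℕ) (v : ℕ) : Prop :=
  ∀ r c, r ≤ c → c < p r → (if e ≤ p e then r = e else c = e) → G (r, c) ≤ v

theorem sEntry_rep {T p G r c} (h : TRep T p G) (hrc : r ≤ c) (hc : c < p r) : sEntry T r c = G (r, c) := by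
  unfold sEntry
  rw [(h r).2 (c - r) (by omega)]
  congr 2; omega

theorem mix_end {T p G e v fuel} (h : TRep T p G) (hp : SC p) (he : Addb p e) (hl : LeftOK p e G v) :
    mixedIns (fuel+1) T (decide (e ≤ p e)) e v =
      (setBox T (cellOf p e).1 ((cellOf p e).2 - (cellOf p e).1) v, cellOf p e) := by
  unfold LeftOK at hl
  by_cases hc : e ≤ p e
  · simp only [hc, if_true] at hl
    simp only [hc, decide_true, mixedIns, cellOf, if_true]
    have hlen := (h e).1
    rw [findIdx_none]
    · simp only [hlen]
      rw [show e + (p e - e) = p e by omega]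
    · intro j hj
      rw [(h e).2 j (by omega)]
      exact hl e _ (by omega) (by omega) rfl
  · simp only [hc, if_false] at hl
    simp only [hc, decide_false, mixedIns, cellOf, if_false]
    rw [show (List.find? _ (List.range (e+1))) = none from ?_]
    · simp only
      rw [findIdx_range (i := p e) (by omega)]
      · unfold Addb at he
        rw [decide_eq_true_iff, (h _).1, he]
      · intro j hj
        rw [decide_eq_false_iff_not, (h _).1]
        have := hp j e
        omega
    · rw [List.find?_range_eq_none]
      intro r hr
      by_cases h1 : e - r < (T.getD r []).length
      · have h2 : e < p r := by rw [(h _).1] at h1; omega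
        have := hl r e (by omega) h2 rfl
        rw [sEntry_rep h (by omega) h2]
        simp; omega
      · simp only [h1, decide_false, Bool.false_and]; decide

theorem mix_hit {T p q G e v fuel} (h : TRep T q G) (hp : SC p) (he : Addb p e) (hl : LeftOK p e G v)
    (hE : (cellOf p e).2 < q (cellOf p e).1) (hz : v < G (cellOf p e)) :
    mixedIns (fuel+1) T (decide (e ≤ p e)) e v =
      if (if (cellOf p e).1 = (cellOf p e).2 ∧ G (cellOf p e) % 2 = 0 then G (cellOf p e) - 1 else G (cellOf p e)) % 2 = 0
      then mixedIns fuel (setBox T (cellOf p e).1 ((cellOf p e).2 - (cellOf p e).1) v) true ((cellOf p e).1 + 1)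
        (if (cellOf p e).1 = (cellOf p e).2 ∧ G (cellOf p e) % 2 = 0 then G (cellOf p e) - 1 else G (cellOf p e))
      else mixedIns fuel (setBox T (cellOf p e).1 ((cellOf p e).2 - (cellOf p e).1) v) false ((cellOf p e).2 + 1)
        (if (cellOf p e).1 = (cellOf p e).2 ∧ G (cellOf p e) % 2 = 0 then G (cellOf p e) - 1 else G (cellOf p e)) := by
  unfold LeftOK at hl
  by_cases hc : e ≤ p e
  · simp only [hc, if_true] at hl
    have hcell : cellOf p e = (e, p e) := by simp [cellOf, hc]
    rw [hcell] at hE hz ⊢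
    simp only at hE hz ⊢
    have hlen := (h e).1
    have hent : (T.getD e []).getD (p e - e) 0 = G (e, p e) := by
      rw [(h e).2 _ (by omega)]; congr 2; omega
    rw [setBox_of_lt (by omega)]
    simp only [hc, decide_true, mixedIns]
    rw [findIdx_some (i := p e - e)]
    · simp only [hent]
      rw [show e + (p e - e) = p e by omega]
      have : (p e - e = 0) ↔ (e = p e) := by omega
      simp only [this]
    · omega
    · rw [hent]; exact hz
    · intro j hj
      rw [(h e).2 j (by omega)]
      exact hl e _ (by omega) (by omega) rfl
  · simp only [hc, if_false] at hl
    have hcell : cellOf p e = (p e, e) := by simp [cellOf, hc]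
    rw [hcell] at hE hz ⊢
    simp only at hE hz ⊢
    have hent : sEntry T (p e) e = G (p e, e) := sEntry_rep h (by omega) hE
    simp only [hc, decide_false, mixedIns]
    rw [bool_cases (i := p e) (by omega)]
    · simp only [hent]
    · rw [hent, (h _).1]
      simp; omega
    · intro r hr
      have h3 := hp r e
      have h4 := hl r e (by omega) (by omega) rfl
      by_cases h1 : e - r < (T.getD r []).length
      · have h2 : e < q r := by rw [(h _).1] at h1; omega
        rw [sEntry_rep h (by omega) h2]
        simp; omega
      · simp only [h1, decide_false, Bool.false_and]

theorem enc_next {p : ℕ → ℕ} {r w : ℕ} {α : Type} (f : Bool → ℕ → ℕ → α) (hp : SC p) (hr : Addb p r) (hw : 1 ≤ w) :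
    (if (if (cellOf p r).1 = (cellOf p r).2 ∧ encOf w p r % 2 = 0 then encOf w p r - 1 else encOf w p r) % 2 = 0
      then f true ((cellOf p r).1 + 1)
        (if (cellOf p r).1 = (cellOf p r).2 ∧ encOf w p r % 2 = 0 then encOf w p r - 1 else encOf w p r)
      else f false ((cellOf p r).2 + 1)
        (if (cellOf p r).1 = (cellOf p r).2 ∧ encOf w p r % 2 = 0 then encOf w p r - 1 else encOf w p r)) =
    f (decide (r + 1 ≤ bump p r (r+1))) (r+1) (encOf w (bump p r) (r+1)) := by
  have h1 := bump_sc hp hr (r+1) r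
  rw [bump_self] at h1
  rcases lt_trichotomy r (p r) with h | h | h
  · have k : r + 1 ≤ bump p r (r+1) := by omega
    have k1 : cellOf p r = (r, p r) := by simp [cellOf, h.le]
    have k2 : encOf w p r = 2 * w := by simp [encOf, h.le]
    have k3 : encOf w (bump p r) (r+1) = 2 * w := by simp [encOf, k]
    rw [k1, k2, k3, decide_eq_true k]
    simp [h.ne]
  · have k : ¬ r + 1 ≤ bump p r (r+1) := by omega
    have k1 : cellOf p r = (r, r) := by simp [cellOf, ← h]
    have k2 : encOf w p r = 2 * w := by simp [encOf, h.le]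
    have k3 : encOf w (bump p r) (r+1) = 2 * w - 1 := by simp only [encOf, k, if_false]
    rw [k1, k2, k3, decide_eq_false k]
    have : ¬ (2 * w - 1) % 2 = 0 := by omega
    have h2 : (2 * w) % 2 = 0 := by omega
    simp only [h2, and_self, if_true, this, if_false]
  · have k : ¬ r + 1 ≤ bump p r (r+1) := by omega
    have k1 : cellOf p r = (p r, r) := by simp [cellOf, h]
    have k2 : encOf w p r = 2 * w - 1 := by simp [encOf, h]
    have k3 : encOf w (bump p r) (r+1) = 2 * w - 1 := by simp only [encOf, k, if_false]
    rw [k1, k2, k3, decide_eq_false k]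
    have : ¬ (2 * w - 1) % 2 = 0 := by omega
    simp only [h.ne, false_and, if_false, this]

theorem cellOf_cases (p : ℕ → ℕ) (r : ℕ) : (r ≤ p r ∧ cellOf p r = (r, p r) ∧ ∀ v, encOf v p r = 2 * v) ∨
    (p r < r ∧ cellOf p r = (p r, r) ∧ ∀ v, encOf v p r = 2 * v - 1) := by
  by_cases h : r ≤ p r
  · left; exact ⟨h, by simp [cellOf, h], fun v => by simp [encOf, h]⟩
  · right; exact ⟨by omega, by simp [cellOf, h], fun v => by simp [encOf, h]⟩

theorem mixed_run (val : ℕ → ℕ) (t : ℕ) : ∀ (u : List ℕ) (D : ℕ → ℕ → ℕ) (F : ℕ → ℕ × ℕ → ℕ) (v e fuel : ℕ)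
    (T : List (List ℕ)), Chain D → (∀ x ∈ u, Free D x) → u.Nodup → t + 1 ∉ u → (∀ x ∈ u, 1 ≤ val x) →
    u.Pairwise (LOrd val) → Addb (D t) e → D (t+1) = bump (D t) e → FInv val D F (t+1) u →
    (∀ x ∈ u, v ≤ val x) → 1 ≤ v → F (t+1) (cellOf (D t) e) = encOf v (D t) e →
    LeftOK (D t) e (F (t+1)) (encOf v (D t) e) →
    TRep T (u.foldl (InsG bump) D t) (fun c => if c.2 < D t c.1 then F (t+1) c else FF val u D F t c) →
    u.countP (· ≤ t) + 1 ≤ fuel →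
    ∃ T' c, mixedIns fuel T (decide (e ≤ D t e)) e (encOf v (D t) e) = (T', c) ∧
      TRep T' (u.foldl (InsG bump) D (t+1)) (FF val u D F (t+1)) ∧ c.1 ≤ c.2 ∧
      c.2 = u.foldl (InsG bump) D t c.1 ∧
      ∀ r d, r ≤ d → (d < u.foldl (InsG bump) D (t+1) r ↔ d < u.foldl (InsG bump) D t r ∨ (r, d) = c) := by
  intro u
  induction u with
  | nil =>
    intro D F v e fuel T C _ _ _ _ _ he hD _ _ _ hF hl hT hfu
    obtain ⟨f', rfl⟩ : ∃ f', fuel = f' + 1 := ⟨fuel - 1, by omega⟩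
    simp only [List.foldl_nil, FF] at hT ⊢
    have hT' : TRep T (D t) (F (t+1)) := rep_congr hT (fun r c _ h2 => by simp [h2])
    have hcell : ∀ r d, r ≤ d → (d < D (t+1) r ↔ d < D t r ∨ (r, d) = cellOf (D t) e) := by
      intro r d hrd; rw [hD]; exact cell_bump2 he hrd
    refine ⟨_, _, mix_end hT' (C.1 t) he hl, ?_, cellOf_le, cellOf_out he, hcell⟩
    have := rep_new (v := encOf v (D t) e) hT' (cellOf_le (p := D t) (r := e)) (cellOf_out he) hcell
    refine rep_congr this (fun r c h1 h2 => ?_)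
    by_cases hh : (r, c) = cellOf (D t) e
    · rw [hh, hF]; simp
    · rw [Function.update_of_ne hh]
  | cons x u ih =>
    intro D F v e fuel T C hfr hn htn hv1 hord he hD hfi hvl hv hF hl hT hfu
    have hfi1 := finv_step C hfi hv1 (fun y hy => (List.pairwise_cons.1 hord).1 y hy)
    have hord1 := (List.pairwise_cons.1 hord).2
    have hxu : ∀ y ∈ u, val x ≤ val y := by
      intro y hy
      rcases (List.pairwise_cons.1 hord).1 y hy with k | k <;> omega
    have C1 : Chain (InsG bump D x) := chain_ins C (hfr x (by simp))
    have hn' := List.nodup_cons.1 hn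
    have hfr1 : ∀ y ∈ u, Free (InsG bump D x) y :=
      fun y hy => free_ins (hfr y (by simp [hy])) (by rintro rfl; exact hn'.1 hy)
    have hxt : t + 1 ≠ x := by rintro rfl; exact htn (by simp)
    have htn1 : t + 1 ∉ u := fun h => htn (by simp [h])
    have hv11 : ∀ y ∈ u, 1 ≤ val y := fun y hy => hv1 y (by simp [hy])
    have hvx1 : 1 ≤ val x := hv1 x (by simp)
    have hvl1 : ∀ y ∈ u, v ≤ val y := fun y hy => hvl y (by simp [hy])
    simp only [List.foldl_cons, FF] at hT ⊢
    have hsub : ∀ r c, r ≤ c → c < D t r → c < D (t+1) r := by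
      intro r c hrc h
      rw [hD, cell_bump2 he hrc]; exact Or.inl h
    have hEin : (cellOf (D t) e).2 < D (t+1) (cellOf (D t) e).1 := by
      rw [hD, cell_bump2 he cellOf_le]; right; rfl
    have hold : ∀ r c, c < D (t+1) r → insF val D F x (t+1) (r, c) = F (t+1) (r, c) :=
      fun r c h => insF_old C h
    have hFE : insF val D F x (t+1) (cellOf (D t) e) = encOf v (D t) e := by
      rw [← hF]; exact hold _ _ hEin
    rcases Nat.lt_or_ge t x with hx | hx
    · have e0 : InsG bump D x t = D t := ins_lt hx
      have e1 : InsG bump D x (t+1) = D (t+1) := ins_lt (by omega)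
      have := ih (InsG bump D x) (insF val D F x) v e fuel T C1 hfr1 hn'.2 htn1 hv11 hord1
        (by rw [e0]; exact he) (by rw [e0, e1]; exact hD) hfi1 hvl1 hv (by rw [e0]; exact hFE)
        (by rw [e0]; intro r c h1 h2 h3; rw [hold r c (hsub r c h1 h2)]; exact hl r c h1 h2 h3)
        (by
          refine rep_congr hT (fun r c h1 h2 => ?_)
          simp only [e0]
          split_ifs with h3
          · rw [hold r c (hsub r c h1 h3)]
          · rfl)
        (by rw [List.countP_cons] at hfu; omega)
      rw [e0] at this
      exact this
    · have hr := st_addb C hx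
      have e0 : InsG bump D x t = bump (D t) (st x D t) := ins_ge hx
      set ρ := st x D t with hρ
      have hF1t : insF val D F x t (cellOf (D t) ρ) = encOf (val x) (D t) ρ := by
        simp [insF, hx, ← hρ]
      have hFFE : FF val u (InsG bump D x) (insF val D F x) t (cellOf (D t) ρ) = encOf (val x) (D t) ρ := by
        rw [← hF1t]
        refine FF_old (r := (cellOf (D t) ρ).1) (c := (cellOf (D t) ρ).2) C1 hfr1 hn'.2 ?_
        rw [e0, cell_bump2 hr cellOf_le]; right; rfl
      by_cases hhit : ρ = e ∨ ρ = D t e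
      · have hce : cellOf (D t) ρ = cellOf (D t) e := cellOf_hit he hhit
        have hbe : bump (D t) e = bump (D t) ρ := bump_hit he hhit
        have hst1 : st x D (t+1) = ρ + 1 := by
          rw [st_succ hx, ← hρ, hD, if_pos ((hit_iff hr he).2 hhit)]
        have e1 : InsG bump D x (t+1) = bump (InsG bump D x t) (ρ + 1) := by
          rw [ins_ge (by omega), hst1, hD, e0, hbe]
        have ha1 : Addb (InsG bump D x t) (ρ+1) := by rw [e0]; exact addb_succ (C.1 t) hr
        have eD : D (t+1) = InsG bump D x t := by rw [e0, hD, hbe]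
        have hmemE : (cellOf (D t) e).2 < u.foldl (InsG bump) (InsG bump D x) t (cellOf (D t) e).1 := by
          refine lt_of_lt_of_le ?_ (foldl_mono C1 hfr1 hn'.2)
          rw [← eD]; exact hEin
        have hEout : ¬ (cellOf (D t) e).2 < D t (cellOf (D t) e).1 := by
          rw [cellOf_out he]; omega
        have hl' : LeftOK (D t) e (fun c => if c.2 < D t c.1 then F (t+1) c else
            FF val u (InsG bump D x) (insF val D F x) t c) (encOf v (D t) e) := by
          intro r c h1 h2 h3
          simp only [h2, if_true]
          exact hl r c h1 h2 h3
        have hGE : (fun c : ℕ × ℕ => if c.2 < D t c.1 then F (t+1) c else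
            FF val u (InsG bump D x) (insF val D F x) t c) (cellOf (D t) e) = encOf (val x) (D t) ρ := by
          simp only [hEout, if_false]
          rw [← hce]; exact hFFE
        beta_reduce at hGE
        have hgt : encOf v (D t) e < encOf (val x) (D t) ρ := by
          have q0 := hvl x (by simp)
          have q1 := hfi x (by simp) (cellOf (D t) e).1 (cellOf (D t) e).2 cellOf_le hEin
          rw [hst1] at q1
          have q2 : F (t+1) ((cellOf (D t) e).1, (cellOf (D t) e).2) = encOf v (D t) e := hF
          rw [q2] at q1
          have hpp : D t (D t e) = e := he
          rcases cellOf_cases (D t) e with ⟨a1, a2, a3⟩ | ⟨a1, a2, a3⟩ <;>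
          rcases cellOf_cases (D t) ρ with ⟨b1, b2, b3⟩ | ⟨b1, b2, b3⟩ <;>
          rw [a3, a2] at q1 <;> rw [a3, b3] <;> simp only at q1 <;>
          rcases hhit with hh | hh <;> rw [hh] at b1 q1 <;> omega
        obtain ⟨f', rfl⟩ : ∃ f', fuel = f' + 1 := ⟨fuel - 1, by omega⟩
        rw [mix_hit hT (C.1 t) he hl' hmemE (by rw [hGE]; exact hgt)]
        rw [hGE, ← hce]
        rw [enc_next (fun b i z => mixedIns f' (setBox T (cellOf (D t) ρ).1 ((cellOf (D t) ρ).2 - (cellOf (D t) ρ).1)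
          (encOf v (D t) e)) b i z) (C.1 t) hr hvx1, hce, ← e0]
        have hF1 : insF val D F x (t+1) (cellOf (InsG bump D x t) (ρ+1)) = encOf (val x) (InsG bump D x t) (ρ+1) := by
          simp [insF, hst1, eD, show x ≤ t + 1 by omega]
        refine ih (InsG bump D x) (insF val D F x) (val x) (ρ+1) f' _ C1 hfr1 hn'.2 htn1 hv11 hord1
          ha1 e1 hfi1 hxu hvx1 hF1 ?_ ?_ ?_
        · intro r c h1 h2 h3
          rw [← eD] at h2
          rw [hold r c h2]
          obtain ⟨q1, q2, -⟩ := hfi x (by simp) r c h1 h2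
          rw [hst1] at q2
          rw [eD] at h2
          rcases cellOf_cases (InsG bump D x t) (ρ+1) with ⟨a1, a2, a3⟩ | ⟨a1, a2, a3⟩
          · rw [a3]; exact q1
          · rw [a3]
            rw [if_neg (by omega)] at h3
            by_contra hcon
            have := q2 (by omega)
            have hrr : r = ρ + 1 := by omega
            rw [hrr] at h2
            omega
        · have := rep_set (v := encOf v (D t) e) hT (cellOf_le (p := D t) (r := e)) hmemE
          refine rep_congr this (fun r c h1 h2 => ?_)
          by_cases hh : (r, c) = cellOf (D t) e
          · rw [hh, ← eD, hFE, if_pos hEin]; simp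
          · rw [Function.update_of_ne hh]
            have := cell_bump2 he h1
            rw [← hD] at this
            rw [← eD]
            simp only [this, hh, or_false]
            split_ifs with h4
            · rw [hold r c (hsub r c h1 h4)]
            · rfl
        · rw [List.countP_cons] at hfu
          simp only [decide_eq_true hx, if_true] at hfu
          omega
      · push Not at hhit
        obtain ⟨n1, n2⟩ := hhit
        obtain ⟨q1, q2, q3, q4⟩ := pass_ne hr he n1 n2
        obtain ⟨m1, m2⟩ := not_hit_partner hr he n1 n2
        have hb : bump (D t) ρ e = D t e := bump_ne (Ne.symm n1) (Ne.symm m1)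
        obtain ⟨c1, c2⟩ := cell_of_row hb
        have hst1 : st x D (t+1) = ρ := by
          rw [st_succ hx, ← hρ, hD, if_neg]
          push Not
          exact q3
        have e1 : InsG bump D x (t+1) = bump (InsG bump D x t) e := by
          rw [ins_ge (by omega), hst1, hD, e0, q4]
        obtain ⟨d1, d2⟩ := cell_of_row q3
        have hF1ρ : insF val D F x (t+1) (cellOf (D t) ρ) = encOf (val x) (D t) ρ := by
          simp [insF, hst1, hD, d1, d2, show x ≤ t + 1 by omega]
        have := ih (InsG bump D x) (insF val D F x) v e fuel T C1 hfr1 hn'.2 htn1 hv11 hord1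
          (by rw [e0]; exact q1) e1 hfi1 hvl1 hv (by rw [e0, c1, c2]; exact hFE)
          (by
            rw [e0, c2]
            intro r c h1 h2 h3
            rw [hb] at h3
            rcases (cell_bump2 hr h1).1 h2 with h4 | h4
            · rw [hold r c (hsub r c h1 h4)]; exact hl r c h1 h4 h3
            · exfalso
              rcases cellOf_cases (D t) ρ with ⟨a1, a2, a3⟩ | ⟨a1, a2, a3⟩ <;>
              rw [a2, Prod.mk.injEq] at h4 <;> split_ifs at h3 <;> omega)
          (by
            refine rep_congr hT (fun r c h1 h2 => ?_)
            simp only [e0, cell_bump2 hr h1]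
            by_cases h3 : c < D t r
            · simp only [h3, true_or, if_true]
              rw [hold r c (hsub r c h1 h3)]
            · simp only [h3, false_or, if_false]
              split_ifs with h4
              · rw [h4, hF1ρ, hFFE]
              · rfl)
          (by rw [List.countP_cons] at hfu; omega)
        rw [e0, c2, hb] at this
        exact this


theorem FF_append (val : ℕ → ℕ) (q : List ℕ) : ∀ (p : List ℕ) D F,
    FF val (p ++ q) D F = FF val q (p.foldl (InsG bump) D) (FF val p D F) := by
  intro p
  induction p with
  | nil => intro D F; rfl
  | cons x p ih => intro D F; simp only [List.cons_append, FF, List.foldl_cons]; exact ih _ _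

theorem FF_const {val : ℕ → ℕ} {t : ℕ} : ∀ {p : List ℕ} {D F}, t + 1 ∉ p → D (t+1) = D t → F (t+1) = F t →
    FF val p D F (t+1) = FF val p D F t := by
  intro p
  induction p with
  | nil => intro D F _ _ h; exact h
  | cons x p ih =>
    intro D F hx hD hF
    simp only [List.mem_cons, not_or] at hx
    rw [FF]
    refine ih hx.2 (ins_same hD hx.1) ?_
    funext c
    unfold insF
    have : x ≤ t + 1 ↔ x ≤ t := by omega
    simp only [hD, st_same hD, hF, this]

theorem finv_foldl {val s q} : ∀ {p : List ℕ} {D F}, Chain D → (∀ x ∈ p, Free D x) → p.Nodup →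
    (∀ x ∈ p ++ q, 1 ≤ val x) → (p ++ q).Pairwise (LOrd val) → FInv val D F s (p ++ q) →
    FInv val (p.foldl (InsG bump) D) (FF val p D F) s q := by
  intro p
  induction p with
  | nil => intro D F _ _ _ _ _ h; exact h
  | cons x p ih =>
    intro D F C hf hn hv ho h
    have hn' := List.nodup_cons.1 hn
    rw [List.cons_append] at hv ho h
    exact ih (chain_ins C (hf x (by simp)))
      (fun y hy => free_ins (hf y (by simp [hy])) (by rintro rfl; exact hn'.1 hy)) hn'.2
      (fun y hy => hv y (by simp only [List.mem_cons]; exact Or.inr hy)) (List.pairwise_cons.1 ho).2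
      (finv_step C h hv (List.pairwise_cons.1 ho).1)

theorem mixed_step {val : ℕ → ℕ} {t : ℕ} {u : List ℕ} {T fuel} (hn : u.Nodup) (ho : u.Pairwise (LOrd val))
    (hv : ∀ x ∈ u, 1 ≤ val x) (ht : t + 1 ∈ u)
    (hT : TRep T (PhiG bump u t) (FF val u Z0 (fun _ _ => 0) t)) (hfu : u.countP (· ≤ t) + 1 ≤ fuel) :
    ∃ T' c, mixedIns fuel T true 0 (2 * val (t+1)) = (T', c) ∧
      TRep T' (PhiG bump u (t+1)) (FF val u Z0 (fun _ _ => 0) (t+1)) ∧ c.1 ≤ c.2 ∧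
      c.2 = PhiG bump u t c.1 ∧
      ∀ r d, r ≤ d → (d < PhiG bump u (t+1) r ↔ d < PhiG bump u t r ∨ (r, d) = c) := by
  obtain ⟨p, q, rfl⟩ := List.append_of_mem ht
  have hn1 := List.nodup_append.1 hn
  have hnq := List.nodup_cons.1 hn1.2.1
  have htp : t + 1 ∉ p := fun h => hn1.2.2 _ h (t+1) (by simp) rfl
  obtain ⟨C0, hf0⟩ := phi_chain (u := p) hn1.1
  have hfi := finv_foldl (F := fun _ _ => 0) (s := t+1) chain_zero (fun x _ => free_zero x) hn1.1 hv ho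
    (by intro x _ r c _ h; simp [Z0] at h)
  have hF0 : FF val p Z0 (fun _ _ => 0) (t+1) = FF val p Z0 (fun _ _ => 0) t := FF_const htp rfl rfl
  rw [FF_append, FF] at hT ⊢
  unfold PhiG at hT ⊢
  rw [List.foldl_append, List.foldl_cons] at hT ⊢
  change Chain (p.foldl (InsG bump) Z0) at C0
  change ∀ y, y ∉ p → Free (p.foldl (InsG bump) Z0) y at hf0
  generalize p.foldl (InsG bump) Z0 = D at *
  generalize FF val p Z0 (fun _ _ => 0) = F at *
  have hD0 : D (t+1) = D t := hf0 _ htp t rfl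
  have e0 : InsG bump D (t+1) t = D t := ins_lt (by omega)
  obtain ⟨ha, hb⟩ := birth_step (x := t+1) C0 (hf0 _ htp) rfl
  have C1 := chain_ins C0 (hf0 _ htp)
  have hvt := hv (t+1) (by simp)
  have hoq := (List.pairwise_append.1 ho).2.1
  have hfr1 : ∀ x ∈ q, Free (InsG bump D (t+1)) x := by
    intro x hx
    refine free_ins (hf0 _ (fun h => hn1.2.2 _ h x (by simp [hx]) rfl)) ?_
    rintro rfl; exact hnq.1 hx
  have henc : encOf (val (t+1)) (InsG bump D (t+1) t) 0 = 2 * val (t+1) := by simp [encOf]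
  have := mixed_run val t q (InsG bump D (t+1)) (insF val D F (t+1)) (val (t+1)) 0 fuel T C1 hfr1 hnq.2 hnq.1
    (fun x hx => hv x (by simp [hx])) (List.pairwise_cons.1 hoq).2 ha hb
    (finv_step C0 hfi (fun x hx => hv x (List.mem_append_right _ hx)) (List.pairwise_cons.1 hoq).1)
    (fun x hx => by rcases (List.pairwise_cons.1 hoq).1 x hx with k | k <;> omega) hvt
    (by rw [e0]; simp [insF, st_le, hD0])
    (by
      rw [e0]
      intro r c h1 h2 h3
      rw [← hD0] at h2
      rw [insF_old C0 h2]
      rw [e0] at henc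
      rw [henc]
      exact (hfi (t+1) (by simp) r c h1 h2).1)
    (by
      refine rep_congr hT (fun r c h1 h2 => ?_)
      simp only
      split_ifs with h3
      · rw [FF_old C1 hfr1 hnq.2 h3]
        rw [e0] at h3
        rw [insF_old C0 h3, insF_old C0 (by rw [hD0]; exact h3), hF0]
      · rfl)
    (by
      have : List.countP (· ≤ t) q ≤ List.countP (· ≤ t) (p ++ (t+1) :: q) := by
        rw [List.countP_append, List.countP_cons]; omega
      omega)
  rw [henc] at this
  simpa using this

theorem tsize_eq (T : List (List ℕ)) : ∀ N, T.length ≤ N → tsize T = ∑ r ∈ Finset.range N, (T.getD r []).length := by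
  induction T with
  | nil => intro N _; simp [tsize]
  | cons a T ih =>
    intro N hN
    obtain ⟨M, rfl⟩ : ∃ M, N = M + 1 := ⟨N - 1, by simp at hN; omega⟩
    rw [Finset.sum_range_succ']
    simp only [List.getD_cons_succ, List.getD_cons_zero]
    rw [← ih M (by simpa using hN)]
    simp [tsize]; try omega

theorem tsize_new {T T' : List (List ℕ)} {r : ℕ}
    (h : ∀ k, (T'.getD k []).length = (T.getD k []).length + if k = r then 1 else 0) : tsize T' = tsize T + 1 := by
  rw [tsize_eq T (T.length + T'.length + r + 1) (by omega), tsize_eq T' (T.length + T'.length + r + 1) (by omega)]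
  simp only [h, Finset.sum_add_distrib]
  congr 1
  rw [Finset.sum_ite_eq', if_pos (by rw [Finset.mem_range]; omega)]

/-- The first time a cell is present. -/
noncomputable def birth (X : ℕ → ℕ → ℕ) (c : ℕ × ℕ) : ℕ := sInf {s | c.2 < X s c.1}

theorem chain_mono {X} (C : Chain X) {r s t : ℕ} (h : s ≤ t) : X s r ≤ X t r := by
  induction t with
  | zero => rw [Nat.le_zero.1 h]
  | succ t ih =>
    rcases Nat.lt_or_ge t s with h1 | h1
    · rw [show s = t + 1 by omega]
    · refine (ih h1).trans ?_
      rcases C.2 t with k | ⟨e, he, k⟩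
      · rw [k]
      · rw [k]; exact bump_mono he

theorem birth_eq {X : ℕ → ℕ → ℕ} {r c t} (C : Chain X) (h1 : ¬ c < X t r) (h2 : c < X (t+1) r) :
    birth X (r, c) = t + 1 := by
  unfold birth
  apply le_antisymm
  · exact Nat.sInf_le h2
  · refine le_csInf (s := {s | c < X s r}) ⟨t+1, h2⟩ ?_
    intro s hs
    by_contra hc
    have := chain_mono C (r := r) (show s ≤ t by omega)
    simp only [Set.mem_setOf_eq] at hs
    omega

theorem birth_spec {X : ℕ → ℕ → ℕ} {r c t} (C : Chain X) (h2 : c < X t r) (s : ℕ) :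
    c < X s r ↔ birth X (r, c) ≤ s := by
  constructor
  · intro h; exact Nat.sInf_le h
  · intro h
    have : c < X (birth X (r, c)) r := Nat.sInf_mem (s := {s | c < X s r}) ⟨t, h2⟩
    exact lt_of_lt_of_le this (chain_mono C h)

theorem chain_const {X : ℕ → ℕ → ℕ} {n : ℕ} (h : ∀ t, n ≤ t → X (t+1) = X t) (t) (ht : n ≤ t) : X t = X n := by
  induction t with
  | zero => rw [Nat.le_zero.1 ht]
  | succ t ih =>
    rcases Nat.lt_or_ge t n with h1 | h1
    · rw [show n = t + 1 by omega]
    · rw [h t h1, ih h1]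

theorem rp_of {X : ℕ → ℕ → ℕ} {n : ℕ} {f : ℕ × ℕ → ℕ} (C : Chain X) (h : ∀ t, n ≤ t → X (t+1) = X t)
    (h1 : ∀ r c, c < r → f (r, c) = 0) (h2 : ∀ r c, r ≤ c → c < X 0 r → f (r, c) = 0)
    (h3 : ∀ r c, r ≤ c → ¬ c < X n r → f (r, c) = 0)
    (h4 : ∀ r c, r ≤ c → ¬ c < X 0 r → c < X n r → f (r, c) = birth X (r, c)) : Rp n f X := by
  refine ⟨C, h, h1, fun r c hrc => ?_⟩
  have h2' := h2 r c hrc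
  have h3' := h3 r c hrc
  have h4' := h4 r c hrc
  by_cases k : c < X 0 r
  · have k2 := h2' k
    refine ⟨fun _ => by omega, fun _ => by omega, fun t ht => ?_⟩
    have := chain_mono C (r := r) ht
    constructor
    · intro _; exact Or.inl k
    · intro _; omega
  · by_cases k2 : c < X n r
    · have k3 := h4' k k2
      have k4 := birth_spec C k2
      have k5 := k4 0
      refine ⟨fun _ => by omega, fun _ => by omega, fun t ht => ?_⟩
      rw [k4 t, k3]
      omega
    · have k3 := h3' k2
      refine ⟨fun _ => by omega, fun _ => by omega, fun t ht => ?_⟩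
      rw [k3]
      constructor
      · intro hc
        exfalso
        rcases Nat.le_total t n with h5 | h5
        · have := chain_mono C (r := r) h5; omega
        · rw [chain_const h t h5] at hc; exact k2 hc
      · omega

/-- The letters of a word are the times, sorted by value and then by time. -/
structure TSorted (n : ℕ) (val : ℕ → ℕ) (u : List ℕ) : Prop where
  nodup : u.Nodup
  mem : ∀ s, s ∈ u ↔ 1 ≤ s ∧ s ≤ n
  ord : u.Pairwise (LOrd val)
  pos : ∀ x ∈ u, 1 ≤ val x

theorem countP_le_of {u : List ℕ} {t : ℕ} (hn : u.Nodup) (h : ∀ s ∈ u, 1 ≤ s) : u.countP (· ≤ t) ≤ t := by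
  rw [List.countP_eq_length_filter]
  have h1 : (u.filter (· ≤ t)).Nodup := hn.filter _
  rw [← List.toFinset_card_of_nodup h1]
  have : (u.filter (· ≤ t)).toFinset ⊆ Finset.Icc 1 t := by
    intro x hx
    simp at hx
    have := h x hx.1
    simp; omega
  have := Finset.card_le_card this
  simpa using this

theorem take_succ_get {w : List ℕ} {t : ℕ} (h : t < w.length) : w.take (t+1) = w.take t ++ [w.getD t 0] := by
  rw [List.take_succ_eq_append_getElem h, List.getD_eq_getElem _ _ h]

theorem mixed_inv {w u : List ℕ} (hu : TSorted w.length (fun s => w.getD (s-1) 0) u) : ∀ t, t ≤ w.length →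
    TRep (mixedPQ (w.take t)).1 (PhiG bump u t) (FF (fun s => w.getD (s-1) 0) u Z0 (fun _ _ => 0) t) ∧
    TRep (mixedPQ (w.take t)).2 (PhiG bump u t) (birth (PhiG bump u)) ∧
    tsize (mixedPQ (w.take t)).1 = t ∧ tsize (mixedPQ (w.take t)).2 = t := by
  intro t
  have C := (phi_chain hu.nodup).1
  induction t with
  | zero =>
    intro _
    have h0 : PhiG bump u 0 = Z0 0 := foldl_early (fun x hx => by have := (hu.mem x).1 hx; omega)
    simp only [List.take_zero, mixedPQ, List.foldl_nil, h0]
    refine ⟨?_, ?_, rfl, rfl⟩ <;> intro r <;> simp [Z0]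
  | succ t ih =>
    intro ht
    obtain ⟨i1, i2, i3, i4⟩ := ih (by omega)
    have hmem : t + 1 ∈ u := (hu.mem _).2 ⟨by omega, ht⟩
    have hcp := countP_le_of (t := t) hu.nodup (fun s hs => ((hu.mem s).1 hs).1)
    obtain ⟨T', c, k1, k2, k3, k4, k5⟩ := mixed_step (fuel := tsize (mixedPQ (w.take t)).1 + 2) hu.nodup hu.ord hu.pos hmem i1
      (by omega)
    have hstep : mixedPQ (w.take (t+1)) = (T', setBox (mixedPQ (w.take t)).2 c.1 (c.2 - c.1) (t + 1)) := by
      rw [take_succ_get (by omega)]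
      conv_lhs => unfold mixedPQ
      rw [List.foldl_append]
      change (fun (PQ : List (List ℕ) × List (List ℕ)) (x : ℕ) =>
        let s := mixedInsLetter PQ.1 x
        (s.1, setBox PQ.2 s.2.1 (s.2.2 - s.2.1) (tsize PQ.2 + 1))) (mixedPQ (w.take t)) (w.getD t 0) = _
      simp only [mixedInsLetter, i4]
      simp only [Nat.add_sub_cancel] at k1
      rw [k1]
    rw [hstep]
    simp only
    have hQ := rep_new (v := t + 1) i2 k3 k4 k5
    have hQ2 : TRep (setBox (mixedPQ (w.take t)).2 c.1 (c.2 - c.1) (t + 1)) (PhiG bump u (t+1)) (birth (PhiG bump u)) := by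
      refine rep_congr hQ (fun r d h1 h2 => ?_)
      by_cases hh : (r, d) = c
      · subst hh
        simp only [Function.update_self]
        rw [birth_eq C _ h2]
        simp only at k4; omega
      · exact Function.update_of_ne hh _ _
    have hlen : ∀ r, PhiG bump u (t+1) r - r = PhiG bump u t r - r + if r = c.1 then 1 else 0 := by
      intro r
      have a : ∀ d, r + d < PhiG bump u (t+1) r ↔ r + d < PhiG bump u t r ∨ (r = c.1 ∧ r + d = c.2) := by
        intro d
        have := k5 r (r + d) (by omega)
        rw [this, Prod.ext_iff]
      split_ifs with hr
      · have a0 := a (c.2 - r)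
        have a1 := a (c.2 - r + 1)
        have a2 := a 0
        subst hr
        omega
      · have a0 := a 0
        have a1 := a (PhiG bump u t r - r)
        have a2 := a (PhiG bump u (t+1) r - r)
        omega
    refine ⟨k2, hQ2, ?_, ?_⟩
    · rw [tsize_new (r := c.1) (T := (mixedPQ (w.take t)).1), i3]
      intro k; rw [(k2 k).1, (i1 k).1, hlen]
    · rw [tsize_new (r := c.1) (T := (mixedPQ (w.take t)).2), i4]
      intro k; rw [(hQ2 k).1, (i2 k).1, hlen]

theorem phi_const {w u : List ℕ} {val} (hu : TSorted w.length val u) (t) (ht : w.length ≤ t) :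
    PhiG bump u (t+1) = PhiG bump u t :=
  (phi_chain hu.nodup).2 (t+1) (fun h => by have := (hu.mem _).1 h; omega) t rfl

theorem mixed_rp {w u : List ℕ} (hu : TSorted w.length (fun s => w.getD (s-1) 0) u) :
    Rp w.length (toFunShifted (mixedQ w)) (PhiG bump u) := by
  obtain ⟨-, h, -, -⟩ := mixed_inv hu w.length le_rfl
  rw [List.take_length] at h
  have h0 : PhiG bump u 0 = Z0 0 := foldl_early (fun x hx => by have := (hu.mem x).1 hx; omega)
  refine rp_of (phi_chain hu.nodup).1 (phi_const hu) ?_ ?_ ?_ ?_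
  · intro r c hc; simp [toFunShifted, Nat.not_le.2 hc]
  · intro r c hrc hc; rw [h0] at hc; simp [Z0] at hc
  · intro r c hrc hc
    simp only [toFunShifted, hrc, if_true]
    apply List.getD_eq_default
    have := (h r).1
    unfold mixedQ
    omega
  · intro r c hrc _ hc
    simp only [toFunShifted, hrc, if_true]
    have := (h r).2 (c - r) (by omega)
    rw [show r + (c - r) = c by omega] at this
    exact this


/-- The `k × k` square. -/
def sqr (k : ℕ) : ℕ → ℕ := fun r => if r < k then k else 0

theorem sqr_sc (k : ℕ) : SC (sqr k) := by
  intro i j; unfold sqr; split_ifs <;> omega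

theorem chain_base {s : ℕ → ℕ} (h : SC s) : Chain (fun _ => s) := ⟨fun _ => h, fun _ => Or.inl rfl⟩

theorem free_base (s : ℕ → ℕ) (x) : Free (fun _ => s) x := fun _ _ => rfl

theorem base_step {val : ℕ → ℕ} {s : ℕ → ℕ} {t : ℕ} {u : List ℕ} {T fuel} (hs : SC s)
    (hn : u.Nodup) (ho : u.Pairwise (LOrd val))
    (hv : ∀ x ∈ u, 1 ≤ val x) (ht : t + 1 ∈ u)
    (hT : TRep T (u.foldl (InsG bump) (fun _ => s) t) (FF val u (fun _ => s) (fun _ _ => 0) t))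
    (hfu : u.countP (· ≤ t) + 1 ≤ fuel) :
    ∃ T' c, mixedIns fuel T true 0 (2 * val (t+1)) = (T', c) ∧
      TRep T' (u.foldl (InsG bump) (fun _ => s) (t+1)) (FF val u (fun _ => s) (fun _ _ => 0) (t+1)) ∧ c.1 ≤ c.2 ∧
      c.2 = u.foldl (InsG bump) (fun _ => s) t c.1 ∧
      ∀ r d, r ≤ d → (d < u.foldl (InsG bump) (fun _ => s) (t+1) r ↔
        d < u.foldl (InsG bump) (fun _ => s) t r ∨ (r, d) = c) := by
  obtain ⟨p, q, rfl⟩ := List.append_of_mem ht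
  have hn1 := List.nodup_append.1 hn
  have hnq := List.nodup_cons.1 hn1.2.1
  have htp : t + 1 ∉ p := fun h => hn1.2.2 _ h (t+1) (by simp) rfl
  obtain ⟨C0, hf0'⟩ := foldl_chain (u := p) (chain_base hs) (fun x _ => free_base s x) hn1.1
  have hf0 := fun y hy => hf0' y hy (free_base s y)
  have hfi := finv_foldl (F := fun _ _ => 0) (s := t+1) (chain_base hs) (fun x _ => free_base s x) hn1.1 hv ho
    (by
      intro x hx r c _ h
      have := hv x hx
      refine ⟨by simp, fun h => ?_, fun h => ?_⟩ <;> simp only at h <;> omega)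
  have hF0 : FF val p (fun _ => s) (fun _ _ => 0) (t+1) = FF val p (fun _ => s) (fun _ _ => 0) t := FF_const htp rfl rfl
  rw [FF_append, FF] at hT ⊢
  rw [List.foldl_append, List.foldl_cons] at hT ⊢
  generalize p.foldl (InsG bump) (fun _ => s) = D at *
  generalize FF val p (fun _ => s) (fun _ _ => 0) = F at *
  have hD0 : D (t+1) = D t := hf0 _ htp t rfl
  have e0 : InsG bump D (t+1) t = D t := ins_lt (by omega)
  obtain ⟨ha, hb⟩ := birth_step (x := t+1) C0 (hf0 _ htp) rfl
  have C1 := chain_ins C0 (hf0 _ htp)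
  have hvt := hv (t+1) (by simp)
  have hoq := (List.pairwise_append.1 ho).2.1
  have hfr1 : ∀ x ∈ q, Free (InsG bump D (t+1)) x := by
    intro x hx
    refine free_ins (hf0 _ (fun h => hn1.2.2 _ h x (by simp [hx]) rfl)) ?_
    rintro rfl; exact hnq.1 hx
  have henc : encOf (val (t+1)) (InsG bump D (t+1) t) 0 = 2 * val (t+1) := by simp [encOf]
  have := mixed_run val t q (InsG bump D (t+1)) (insF val D F (t+1)) (val (t+1)) 0 fuel T C1 hfr1 hnq.2 hnq.1
    (fun x hx => hv x (by simp [hx])) (List.pairwise_cons.1 hoq).2 ha hb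
    (finv_step C0 hfi (fun x hx => hv x (List.mem_append_right _ hx)) (List.pairwise_cons.1 hoq).1)
    (fun x hx => by rcases (List.pairwise_cons.1 hoq).1 x hx with k | k <;> omega) hvt
    (by rw [e0]; simp [insF, st_le, hD0])
    (by
      rw [e0]
      intro r c h1 h2 h3
      rw [← hD0] at h2
      rw [insF_old C0 h2]
      rw [e0] at henc
      rw [henc]
      exact (hfi (t+1) (by simp) r c h1 h2).1)
    (by
      refine rep_congr hT (fun r c h1 h2 => ?_)
      simp only
      split_ifs with h3
      · rw [FF_old C1 hfr1 hnq.2 h3]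
        rw [e0] at h3
        rw [insF_old C0 h3, insF_old C0 (by rw [hD0]; exact h3), hF0]
      · rfl)
    (by
      have : List.countP (· ≤ t) q ≤ List.countP (· ≤ t) (p ++ (t+1) :: q) := by
        rw [List.countP_append, List.countP_cons]; omega
      omega)
  rw [henc] at this
  simpa using this

/-- `T` is the tableau `P` (doubled entries), padded with zeros on the left. -/
def PadRel (k : ℕ) (T P : List (List ℕ)) : Prop :=
  ∀ r, T.getD r [] = if r ≤ k then List.replicate (k - r) 0 ++ (P.getD r []).map (2 * ·) else []

theorem findIdx_pad {m x : ℕ} {row : List ℕ} :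
    (List.replicate m 0 ++ row.map (2 * ·)).findIdx? (fun z => decide (2 * x < z)) =
      (row.findIdx? (fun z => decide (x < z))).map (· + m) := by
  rw [List.findIdx?_append, List.findIdx?_map]
  have h1 : (List.replicate m 0).findIdx? (fun z => decide (2 * x < z)) = none := by
    rw [List.findIdx?_eq_none_iff]
    intro z hz
    rw [List.eq_of_mem_replicate hz]; simp
  rw [h1]
  have h2 : (fun z => decide (2 * x < z)) ∘ (fun z => 2 * z) = fun z => decide (x < z) := by
    funext z; simp
  rw [h2]
  simp

theorem getD_append_row {pre rest : List (List ℕ)} {a : List ℕ} {i : ℕ} :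
    (pre ++ a :: rest).getD i [] = if i = pre.length then a else (pre ++ [] :: rest).getD i [] := by
  split_ifs with h
  · subst h; simp [List.getD_eq_getElem?_getD]
  · simp only [List.getD_eq_getElem?_getD, List.getElem?_append]
    split_ifs with h2
    · rfl
    · obtain ⟨m, hm⟩ : ∃ m, i - pre.length = m + 1 := ⟨i - pre.length - 1, by omega⟩
      rw [hm]; simp

theorem getD_append_nil {pre : List (List ℕ)} {i : ℕ} : (pre ++ [[]]).getD i [] = pre.getD i [] := by
  simp only [List.getD_eq_getElem?_getD, List.getElem?_append]
  split_ifs with h2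
  · rfl
  · rw [List.getElem?_eq_none (l := pre) (by omega)]
    rcases hm : i - pre.length with _ | m <;> simp

theorem rskInsert_len (x : ℕ) (P : List (List ℕ)) : 1 ≤ (rskInsert x P).length := by
  cases P with
  | nil => simp [rskInsert]
  | cons row rest => rw [rskInsert]; split <;> simp

theorem rsk_mixed (k : ℕ) : ∀ (rest : List (List ℕ)) (x r : ℕ) (T pre : List (List ℕ)) (fuel : ℕ), r = pre.length →
    r + (rskInsert x rest).length ≤ k + 1 → rest.length + 1 ≤ fuel → PadRel k T (pre ++ rest) →
    PadRel k (mixedIns fuel T true r (2 * x)).1 (pre ++ rskInsert x rest) := by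
  intro rest
  induction rest with
  | nil =>
    intro x r T pre fuel hr hk hf hT
    obtain ⟨f', rfl⟩ : ∃ f', fuel = f' + 1 := ⟨fuel - 1, by omega⟩
    have hl := rskInsert_len x []
    have hrow := hT r
    have hnil : (pre ++ []).getD r [] = [] := by
      rw [List.append_nil, List.getD_eq_default _ _ (by omega)]
    rw [if_pos (by omega), hnil] at hrow
    have hfi := findIdx_pad (m := k - r) (x := x) (row := [])
    rw [mixedIns]
    simp only
    rw [hrow, hfi]
    simp only [List.findIdx?_nil, Option.map_none]
    intro i
    rw [setBox_getD, hrow, rskInsert, padSet_eq]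
    split_ifs with h1 h2 h2
    · subst h1
      rw [getD_append_row, if_pos hr]; simp
    · omega
    · have := hT i
      rw [if_pos h2] at this
      rw [this, getD_append_row, if_neg (by omega), getD_append_nil, List.append_nil]
    · have := hT i
      rw [if_neg h2] at this
      exact this
  | cons row rest ih =>
    intro x r T pre fuel hr hk hf hT
    obtain ⟨f', rfl⟩ : ∃ f', fuel = f' + 1 := ⟨fuel - 1, by omega⟩
    have hl := rskInsert_len x (row :: rest)
    have hrk : r ≤ k := by omega
    have hrow := hT r
    rw [if_pos hrk, getD_append_row, if_pos hr] at hrow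
    have hfi := findIdx_pad (m := k - r) (x := x) (row := row)
    rw [mixedIns]
    simp only
    rw [hrow, hfi]
    have hother : ∀ i a, i ≠ r → T.getD i [] = if i ≤ k then List.replicate (k - i) 0 ++ ((pre ++ a :: rest).getD i []).map (2 * ·) else [] := by
      intro i a hi
      have hi2 : ¬ i = pre.length := by omega
      rw [hT i, getD_append_row, getD_append_row (a := a)]
      simp only [hi2, if_false]
    rcases hj : row.findIdx? (fun z => decide (x < z)) with _ | j
    · simp only [Option.map_none]
      intro i
      have hins : rskInsert x (row :: rest) = (row ++ [x]) :: rest := by rw [rskInsert, hj]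
      rw [hins, setBox_getD, hrow, padSet_eq]
      by_cases hi : i = r
      · subst hi
        rw [if_pos rfl, if_pos hrk, getD_append_row, if_pos hr]; simp
      · rw [if_neg hi]; exact hother i _ hi
    · have hins : rskInsert x (row :: rest) = row.set j x :: rskInsert (row.getD j 0) rest := by rw [rskInsert, hj]
      simp only [Option.map_some]
      rw [hins] at hk ⊢
      have hl2 := rskInsert_len (row.getD j 0) rest
      simp only [List.length_cons] at hk
      obtain ⟨hj1, -, -⟩ := List.findIdx?_eq_some_iff_getElem.1 hj
      have hz : (List.replicate (k - r) 0 ++ row.map (2 * ·)).getD (j + (k - r)) 0 = 2 * row.getD j 0 := by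
        simp only [List.getD_eq_getElem?_getD]
        rw [List.getElem?_append_right (by simp)]
        simp [hj1]
      rw [hz]
      have hne : ¬ (j + (k - r) = 0 ∧ 2 * row.getD j 0 % 2 = 0) := by omega
      rw [if_neg hne, if_pos (by omega)]
      have hlt : r < T.length := by
        by_contra hc
        rw [List.getD_eq_default _ _ (by omega)] at hrow
        have := congrArg List.length hrow
        simp at this; omega
      have hT' : PadRel k (T.set r ((List.replicate (k - r) 0 ++ row.map (2 * ·)).set (j + (k - r)) (2 * x)))
          ((pre ++ [row.set j x]) ++ rest) := by
        intro i
        rw [List.append_assoc, List.singleton_append]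
        by_cases hi : i = r
        · subst hi
          rw [if_pos hrk, getD_append_row, if_pos hr]
          simp only [List.getD_eq_getElem?_getD, List.getElem?_set, if_true, hlt, Option.getD_some]
          rw [List.set_append_right _ _ (by simp)]
          simp [List.map_set]
        · rw [← hother i _ hi]
          simp only [List.getD_eq_getElem?_getD, List.getElem?_set, if_neg (Ne.symm hi)]
      have := ih (row.getD j 0) (r+1) _ (pre ++ [row.set j x]) f' (by simp [hr]) (by omega)
        (by simp at hf; omega) hT'
      rw [List.append_assoc, List.singleton_append] at this
      exact this

theorem rskInsert_shape : ∀ (P : List (List ℕ)) (x : ℕ), ∃ r, (rskInsert x P).length = max P.length (r+1) ∧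
    ∀ i, ((rskInsert x P).getD i []).length = (P.getD i []).length + if i = r then 1 else 0 := by
  intro P
  induction P with
  | nil =>
    intro x
    refine ⟨0, by simp [rskInsert], fun i => ?_⟩
    rcases i with _ | i <;> simp [rskInsert]
  | cons row rest ih =>
    intro x
    rcases hj : row.findIdx? (fun z => decide (x < z)) with _ | j
    · have hins : rskInsert x (row :: rest) = (row ++ [x]) :: rest := by rw [rskInsert, hj]
      refine ⟨0, by simp [hins], fun i => ?_⟩
      rcases i with _ | i <;> simp [hins]
    · have hins : rskInsert x (row :: rest) = row.set j x :: rskInsert (row.getD j 0) rest := by rw [rskInsert, hj]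
      obtain ⟨r, h1, h2⟩ := ih (row.getD j 0)
      refine ⟨r+1, ?_, fun i => ?_⟩
      · rw [hins, List.length_cons, List.length_cons, h1]; omega
      · rw [hins]
        rcases i with _ | i
        · simp
        · rw [List.getD_cons_succ, List.getD_cons_succ, h2]; simp

theorem newCell_eq {T T' : List (List ℕ)} {r : ℕ} (h0 : r < T'.length)
    (h : ∀ i, (T'.getD i []).length = (T.getD i []).length + if i = r then 1 else 0) :
    newCell T T' = (r, (T.getD r []).length) := by
  unfold newCell
  have : (List.range T'.length).findIdx
    (fun r => decide ((T.getD r []).length ≠ (T'.getD r []).length)) = r := by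
    apply findIdx_range h0
    · rw [decide_eq_true_iff, h, if_pos rfl]; omega
    · intro j hj
      rw [decide_eq_false_iff_not, h, if_neg (by omega)]; simp
  simp only [this]

theorem setBox_length (T : List (List ℕ)) (r j v : ℕ) : (setBox T r j v).length = max T.length (r+1) := by
  unfold setBox
  split_ifs with h <;> simp <;> omega

theorem pad_exists (k : ℕ) (P : List (List ℕ)) : ∃ T, PadRel k T P := by
  refine ⟨(List.range (k+1)).map fun r => List.replicate (k - r) 0 ++ (P.getD r []).map (2 * ·), fun r => ?_⟩
  simp only [List.getD_eq_getElem?_getD, List.getElem?_map, List.getElem?_range]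
  split_ifs with h
  · rw [List.getElem?_range (by omega)]; simp
  · rw [List.getElem?_eq_none (by simp; omega)]; simp

theorem rep_pad {k T T' P p G} (h : PadRel k T P) (h' : PadRel k T' P) (hT : TRep T p G) : TRep T' p G := by
  intro r
  have : T'.getD r [] = T.getD r [] := by rw [h r, h' r]
  rw [this]; exact hT r

theorem rskPQ_succ {w : List ℕ} {t : ℕ} (ht : t < w.length) {r : ℕ}
    (h1 : (rskInsert (w.getD t 0) (rskPQ (w.take t)).1).length = max (rskPQ (w.take t)).1.length (r+1))
    (h2 : ∀ i, ((rskInsert (w.getD t 0) (rskPQ (w.take t)).1).getD i []).length =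
      ((rskPQ (w.take t)).1.getD i []).length + if i = r then 1 else 0) :
    rskPQ (w.take (t+1)) = (rskInsert (w.getD t 0) (rskPQ (w.take t)).1,
      setBox (rskPQ (w.take t)).2 r ((rskPQ (w.take t)).1.getD r []).length (tsize (rskPQ (w.take t)).2 + 1)) := by
  rw [take_succ_get ht]
  conv_lhs => unfold rskPQ
  rw [List.foldl_append]
  change (fun (PQ : List (List ℕ) × List (List ℕ)) (x : ℕ) =>
      let P' := rskInsert x PQ.1
      let c := newCell PQ.1 P'
      (P', setBox PQ.2 c.1 c.2 (tsize PQ.2 + 1))) (rskPQ (w.take t)) (w.getD t 0) = _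
  simp only
  rw [newCell_eq (r := r) (by omega) h2]

theorem rsk_len_mono {w : List ℕ} : ∀ s t, t + s ≤ w.length →
    (rskPQ (w.take t)).2.length ≤ (rskPQ (w.take (t + s))).2.length := by
  intro s
  induction s with
  | zero => intro t _; exact le_rfl
  | succ s ih =>
    intro t ht
    refine (ih t (by omega)).trans ?_
    obtain ⟨r, h1, h2⟩ := rskInsert_shape (rskPQ (w.take (t+s))).1 (w.getD (t+s) 0)
    rw [← Nat.add_assoc, rskPQ_succ (by omega) h1 h2]
    simp only [setBox_length]
    omega

theorem rsk_inv {k : ℕ} {w u : List ℕ} (hu : TSorted w.length (fun s => w.getD (s-1) 0) u)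
    (hk : (rskQ w).length ≤ k + 1) : ∀ t, t ≤ w.length →
    (∃ T, PadRel k T (rskPQ (w.take t)).1 ∧ TRep T (u.foldl (InsG bump) (fun _ => sqr k) t)
      (FF (fun s => w.getD (s-1) 0) u (fun _ => sqr k) (fun _ _ => 0) t)) ∧
    (rskPQ (w.take t)).2.length = (rskPQ (w.take t)).1.length ∧
    tsize (rskPQ (w.take t)).2 = t ∧
    (∀ r, ((rskPQ (w.take t)).2.getD r []).length = ((rskPQ (w.take t)).1.getD r []).length) ∧
    (∀ r j, j < ((rskPQ (w.take t)).1.getD r []).length →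
      ((rskPQ (w.take t)).2.getD r []).getD j 0 = birth (u.foldl (InsG bump) (fun _ => sqr k)) (r, k + j)) := by
  have C := (foldl_chain (chain_base (sqr_sc k)) (fun x _ => free_base _ x) hu.nodup).1
  intro t
  induction t with
  | zero =>
    intro _
    have h0 : u.foldl (InsG bump) (fun _ => sqr k) 0 = sqr k :=
      foldl_early (fun x hx => by have := (hu.mem x).1 hx; omega)
    obtain ⟨T, hT⟩ := pad_exists k []
    refine ⟨⟨T, hT, ?_⟩, rfl, rfl, fun r => rfl, fun r j hj => by simp [rskPQ] at hj⟩
    have hF : ∀ r c, FF (fun s => w.getD (s-1) 0) u (fun _ => sqr k) (fun _ _ => 0) 0 (r, c) = 0 := by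
      intro r c
      have : ∀ (u : List ℕ) D F, (∀ x ∈ u, 1 ≤ x) → FF (fun s => w.getD (s-1) 0) u D F 0 = F 0 := by
        intro u
        induction u with
        | nil => intro D F _; rfl
        | cons x u ih =>
          intro D F h
          rw [FF, ih _ _ (fun y hy => h y (by simp [hy]))]
          funext c
          have := h x (by simp)
          simp [insF, show x ≠ 0 by omega]
      rw [this u _ _ (fun x hx => ((hu.mem x).1 hx).1)]
    rw [h0]
    intro r
    have hr := hT r
    simp only [List.getD_nil, List.map_nil, List.append_nil] at hr
    rw [hr]
    simp only [hF]
    unfold sqr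
    split_ifs with h1 h2 h2
    · refine ⟨by simp, fun j hj => ?_⟩
      simp [List.getD_eq_getElem?_getD, hj]
    · have : k = r := by omega
      simp [this]
    · omega
    · simp
  | succ t ih =>
    intro ht
    obtain ⟨⟨T, hp, hT⟩, i1, i2, i3, i4⟩ := ih (by omega)
    have hmem : t + 1 ∈ u := (hu.mem _).2 ⟨by omega, ht⟩
    obtain ⟨r, h1, h2⟩ := rskInsert_shape (rskPQ (w.take t)).1 (w.getD t 0)
    have hsucc := rskPQ_succ (by omega) h1 h2
    have hlenk : (rskInsert (w.getD t 0) (rskPQ (w.take t)).1).length ≤ k + 1 := by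
      have := rsk_len_mono (w := w) (w.length - (t+1)) (t+1) (by omega)
      rw [show t + 1 + (w.length - (t+1)) = w.length by omega, List.take_length, hsucc] at this
      simp only [setBox_length] at this
      unfold rskQ at hk
      omega
    obtain ⟨T', c, k1, k2, -, -, -⟩ := base_step (fuel := u.countP (· ≤ t) + 1 + (rskPQ (w.take t)).1.length + 1)
      (sqr_sc k) hu.nodup hu.ord hu.pos hmem hT (by omega)
    simp only [Nat.add_sub_cancel] at k1
    have hp' := rsk_mixed k (rskPQ (w.take t)).1 (w.getD t 0) 0 T []
      (u.countP (· ≤ t) + 1 + (rskPQ (w.take t)).1.length + 1) rfl (by omega) (by omega) (by simpa using hp)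
    rw [k1] at hp'
    simp only [List.nil_append] at hp'
    rw [hsucc, i2]
    simp only
    have hrk : r ≤ k := by omega
    have hQl : ∀ i, ((setBox (rskPQ (w.take t)).2 r ((rskPQ (w.take t)).1.getD r []).length (t + 1)).getD i []).length
        = ((rskInsert (w.getD t 0) (rskPQ (w.take t)).1).getD i []).length := by
      intro i
      rw [setBox_getD, h2]
      split_ifs with h
      · subst h
        rw [← i3, padSet_eq]; simp
      · rw [i3]; rfl
    refine ⟨⟨T', hp', k2⟩, by rw [setBox_length, h1, i1], ?_, hQl, ?_⟩
    · rw [tsize_new (r := r) (T := (rskPQ (w.take t)).2), i2]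
      intro i; rw [hQl, h2, i3]
    · intro i j hj
      rw [setBox_getD]
      rw [h2] at hj
      split_ifs with h
      · subst h
        rw [if_pos rfl] at hj
        rw [← i3, padSet_eq]
        by_cases hj2 : j < ((rskPQ (w.take t)).1.getD i []).length
        · rw [← i4 i j hj2]
          rw [List.getD_eq_getElem?_getD, List.getElem?_append_left (by rw [i3]; exact hj2), ← List.getD_eq_getElem?_getD]
        · have hj3 : j = ((rskPQ (w.take t)).2.getD i []).length := by rw [i3]; omega
          rw [hj3, birth_eq (t := t) C]
          · simp [List.getD_eq_getElem?_getD]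
          · have a := (hT i).1
            rw [hp i, if_pos hrk] at a
            simp only [List.length_append, List.length_replicate, List.length_map] at a
            rw [i3]
            omega
          · have a := (k2 i).1
            rw [hp' i, if_pos hrk] at a
            simp only [List.length_append, List.length_replicate, List.length_map] at a
            rw [h2 i, if_pos rfl] at a
            rw [i3]
            omega
      · rw [if_neg h] at hj
        exact i4 i j hj

theorem rsk_rp {k : ℕ} {w u : List ℕ} (hu : TSorted w.length (fun s => w.getD (s-1) 0) u)
    (hk : (rskQ w).length ≤ k + 1) :
    Rp w.length (embedShift k (rskQ w)) (u.foldl (InsG bump) (fun _ => sqr k)) := by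
  obtain ⟨C, hfr⟩ := foldl_chain (chain_base (sqr_sc k)) (fun x _ => free_base _ x) hu.nodup
  obtain ⟨⟨T, hp, hT⟩, i1, i2, i3, i4⟩ := rsk_inv hu hk w.length le_rfl
  rw [List.take_length] at hp i1 i2 i3 i4
  have h0 : u.foldl (InsG bump) (fun _ => sqr k) 0 = sqr k :=
      foldl_early (fun x hx => by have := (hu.mem x).1 hx; omega)
  have hlen : ∀ r, u.foldl (InsG bump) (fun _ => sqr k) w.length r - r =
      if r ≤ k then k - r + ((rskQ w).getD r []).length else 0 := by
    intro r
    rw [← (hT r).1, hp r]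
    unfold rskQ
    rw [i3]
    split_ifs <;> simp
  have hbig : ∀ r, k < r → (rskQ w).getD r [] = [] := by
    intro r hr
    rw [List.getD_eq_default _ _ (by omega)]
  refine rp_of C ?_ ?_ ?_ ?_ ?_
  · intro t ht
    exact hfr (t+1) (fun h => by have := (hu.mem _).1 h; omega) (free_base _ _) t rfl
  · intro r c hc
    unfold embedShift toFunStraight
    split_ifs with h
    · simp only
      rw [hbig r (by omega)]; rfl
    · rfl
  · intro r c hrc hc
    rw [h0] at hc
    unfold sqr at hc
    unfold embedShift
    rw [if_neg]
    split_ifs at hc <;> simp only <;> omega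
  · intro r c hrc hc
    unfold embedShift toFunStraight
    split_ifs with h
    · simp only at h ⊢
      apply List.getD_eq_default
      have := hlen r
      split_ifs at this with h2
      · omega
      · rw [hbig r (by omega)]; simp
    · rfl
  · intro r c hrc hc0 hc
    rw [h0] at hc0
    have a := hlen r
    have hrk : r ≤ k := by
      by_contra h
      rw [if_neg h] at a; omega
    rw [if_pos hrk] at a
    have hkc : k ≤ c := by
      unfold sqr at hc0
      split_ifs at hc0 <;> omega
    unfold embedShift toFunStraight
    rw [if_pos hkc]
    simp only
    have := i4 r (c - k) (by rw [← i3]; unfold rskQ at a; omega)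
    rw [show k + (c - k) = c by omega] at this
    exact this

theorem sorted_exists (n : ℕ) (val : ℕ → ℕ) (hv : ∀ s, 1 ≤ s → s ≤ n → 1 ≤ val s) : ∃ u, TSorted n val u := by
  let le : ℕ → ℕ → Bool := fun a b => decide (val a < val b ∨ (val a = val b ∧ a ≤ b))
  have hperm := List.mergeSort_perm (List.range' 1 n) le
  have hpw : (List.mergeSort (List.range' 1 n) le).Pairwise (fun a b => le a b = true) := by
    apply List.pairwise_mergeSort
    · intro a b c h1 h2
      simp only [le, decide_eq_true_iff] at *
      omega
    · intro a b
      simp only [le, Bool.or_eq_true, decide_eq_true_iff]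
      omega
  have hnd : (List.mergeSort (List.range' 1 n) le).Nodup := hperm.nodup_iff.2 List.nodup_range'
  have hmem : ∀ s, s ∈ List.mergeSort (List.range' 1 n) le ↔ 1 ≤ s ∧ s ≤ n := by
    intro s
    rw [hperm.mem_iff, List.mem_range'_1]
    omega
  refine ⟨_, hnd, hmem, ?_, fun x hx => hv x ((hmem x).1 hx).1 ((hmem x).1 hx).2⟩
  refine (hpw.and hnd).imp ?_
  intro a b h
  simp only [le, decide_eq_true_iff] at h
  unfold LOrd
  omega

theorem final_thm (w : List ℕ) (hw : ∀ x ∈ w, 1 ≤ x) (k : ℕ) (hk : (rskQ w).length ≤ k + 1) :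
    (∃ g, Relation.ReflTransGen (JdtStep (w.length + 1)) (embedShift k (rskQ w)) g ∧ IsRectifiedShifted g) ∧
    (∀ g, Relation.ReflTransGen (JdtStep (w.length + 1)) (embedShift k (rskQ w)) g → IsRectifiedShifted g →
      g = toFunShifted (mixedQ w)) := by
  obtain ⟨u, hu⟩ := sorted_exists w.length (fun s => w.getD (s-1) 0) (by
    intro s h1 h2
    rw [List.getD_eq_getElem _ _ (by omega)]
    exact hw _ (List.getElem_mem _))
  have h0 : u.foldl (InsG bump) (fun _ => sqr k) 0 = sqr k :=
      foldl_early (fun x hx => by have := (hu.mem x).1 hx; omega)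
  exact geom_main (rsk_rp hu hk) hu.nodup (fun x hx => ((hu.mem x).1 hx).1) (by rw [h0]) (mixed_rp hu)

/-- (Serrano, Theorem 2.26.)  Let `w` be a word (over the positive integers).  If the RSK
recording tableau `Q(w)` is viewed as a skew shifted standard Young tableau (embedded with
any valid offset `k`) and jeu de taquin is applied to obtain a standard shifted Young
tableau, the result is the shifted mixed insertion recording tableau `Q'(w)`, independent
of any choices made in applying jeu de taquin: some sequence of inward slides reaches a
rectified filling, and every rectified filling reachable by inward slides equals `Q'(w)`. -/
theorem rectification_of_recording_tableau_is_mixed_recording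
    (w : List ℕ) (hw : ∀ x ∈ w, 1 ≤ x) (k : ℕ) (hk : (rskQ w).length ≤ k + 1) :
    (∃ g, Relation.ReflTransGen (JdtStep (w.length + 1)) (embedShift k (rskQ w)) g ∧
        IsRectifiedShifted g) ∧
    (∀ g, Relation.ReflTransGen (JdtStep (w.length + 1)) (embedShift k (rskQ w)) g →
        IsRectifiedShifted g → g = toFunShifted (mixedQ w)) := by
  exact final_thm w hw k hk
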